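/- Let d ≥ 3 and suppose u > 0 is strongly supercritical. Then there exists λ = λ(u) > 0 such that for every ρ > 0 there is a constant c = c(d,u,ρ) > 0 with P[ |C^u_sec| > (log N)^λ ] ≤ c N^{−ρ} for all N ≥ 2. -/

import Mathlib

open MeasureTheory Filter Classical
open scoped ENNReal NNReal

noncomputable section

namespace Frag

/-! ### Graph-theoretic basics -/

/-- Two vertices of `Fin d → R` are adjacent if they differ in exactly one
coordinate, by `±1` (Euclidean distance one). -/
def adj {d : ℕ} {R : Type*} [AddGroupWithOne R] (x y : Fin d → R) : Prop :=
  x ≠ y ∧ ∃ i : Fin d, (y i = x i + 1 ∨ x i = y i + 1) ∧ ∀ j : Fin d, j ≠ i → x j = y j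

/-- The discrete torus `(ℤ/Nℤ)^d`. -/
abbrev Torus (d N : ℕ) := Fin d → ZMod N

/-- The lattice `ℤ^d`. -/
abbrev Lat (d : ℕ) := Fin d → ℤ

instance (n : ℕ) : MeasurableSpace (ZMod n) := ⊤

/-- The `ℓ∞`-distance on the torus. -/
def torusDist {d N : ℕ} (x y : Torus d N) : ℕ :=
  Finset.univ.sup fun i : Fin d => min (x i - y i).val (y i - x i).val

/-- The `ℓ∞`-distance on the lattice. -/
def latDist {d : ℕ} (x y : Lat d) : ℕ :=
  Finset.univ.sup fun i : Fin d => (x i - y i).natAbs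

/-- Closed `ℓ∞`-ball in the torus. -/
def torusBall {d N : ℕ} (x : Torus d N) (r : ℝ) : Set (Torus d N) :=
  {y | (torusDist x y : ℝ) ≤ r}

/-- Closed `ℓ∞`-ball in the lattice. -/
def latBall {d : ℕ} (x : Lat d) (r : ℝ) : Set (Lat d) :=
  {y | (latDist x y : ℝ) ≤ r}

/-- `x` and `y` are connected by a nearest-neighbour path staying in `S`. -/
def connectedIn {α : Type*} (rel : α → α → Prop) (S : Set α) (x y : α) : Prop :=
  ∃ (n : ℕ) (p : ℕ → α), p 0 = x ∧ p n = y ∧ (∀ k, k ≤ n → p k ∈ S) ∧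
    ∀ k, k < n → rel (p k) (p (k + 1))

/-- The connected component of `x` inside `S`. -/
def compOf {α : Type*} (rel : α → α → Prop) (S : Set α) (x : α) : Set α :=
  {y | connectedIn rel S x y}

/-- `S` is a connected set. -/
def IsConnSet {α : Type*} (rel : α → α → Prop) (S : Set α) : Prop :=
  ∀ x ∈ S, ∀ y ∈ S, connectedIn rel S x y

/-- External vertex boundary. -/
def extBdry {α : Type*} (rel : α → α → Prop) (S : Set α) : Set α :=
  {y | y ∉ S ∧ ∃ x ∈ S, rel x y}

/-- Internal vertex boundary. -/
def intBdry {α : Type*} (rel : α → α → Prop) (S : Set α) : Set α :=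
  {x | x ∈ S ∧ ∃ y, y ∉ S ∧ rel x y}

/-- The cardinality of the largest connected component of `S`. -/
def maxCompSize {α : Type*} (rel : α → α → Prop) (S : Set α) : ℕ :=
  sSup {n | ∃ x ∈ S, n = (compOf rel S x).ncard}

/-- The diameter of a set with respect to a distance. -/
def diamOf {α : Type*} (dist : α → α → ℕ) (S : Set α) : ℕ :=
  sSup {n | ∃ x ∈ S, ∃ y ∈ S, n = dist x y}

/-- The canonical graph isomorphism `φ` from `B(0, N/4) ⊆ (ℤ/Nℤ)^d` onto
`B(0, N/4) ⊆ ℤ^d`, given by the signed representative of each coordinate. -/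
def torusToLat {d N : ℕ} (x : Torus d N) : Lat d :=
  fun i => if ((x i).val : ℝ) ≤ (N : ℝ) / 2 then ((x i).val : ℤ) else ((x i).val : ℤ) - (N : ℤ)

/-! ### Discrete-time simple random walk -/

/-- One-step transition probability of the simple random walk. -/
def srwStep {d : ℕ} {R : Type*} [AddGroupWithOne R] (x y : Fin d → R) : ℝ≥0∞ :=
  if adj x y then ((2 * d : ℕ) : ℝ≥0∞)⁻¹ else 0

/-- `μ` is the law on path space of the discrete-time simple random walk with
initial distribution `init`, characterized by its cylinder probabilities. -/
def IsWalkLaw {d : ℕ} {R : Type*} [AddGroupWithOne R] [MeasurableSpace R]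
    (μ : Measure (ℕ → (Fin d → R))) (init : (Fin d → R) → ℝ≥0∞) : Prop :=
  IsProbabilityMeasure μ ∧
  ∀ (n : ℕ) (w : ℕ → (Fin d → R)),
    μ {ω | ∀ k, k ≤ n → ω k = w k} =
      init (w 0) * ∏ k ∈ Finset.range n, srwStep (w k) (w (k + 1))

/-- The uniform initial distribution on the torus. -/
def unifInit (d N : ℕ) : Torus d N → ℝ≥0∞ := fun _ => ((N : ℝ≥0∞) ^ d)⁻¹

/-- The initial distribution concentrated at `x`. -/
def pointInit {α : Type*} (x : α) : α → ℝ≥0∞ := fun y => if y = x then 1 else 0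

/-- The set of sites visited in the first `t` steps. -/
def visited {α : Type*} (t : ℕ) (ω : ℕ → α) : Set α := {v | ∃ k, k ≤ t ∧ ω k = v}

/-! ### Capacity and random interlacements on `ℤ^d` -/

/-- The event that the walk never returns to `V` after time `0`. -/
def escEvent {d : ℕ} (V : Set (Lat d)) : Set (ℕ → Lat d) :=
  {w | ∀ n, 1 ≤ n → w n ∉ V}

/-- `r` is the (simple random walk) capacity of `V ⊆ ℤ^d`:
`r = Σ_{x ∈ V} P_x[H̃_V = ∞]`. -/
def IsCap (d : ℕ) (V : Set (Lat d)) (r : ℝ) : Prop :=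
  ∃ μ : Lat d → Measure (ℕ → Lat d),
    (∀ x, IsWalkLaw (μ x) (pointInit x)) ∧
    r = ∑ᶠ x ∈ V, ((μ x) (escEvent V)).toReal

/-- `I` is a random interlacement at level `u` on the probability space `(Ω, P)`:
for every finite `V ⊆ ℤ^d`, `P[I ∩ V = ∅] = exp (−u · cap V)`. -/
def IsInterlacement (d : ℕ) (u : ℝ) {Ω : Type*} [MeasurableSpace Ω]
    (P : Measure Ω) (I : Ω → Set (Lat d)) : Prop :=
  IsProbabilityMeasure P ∧
  (∀ x : Lat d, MeasurableSet {ω | x ∈ I ω}) ∧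
  ∀ V : Set (Lat d), V.Finite → ∀ r : ℝ, IsCap d V r →
    P {ω | ∀ x ∈ V, x ∉ I ω} = ENNReal.ofReal (Real.exp (-u * r))

/-- `e = η(u)`, the probability that the origin lies in an infinite component of
the vacant set `V^u = ℤ^d ∖ I^u` of a random interlacement at level `u`. -/
def IsEta (d : ℕ) (u e : ℝ) : Prop :=
  ∃ (Ω : Type) (_ : MeasurableSpace Ω) (P : Measure Ω) (I : Ω → Set (Lat d)),
    IsInterlacement d u P I ∧
    e = (P {ω | (compOf adj ((I ω)ᶜ) (0 : Lat d)).Infinite}).toReal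

/-- The critical level `u_* = inf {u ≥ 0 : η(u) = 0}`. -/
def uStar (d : ℕ) : ℝ := sInf {u | 0 ≤ u ∧ IsEta d u 0}

/-- The probability of an event `E` about a random interlacement at level `u`. -/
def intProb (d : ℕ) (u : ℝ) (E : Set (Lat d) → Prop) : ℝ :=
  sSup {p | ∃ (Ω : Type) (_ : MeasurableSpace Ω) (P : Measure Ω) (I : Ω → Set (Lat d)),
    IsInterlacement d u P I ∧ p = (P {ω | E (I ω)}).toReal}

/-- The event that `B(0,L)` is connected to the external boundary of `B(0,2L)`
by a nearest-neighbour path in `S`. -/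
def connAcross (d L : ℕ) (S : Set (Lat d)) : Prop :=
  ∃ x ∈ latBall (0 : Lat d) (L : ℝ), ∃ y ∈ extBdry adj (latBall (0 : Lat d) (2 * (L : ℝ))),
    connectedIn adj S x y

/-- The critical level `u_** = inf {u ≥ 0 : α(u) > 0}`. -/
def uStarStar (d : ℕ) : ℝ :=
  sInf {u | 0 ≤ u ∧ ∃ a : ℝ, 0 < a ∧
    Tendsto (fun L : ℕ => (L : ℝ) ^ a * intProb d u fun I => connAcross d L Iᶜ)
      atTop (nhds 0)}

/-- `u` is a strongly supercritical level for random interlacements on `ℤ^d`. -/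
def StronglySupercritical (d : ℕ) (u : ℝ) : Prop :=
  ∃ μ : ℝ, 0 < μ ∧
  ∃ (Ω : Type) (_ : MeasurableSpace Ω) (P : Measure Ω) (I : ℝ → Ω → Set (Lat d)),
    (∀ v : ℝ, 0 ≤ v → IsInterlacement d v P (I v)) ∧
    (∀ v v' : ℝ, v ≤ v' → ∀ ω, I v ω ⊆ I v' ω) ∧
    ∃ N₀ : ℕ, ∀ N : ℕ, N₀ ≤ N →
      (1 - Real.exp (-(N : ℝ) ^ μ) ≤
        (P {ω | ∃ x ∈ latBall (0 : Lat d) (N : ℝ),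
          (compOf adj ((I (u * (1 + μ)) ω)ᶜ) x).Infinite}).toReal) ∧
      (1 - Real.exp (-(N : ℝ) ^ μ) ≤
        (P {ω | ∀ S₁ S₂ : Set (Lat d),
            S₁ ⊆ (I (u * (1 - μ)) ω)ᶜ ∩ latBall 0 (N : ℝ) →
            S₂ ⊆ (I (u * (1 - μ)) ω)ᶜ ∩ latBall 0 (N : ℝ) →
            IsConnSet adj S₁ → IsConnSet adj S₂ →
            (N : ℝ) / 8 ≤ (diamOf latDist S₁ : ℝ) →
            (N : ℝ) / 8 ≤ (diamOf latDist S₂ : ℝ) →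
            ∃ x ∈ S₁, ∃ y ∈ S₂,
              connectedIn adj ((I (u * (1 + μ)) ω)ᶜ ∩ latBall 0 (2 * (N : ℝ))) x y}).toReal)

/-! ### Continuous-time walk -/

/-- Sample space for the continuous-time walk: a discrete path together with
the i.i.d. exponential interarrival gaps of the driving Poisson process. -/
abbrev CTPath (d N : ℕ) := (ℕ → Torus d N) × (ℕ → ℝ)

/-- The number of jumps performed up to time `t`. -/
def nJumps (g : ℕ → ℝ) (t : ℝ) : ℕ := sSup {n | ∑ k ∈ Finset.range n, g k ≤ t}

/-- The position of the continuous-time walk at time `t`. -/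
def ctPos {d N : ℕ} (ω : CTPath d N) (t : ℝ) : Torus d N := ω.1 (nJumps ω.2 t)

/-- `ν` is the law of an i.i.d. sequence of exponential random variables of
parameter `1`, characterized by its joint survival function. -/
def IsIIDExp (ν : Measure (ℕ → ℝ)) : Prop :=
  IsProbabilityMeasure ν ∧
  ∀ (n : ℕ) (s : ℕ → ℝ), (∀ k, 0 ≤ s k) →
    ν {g | ∀ k, k ≤ n → s k < g k} =
      ENNReal.ofReal (Real.exp (-(∑ k ∈ Finset.range (n + 1), s k)))

/-- `P` is the law of the continuous-time simple random walk `Y_t = X_{N_t}`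
with initial distribution `init`. -/
def IsCTWalk {d N : ℕ} (P : Measure (CTPath d N)) (init : Torus d N → ℝ≥0∞) : Prop :=
  ∃ (μ : Measure (ℕ → Torus d N)) (ν : Measure (ℕ → ℝ)),
    IsWalkLaw μ init ∧ IsIIDExp ν ∧ P = μ.prod ν

/-- The entrance time `H_V = inf {t ≥ 0 : Y_t ∈ V}`. -/
def hitT {d N : ℕ} (V : Set (Torus d N)) (ω : CTPath d N) : ℝ :=
  sInf {t | 0 ≤ t ∧ ctPos ω t ∈ V}

/-- The entrance time to `V` after time `s`. -/
def hitTAfter {d N : ℕ} (V : Set (Torus d N)) (ω : CTPath d N) (s : ℝ) : ℝ :=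
  sInf {t | s ≤ t ∧ ctPos ω t ∈ V}

/-- The exit time `T_V = inf {t ≥ 0 : Y_t ∉ V}`. -/
def exitT {d N : ℕ} (V : Set (Torus d N)) (ω : CTPath d N) : ℝ :=
  sInf {t | 0 ≤ t ∧ ctPos ω t ∉ V}

/-- The regeneration time `t_* = (N log N)^2`. -/
def tstar (N : ℕ) : ℝ := ((N : ℝ) * Real.log N) ^ 2

/-- The first time `t ≥ s + t_*` such that the walk has avoided `B` during the
whole interval `[t − t_*, t]`. -/
def uEndAfter {d N : ℕ} (B : Set (Torus d N)) (ω : CTPath d N) (s : ℝ) : ℝ :=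
  sInf {t | s + tstar N ≤ t ∧ ∀ r, t - tstar N ≤ r → r ≤ t → ctPos ω r ∉ B}

/-- The successive excursion times `(R_k, U_k)` between `A` and (long absences
from) `B`, with the convention `(R_0, U_0) = (0, 0)`. -/
def excTimes {d N : ℕ} (A B : Set (Torus d N)) (ω : CTPath d N) : ℕ → ℝ × ℝ
  | 0 => (0, 0)
  | k + 1 =>
      let R := hitTAfter A ω (excTimes A B ω k).2
      (R, uEndAfter B ω R)

/-- The range of the continuous-time walk during the time interval `[a, b]`. -/
def ctRange {d N : ℕ} (ω : CTPath d N) (a b : ℝ) : Set (Torus d N) :=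
  {v | ∃ t, a ≤ t ∧ t ≤ b ∧ ctPos ω t = v}

/-! ### The killed walk and the quasistationary distribution -/

/-- The action of the substochastic matrix `P^B` (walk killed on `B`) on a
vector `v`. -/
def killedMul (d N : ℕ) (B : Set (Torus d N)) (v : Torus d N → ℝ) (x : Torus d N) : ℝ :=
  ∑ᶠ y : Torus d N, if y ∉ B ∧ adj x y then v y / (2 * d) else 0

/-- `l` is an eigenvalue of the killed transition matrix `P^B`. -/
def IsKilledEigenvalue (d N : ℕ) (B : Set (Torus d N)) (l : ℝ) : Prop :=
  ∃ v : Torus d N → ℝ, v ≠ 0 ∧ (∀ x ∈ B, v x = 0) ∧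
    ∀ x, x ∉ B → killedMul d N B v x = l * v x

/-- `σ` is the quasistationary distribution on `T ∖ B`: the normalized
non-negative principal (Perron–Frobenius) eigenvector of `P^B`. -/
def IsQSD (d N : ℕ) (B : Set (Torus d N)) (σ : Torus d N → ℝ) : Prop :=
  (∀ x, 0 ≤ σ x) ∧ (∀ x ∈ B, σ x = 0) ∧ (∑ᶠ x, σ x = 1) ∧
  ∃ l : ℝ, (∀ x, x ∉ B → killedMul d N B σ x = l * σ x) ∧
    ∀ l', IsKilledEigenvalue d N B l' → l' ≤ l

/-- The Dirichlet form of the simple random walk on the torus. -/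
def dirichlet (d N : ℕ) (g : Torus d N → ℝ) : ℝ :=
  (1 / 2) * ∑ᶠ x : Torus d N, ∑ᶠ y : Torus d N,
    if adj x y then (g x - g y) ^ 2 / (2 * d * (N : ℝ) ^ d) else 0

end Frag

namespace Frag

/-! ### The averaging operator and hitting functions -/

/-- The signed unit vector in direction `i`. -/
def dir {d : ℕ} {R : Type*} [CommRing R] (p : Fin d × Bool) : Fin d → R :=
  Pi.single p.1 (if p.2 then 1 else -1)

/-- The average of `f` over the neighbours of `x`. -/
def avg {d : ℕ} {R : Type*} [CommRing R] (f : (Fin d → R) → ℝ) (x : Fin d → R) : ℝ :=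
  (2 * d : ℝ)⁻¹ * ∑ p : Fin d × Bool, f (x + dir p)

section Avg

variable {d : ℕ} {R : Type*} [CommRing R]

lemma neg_dir (p : Fin d × Bool) : -(dir p : Fin d → R) = dir (p.1, !p.2) := by
  obtain ⟨i, s⟩ := p
  unfold dir
  rw [← Pi.single_neg]
  cases s <;> simp

lemma avg_mono {f g : (Fin d → R) → ℝ} {x : Fin d → R}
    (h : ∀ p, f (x + dir p) ≤ g (x + dir p)) : avg f x ≤ avg g x := by
  unfold avg
  gcongr with p
  exact h p

lemma avg_nonneg {f : (Fin d → R) → ℝ} {x : Fin d → R}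
    (h : ∀ p, 0 ≤ f (x + dir p)) : 0 ≤ avg f x := by
  unfold avg
  exact mul_nonneg (by positivity) (Finset.sum_nonneg fun p _ => h p)

lemma avg_const (hd : 0 < d) (c : ℝ) (x : Fin d → R) : avg (fun _ => c) x = c := by
  unfold avg
  have : (d : ℝ) ≠ 0 := by positivity
  simp
  field_simp

lemma avg_le_const (hd : 0 < d) {f : (Fin d → R) → ℝ} {c : ℝ} {x : Fin d → R}
    (h : ∀ z, f z ≤ c) : avg f x ≤ c :=
  (avg_mono fun _ => h _).trans_eq (avg_const hd c x)

lemma avg_add (f g : (Fin d → R) → ℝ) (x : Fin d → R) :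
    avg (fun z => f z + g z) x = avg f x + avg g x := by
  unfold avg
  rw [Finset.sum_add_distrib, mul_add]

lemma avg_sub (f g : (Fin d → R) → ℝ) (x : Fin d → R) :
    avg (fun z => f z - g z) x = avg f x - avg g x := by
  unfold avg
  rw [Finset.sum_sub_distrib, mul_sub]

lemma avg_const_mul (c : ℝ) (f : (Fin d → R) → ℝ) (x : Fin d → R) :
    avg (fun z => c * f z) x = c * avg f x := by
  unfold avg
  rw [← Finset.mul_sum]
  ring

lemma avg_sum {ι : Type*} (s : Finset ι) (f : ι → (Fin d → R) → ℝ) (x : Fin d → R) :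
    avg (fun z => ∑ i ∈ s, f i z) x = ∑ i ∈ s, avg (f i) x := by
  unfold avg
  rw [Finset.sum_comm, Finset.mul_sum]

lemma avg_tendsto {ι : Type*} {l : Filter ι} {f : ι → (Fin d → R) → ℝ} {g : (Fin d → R) → ℝ}
    (h : ∀ z, Tendsto (fun n => f n z) l (nhds (g z))) (x : Fin d → R) :
    Tendsto (fun n => avg (f n) x) l (nhds (avg g x)) := by
  unfold avg
  exact (tendsto_finsetSum _ fun p _ => h _).const_mul _

lemma avg_shift (f : (Fin d → R) → ℝ) (a x : Fin d → R) :
    avg (fun z => f (z - a)) x = avg f (x - a) := by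
  unfold avg
  congr 1
  refine Finset.sum_congr rfl fun p _ => ?_
  rw [sub_add_eq_add_sub]

lemma avg_neg (f : (Fin d → R) → ℝ) (x : Fin d → R) :
    avg (fun z => f (-z)) x = avg f (-x) := by
  unfold avg
  congr 1
  refine Fintype.sum_equiv ((Equiv.refl _).prodCongr Equiv.boolNot) _ _ fun p => ?_
  simp only [Equiv.prodCongr_apply, Prod.map, Equiv.refl_apply, Equiv.boolNot_apply]
  rw [← neg_dir, neg_add]

lemma sum_avg_mul [Fintype R] (f g : (Fin d → R) → ℝ) :
    ∑ z, avg f z * g z = ∑ z, f z * avg g z := by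
  unfold avg
  simp only [Finset.mul_sum, Finset.sum_mul]
  rw [Finset.sum_comm, Finset.sum_comm (s := Finset.univ (α := Fin d → R))]
  refine Fintype.sum_equiv ((Equiv.refl _).prodCongr Equiv.boolNot) _ _ fun p => ?_
  refine Fintype.sum_equiv (Equiv.addRight (dir p)) _ _ fun z => ?_
  simp only [Equiv.prodCongr_apply, Prod.map, Equiv.refl_apply, Equiv.boolNot_apply,
    Equiv.coe_addRight]
  rw [← neg_dir]
  simp only [add_neg_cancel_right]
  ring

end Avg

/-- The probability-weighted boundary value `f` picked up when hitting `B` within `n` steps. -/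
def hitIter {d : ℕ} {R : Type*} [CommRing R] (B : Finset (Fin d → R)) (f : (Fin d → R) → ℝ) :
    ℕ → (Fin d → R) → ℝ
  | 0 => fun z => if z ∈ B then f z else 0
  | n + 1 => fun z => if z ∈ B then f z else avg (hitIter B f n) z

/-- The expected boundary value `f` at the hitting point of `B`. -/
def hit {d : ℕ} {R : Type*} [CommRing R] (B : Finset (Fin d → R)) (f : (Fin d → R) → ℝ)
    (z : Fin d → R) : ℝ := ⨆ n, hitIter B f n z

section Hit

variable {d : ℕ} {R : Type*} [CommRing R] {B : Finset (Fin d → R)} {f : (Fin d → R) → ℝ} {M : ℝ}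

lemma hitIter_nonneg (hf : ∀ z, 0 ≤ f z) (n : ℕ) (z : Fin d → R) : 0 ≤ hitIter B f n z := by
  induction n generalizing z with
  | zero => unfold hitIter; split_ifs <;> simp [hf]
  | succ n ih => unfold hitIter; split_ifs; exacts [hf z, avg_nonneg fun p => ih _]

lemma hitIter_le_of_super {g : (Fin d → R) → ℝ} (hg : ∀ z, 0 ≤ g z) (hB : ∀ z ∈ B, f z ≤ g z)
    (hs : ∀ z, z ∉ B → avg g z ≤ g z) (n : ℕ) (z : Fin d → R) : hitIter B f n z ≤ g z := by
  induction n generalizing z with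
  | zero => unfold hitIter; split_ifs with h; exacts [hB z h, hg z]
  | succ n ih =>
    unfold hitIter; split_ifs with h
    exacts [hB z h, (avg_mono fun p => ih _).trans (hs z h)]

lemma hitIter_mono (hf : ∀ z, 0 ≤ f z) (z : Fin d → R) : Monotone fun n => hitIter B f n z := by
  refine monotone_nat_of_le_succ fun n => ?_
  induction n generalizing z with
  | zero =>
    by_cases h : z ∈ B
    · simp [hitIter, h]
    · simp only [hitIter, h, if_false]
      refine avg_nonneg fun p => ?_
      split_ifs <;> simp [hf]
  | succ n ih =>
    by_cases h : z ∈ B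
    · simp [hitIter, h]
    · simp only [hitIter, h, if_false] at ih ⊢
      exact avg_mono fun p => ih _

lemma hit_tendsto (hd : 0 < d) (hf : ∀ z, 0 ≤ f z) (hM : ∀ z, f z ≤ M) (z : Fin d → R) :
    Tendsto (fun n => hitIter B f n z) atTop (nhds (hit B f z)) := by
  refine tendsto_atTop_ciSup (hitIter_mono hf z) ⟨M, ?_⟩
  rintro _ ⟨n, rfl⟩
  exact hitIter_le_of_super (g := fun _ => M) (fun z => (hf z).trans (hM z)) (fun z _ => hM z)
    (fun z _ => (avg_const hd M z).le) n z

lemma hit_nonneg (hf : ∀ z, 0 ≤ f z) (z : Fin d → R) : 0 ≤ hit B f z :=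
  Real.iSup_nonneg fun n => hitIter_nonneg hf n z

lemma hit_le_of_super {g : (Fin d → R) → ℝ} (hg : ∀ z, 0 ≤ g z) (hB : ∀ z ∈ B, f z ≤ g z)
    (hs : ∀ z, z ∉ B → avg g z ≤ g z) (z : Fin d → R) : hit B f z ≤ g z :=
  ciSup_le fun n => hitIter_le_of_super hg hB hs n z

lemma hit_on {z : Fin d → R} (hz : z ∈ B) : hit B f z = f z := by
  have : ∀ n, hitIter B f n z = f z := by
    intro n; cases n <;> simp [hitIter, hz]
  simp [hit, this]

lemma hit_off (hd : 0 < d) (hf : ∀ z, 0 ≤ f z) (hM : ∀ z, f z ≤ M) {z : Fin d → R}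
    (hz : z ∉ B) : hit B f z = avg (hit B f) z := by
  refine tendsto_nhds_unique ((hit_tendsto hd hf hM z).comp (tendsto_add_atTop_nat 1)) ?_
  have : (fun n => hitIter B f n z) ∘ (fun n => n + 1) = fun n => avg (hitIter B f n) z := by
    funext n; simp [hitIter, hz]
  rw [this]
  exact avg_tendsto (fun z => hit_tendsto hd hf hM z) z

/-- A sequence of iterates of a (possibly lazy) averaging scheme is dominated by `hit`. -/
lemma le_hit (hd : 0 < d) (hf : ∀ z, 0 ≤ f z) (hM : ∀ z, f z ≤ M) {g : ℕ → (Fin d → R) → ℝ}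
    {c : ℝ} (hc0 : 0 ≤ c) (hc1 : c ≤ 1) (hB : ∀ n, ∀ z ∈ B, g n z ≤ f z)
    (h0 : ∀ z, z ∉ B → g 0 z ≤ 0)
    (hs : ∀ n z, z ∉ B → g (n + 1) z ≤ c * g n z + (1 - c) * avg (g n) z) (n : ℕ)
    (z : Fin d → R) : g n z ≤ hit B f z := by
  induction n generalizing z with
  | zero =>
    by_cases hz : z ∈ B
    · rw [hit_on hz]; exact hB 0 z hz
    · exact (h0 z hz).trans (hit_nonneg hf z)
  | succ n ih =>
    by_cases hz : z ∈ B
    · rw [hit_on hz]; exact hB _ z hz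
    · have h1 : avg (g n) z ≤ hit B f z := by
        rw [hit_off hd hf hM hz]; exact avg_mono fun p => ih _
      have h2 := ih z
      have h3 := hs n z hz
      nlinarith

/-- The harmonic measure: the probability, from `z`, that `B` is first hit at `y`. -/
def harm (B : Finset (Fin d → R)) (y : Fin d → R) : (Fin d → R) → ℝ :=
  hit B fun z => if z = y then 1 else 0

lemma harm_nonneg (y z : Fin d → R) : 0 ≤ harm B y z :=
  hit_nonneg (fun z => by split_ifs <;> simp) z

lemma harm_on {y z : Fin d → R} (hz : z ∈ B) : harm B y z = if z = y then 1 else 0 :=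
  hit_on hz

lemma harm_off (hd : 0 < d) (y : Fin d → R) {z : Fin d → R} (hz : z ∉ B) :
    harm B y z = avg (harm B y) z :=
  hit_off (M := 1) hd (fun z => by split_ifs <;> simp) (fun z => by split_ifs <;> simp) hz

lemma hit_eq_sum (hd : 0 < d) (hf : ∀ z, 0 ≤ f z) (hM : ∀ z, f z ≤ M) (z : Fin d → R) :
    hit B f z = ∑ y ∈ B, f y * harm B y z := by
  have h1 : ∀ n z, hitIter B f n z
      = ∑ y ∈ B, f y * hitIter B (fun w => if w = y then 1 else 0) n z := by
    intro n
    induction n with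
    | zero =>
      intro z
      by_cases hz : z ∈ B <;> simp [hitIter, hz]
    | succ n ih =>
      intro z
      by_cases hz : z ∈ B
      · simp [hitIter, hz]
      · simp only [hitIter, hz, if_false]
        rw [funext ih, avg_sum]
        exact Finset.sum_congr rfl fun y _ => avg_const_mul _ _ _
  refine tendsto_nhds_unique (hit_tendsto hd hf hM z) ?_
  simp only [h1]
  exact tendsto_finsetSum _ fun y _ => (hit_tendsto (M := 1) hd
    (fun z => by split_ifs <;> simp) (fun z => by split_ifs <;> simp) z).const_mul _

end Hit

section Fourier

variable {d N : ℕ} [NeZero N]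

/-- The character of the torus with frequency `ξ`. -/
def chr (ξ x : Torus d N) : ℂ := ∏ i, ZMod.stdAddChar (ξ i * x i)

/-- Half the eigenvalue of `1 - avg` at the frequency `ξ`. -/
def symb (ξ : Torus d N) : ℝ := (2 * d : ℝ)⁻¹ * ∑ i, (1 - (ZMod.stdAddChar (ξ i)).re)

lemma chr_add (ξ x y : Torus d N) : chr ξ (x + y) = chr ξ x * chr ξ y := by
  simp [chr, mul_add, AddChar.map_add_eq_mul, Finset.prod_mul_distrib]

lemma chr_dir (ξ : Torus d N) (p : Fin d × Bool) :
    chr ξ (dir p) = ZMod.stdAddChar (if p.2 then ξ p.1 else -ξ p.1) := by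
  obtain ⟨i, s⟩ := p
  unfold chr dir
  rw [Finset.prod_eq_single i]
  · cases s <;> simp
  · intro j _ hj
    simp [hj]
  · simp

lemma sum_chr_dir (ξ : Torus d N) (i : Fin d) :
    chr ξ (dir (i, true)) + chr ξ (dir (i, false)) = (2 * (ZMod.stdAddChar (ξ i)).re : ℝ) := by
  rw [chr_dir, chr_dir]
  simp only [if_true, Bool.false_eq_true, if_false]
  rw [AddChar.map_neg_eq_conj, Complex.add_conj]

lemma norm_chr (ξ x : Torus d N) : ‖chr ξ x‖ = 1 := by
  simp [chr, norm_prod, AddChar.norm_apply]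

lemma abs_chr_re_le (ξ x : Torus d N) : |(chr ξ x).re| ≤ 1 :=
  (Complex.abs_re_le_norm _).trans (norm_chr ξ x).le

lemma avg_chr (hd : 0 < d) (ξ x : Torus d N) :
    avg (fun z => (chr ξ z).re) x = (1 - 2 * symb ξ) * (chr ξ x).re := by
  have h1 : ∑ p : Fin d × Bool, (chr ξ (x + dir p)).re
      = (∑ i, 2 * (ZMod.stdAddChar (ξ i)).re) * (chr ξ x).re := by
    rw [Fintype.sum_prod_type, Finset.sum_mul]
    refine Finset.sum_congr rfl fun i _ => ?_
    rw [Fintype.sum_bool, ← Complex.add_re, chr_add, chr_add, ← mul_add, sum_chr_dir,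
      Complex.re_mul_ofReal]
    ring
  have hd' : (d : ℝ) ≠ 0 := by positivity
  unfold avg symb
  rw [h1, Finset.sum_sub_distrib, ← Finset.mul_sum]
  simp only [Finset.sum_const, Finset.card_univ, Fintype.card_fin, nsmul_eq_mul, mul_one]
  field_simp
  ring

lemma sum_chr (x : Torus d N) :
    ∑ ξ, (chr ξ x).re = if x = 0 then (N : ℝ) ^ d else 0 := by
  rw [← Complex.re_sum]
  have h : ∑ ξ, chr ξ x = ∏ i : Fin d, ∑ j : ZMod N, ZMod.stdAddChar (j * x i) := by
    rw [Finset.prod_univ_sum, Fintype.piFinset_univ]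
    rfl
  rw [h]
  simp_rw [AddChar.sum_mulShift _ (ZMod.isPrimitive_stdAddChar N)]
  split_ifs with hx
  · subst hx
    simp only [Pi.zero_apply, if_true, ZMod.card, Finset.prod_const, Finset.card_univ,
      Fintype.card_fin]
    rw [← Nat.cast_pow, Complex.natCast_re, Nat.cast_pow]
  · obtain ⟨i, hi⟩ := Function.ne_iff.1 hx
    rw [Finset.prod_eq_zero (Finset.mem_univ i)]
    · simp
    · simp at hi; simp [hi]

lemma chr_zero_left (x : Torus d N) : chr 0 x = 1 := by simp [chr]

lemma stdAddChar_re (j : ZMod N) :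
    (ZMod.stdAddChar j).re = Real.cos (2 * (Real.pi * j.val / N)) := by
  rw [ZMod.stdAddChar_apply, ZMod.toCircle_apply, ← Complex.exp_ofReal_mul_I_re]
  congr 2
  push_cast
  ring

/-- The distance of `j` to zero in `ZMod N`, divided by `N` and made positive. -/
def nrm (j : ZMod N) : ℝ := (max 1 (min j.val (N - j.val)) : ℕ) / (N : ℝ)

lemma nrm_pos (j : ZMod N) : 0 < nrm j := by
  have : (0 : ℝ) < N := by exact_mod_cast Nat.pos_of_ne_zero (NeZero.ne N)
  unfold nrm; positivity

lemma nrm_le_one (j : ZMod N) : nrm j ≤ 1 := by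
  have h0 := Nat.pos_of_ne_zero (NeZero.ne N)
  have : (0 : ℝ) < N := by exact_mod_cast h0
  unfold nrm
  rw [div_le_one this]
  have := j.val_lt
  exact_mod_cast (by omega : max 1 (min j.val (N - j.val)) ≤ N)

lemma one_sub_stdAddChar_re (j : ZMod N) (hj : j ≠ 0) :
    8 * nrm j ^ 2 ≤ 1 - (ZMod.stdAddChar j).re := by
  have h0 : (0 : ℝ) < N := by exact_mod_cast Nat.pos_of_ne_zero (NeZero.ne N)
  have hlt := j.val_lt
  have hpos : 0 < j.val := ZMod.val_pos.2 hj
  set m := min j.val (N - j.val) with hm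
  have hn : nrm j = m / N := by
    unfold nrm; rw [max_eq_right (by omega)]
  have hs : Real.sin (Real.pi * j.val / N) = Real.sin (Real.pi * (m / N)) := by
    rcases le_total j.val (N - j.val) with h | h
    · rw [hm, min_eq_left h]; congr 1; ring
    · rw [hm, min_eq_right h, Nat.cast_sub hlt.le, ← Real.sin_pi_sub]
      congr 1; field_simp
  have hm2 : (m : ℝ) / N ≤ 1 / 2 := by
    rw [div_le_div_iff₀ h0 two_pos]
    exact_mod_cast (by omega : m * 2 ≤ 1 * N)
  have hpi := Real.pi_pos
  have hle := Real.mul_le_sin (x := Real.pi * (m / N)) (by positivity) (by nlinarith)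
  rw [stdAddChar_re, Real.cos_two_mul, Real.cos_sq', hs, hn]
  have h2 : 2 * ((m : ℝ) / N) ≤ Real.sin (Real.pi * (m / N)) := by
    refine le_trans (le_of_eq ?_) hle
    field_simp
  have h3 : 0 ≤ (m : ℝ) / N := by positivity
  nlinarith

lemma stdAddChar_re_le (j : ZMod N) : (ZMod.stdAddChar j).re ≤ 1 := by
  rw [stdAddChar_re]; exact Real.cos_le_one _

lemma symb_le_one (ξ : Torus d N) : symb ξ ≤ 1 := by
  have h : ∑ i, (1 - (ZMod.stdAddChar (ξ i)).re) ≤ ∑ _i : Fin d, (2 : ℝ) := by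
    refine Finset.sum_le_sum fun i _ => ?_
    rw [stdAddChar_re]
    linarith [Real.neg_one_le_cos (2 * (Real.pi * (ξ i).val / N))]
  simp only [Finset.sum_const, Finset.card_univ, Fintype.card_fin, nsmul_eq_mul] at h
  unfold symb
  rcases Nat.eq_zero_or_pos d with rfl | hd
  · simp
  · have : (0 : ℝ) < d := by positivity
    rw [inv_mul_le_iff₀ (by positivity)]
    linarith

lemma nrm_sq_le_symb (hd : 0 < d) {ξ : Torus d N} (hξ : ξ ≠ 0) (i : Fin d) :
    nrm (ξ i) ^ 2 / d ≤ symb ξ := by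
  have hd' : (0 : ℝ) < d := by positivity
  have key : ∀ j, 1 - (ZMod.stdAddChar (ξ j)).re ≤ 2 * d * symb ξ := by
    intro j
    unfold symb
    rw [mul_inv_cancel_left₀ (by positivity)]
    exact Finset.single_le_sum (f := fun i => 1 - (ZMod.stdAddChar (ξ i)).re)
      (fun i _ => by linarith [stdAddChar_re_le (ξ i)]) (Finset.mem_univ j)
  have h8 : 8 * nrm (ξ i) ^ 2 ≤ 2 * d * symb ξ := by
    by_cases hi : ξ i = 0
    · obtain ⟨j, hj⟩ := Function.ne_iff.1 hξ
      refine le_trans ?_ ((one_sub_stdAddChar_re _ hj).trans (key j))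
      have : nrm (ξ i) ≤ nrm (ξ j) := by
        unfold nrm
        gcongr ?_ / _
        rw [hi, ZMod.val_zero]
        exact_mod_cast (by omega : max 1 (min 0 (N - 0)) ≤ max 1 (min (ξ j).val (N - (ξ j).val)))
      have := nrm_pos (ξ i)
      gcongr
    · exact (one_sub_stdAddChar_re _ hi).trans (key i)
  rw [div_le_iff₀ hd']
  nlinarith [sq_nonneg (nrm (ξ i))]

lemma symb_pos (hd : 0 < d) {ξ : Torus d N} (hξ : ξ ≠ 0) : 0 < symb ξ := by
  refine lt_of_lt_of_le ?_ (nrm_sq_le_symb hd hξ ⟨0, hd⟩)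
  have := nrm_pos (ξ ⟨0, hd⟩)
  have hd' : (0 : ℝ) < d := by positivity
  positivity

lemma symb_rpow_le (hd : 3 ≤ d) {ξ : Torus d N} (hξ : ξ ≠ 0) :
    symb ξ ^ (-(9 / 8) : ℝ) ≤ ∏ i, ((d : ℝ) ^ (3 / 8 : ℝ) * nrm (ξ i) ^ (-(3 / 4) : ℝ)) := by
  have hd' : (3 : ℝ) ≤ d := by exact_mod_cast hd
  have hy := symb_pos (by omega) hξ
  have h1 : symb ξ ^ (-(9 / 8) : ℝ) = ∏ _i : Fin d, symb ξ ^ (-(9 / (8 * d)) : ℝ) := by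
    rw [Finset.prod_const, Finset.card_univ, Fintype.card_fin, ← Real.rpow_mul_natCast hy.le]
    congr 1; field_simp
  rw [h1]
  refine Finset.prod_le_prod (fun i _ => by positivity) fun i _ => ?_
  have hn := nrm_pos (ξ i)
  have hn1 := nrm_le_one (ξ i)
  have hle : nrm (ξ i) ^ 2 / d ≤ 1 := by
    rw [div_le_one (by positivity)]
    nlinarith
  calc symb ξ ^ (-(9 / (8 * d)) : ℝ) ≤ (nrm (ξ i) ^ 2 / d) ^ (-(9 / (8 * d)) : ℝ) :=
        Real.rpow_le_rpow_of_nonpos (by positivity) (nrm_sq_le_symb (by omega) hξ i)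
          (neg_nonpos.2 (by positivity))
    _ ≤ (nrm (ξ i) ^ 2 / d) ^ (-(3 / 8) : ℝ) := by
        refine Real.rpow_le_rpow_of_exponent_ge (by positivity) hle ?_
        rw [neg_le_neg_iff, div_le_div_iff₀ (by positivity) (by norm_num)]
        nlinarith
    _ = (d : ℝ) ^ (3 / 8 : ℝ) * nrm (ξ i) ^ (-(3 / 4) : ℝ) := by
        rw [Real.div_rpow (by positivity) (by positivity), ← Real.rpow_natCast,
          ← Real.rpow_mul hn.le, Real.rpow_neg (by positivity : (0 : ℝ) ≤ d), div_inv_eq_mul,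
          mul_comm]
        norm_num

end Fourier

section FourierSum

variable {d N : ℕ} [NeZero N]

lemma sum_zmod_val (f : ℕ → ℝ) : ∑ j : ZMod N, f j.val = ∑ k ∈ Finset.range N, f k := by
  refine Finset.sum_bij' (fun j _ => j.val) (fun k _ => (k : ZMod N)) ?_ ?_ ?_ ?_ ?_
  · intro j _; exact Finset.mem_range.2 j.val_lt
  · intro k _; exact Finset.mem_univ _
  · intro j _; simp
  · intro k hk; exact ZMod.val_cast_of_lt (Finset.mem_range.1 hk)
  · intro j _; rfl

lemma rpow_neg_three_quarters_le (k : ℕ) :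
    ((k + 1 : ℕ) : ℝ) ^ (-(3 / 4) : ℝ)
      ≤ 4 * (((k + 1 : ℕ) : ℝ) ^ (1 / 4 : ℝ) - (k : ℝ) ^ (1 / 4 : ℝ)) := by
  set a := ((k + 1 : ℕ) : ℝ) ^ (1 / 4 : ℝ) with ha
  set b := (k : ℝ) ^ (1 / 4 : ℝ) with hb
  have hk : (0 : ℝ) ≤ k := by positivity
  have ha4 : a ^ 4 = (k : ℝ) + 1 := by
    rw [ha, ← Real.rpow_mul_natCast (by positivity)]; norm_num
  have hb4 : b ^ 4 = (k : ℝ) := by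
    rw [hb, ← Real.rpow_mul_natCast (by positivity)]; norm_num
  have ha0 : 0 < a := by positivity
  have hb0 : 0 ≤ b := by positivity
  have hab : b ≤ a := by rw [ha, hb]; gcongr; simp
  have h3 : ((k + 1 : ℕ) : ℝ) ^ (-(3 / 4) : ℝ) = (a ^ 3)⁻¹ := by
    rw [ha, ← Real.rpow_mul_natCast (by positivity), ← Real.rpow_neg (by positivity)]
    norm_num
  rw [h3, inv_le_iff_one_le_mul₀ (by positivity)]
  have e1 : 1 = (a - b) * (a ^ 3 + a ^ 2 * b + a * b ^ 2 + b ^ 3) := by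
    linear_combination -ha4 + hb4
  have e2 : a ^ 3 + a ^ 2 * b + a * b ^ 2 + b ^ 3 ≤ 4 * a ^ 3 := by
    have i1 : a ^ 2 * b ≤ a ^ 2 * a := by gcongr
    have i2 : a * b ^ 2 ≤ a * a ^ 2 := by gcongr
    have i3 : b ^ 3 ≤ a ^ 3 := by gcongr
    nlinarith
  nlinarith [mul_le_mul_of_nonneg_left e2 (sub_nonneg.2 hab)]

lemma sum_rpow_le (n : ℕ) :
    ∑ k ∈ Finset.range n, ((k + 1 : ℕ) : ℝ) ^ (-(3 / 4) : ℝ) ≤ 4 * (n : ℝ) ^ (1 / 4 : ℝ) := by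
  induction n with
  | zero => simp
  | succ n ih =>
    rw [Finset.sum_range_succ]
    linarith [rpow_neg_three_quarters_le n]

lemma sum_nrm_le : ∑ j : ZMod N, nrm j ^ (-(3 / 4) : ℝ) ≤ 12 * N := by
  have h0 : (0 : ℝ) < N := by exact_mod_cast Nat.pos_of_ne_zero (NeZero.ne N)
  set g : ℕ → ℝ := fun k => ((k + 1 : ℕ) : ℝ) ^ (-(3 / 4) : ℝ) with hg
  have hterm : ∀ j : ZMod N, nrm j ^ (-(3 / 4) : ℝ)
      ≤ (N : ℝ) ^ (3 / 4 : ℝ) * (2 * g j.val + g (N - 1 - j.val)) := by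
    intro j
    have hlt := j.val_lt
    unfold nrm
    rw [Real.div_rpow (by positivity) h0.le, Real.rpow_neg h0.le (3 / 4), div_inv_eq_mul, mul_comm]
    gcongr
    have hgpos : ∀ k, 0 < g k := fun k => by positivity
    rcases le_total j.val (N - j.val) with h | h
    · refine le_trans ?_ (le_add_of_nonneg_right (hgpos _).le)
      rw [min_eq_left h]
      have h2 : ((j.val + 1 : ℕ) : ℝ) / 2 ≤ (max 1 j.val : ℕ) := by
        rw [div_le_iff₀ two_pos]
        exact_mod_cast (by omega : j.val + 1 ≤ max 1 j.val * 2)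
      refine (Real.rpow_le_rpow_of_nonpos (by positivity) h2 (by norm_num)).trans ?_
      rw [Real.div_rpow (by positivity) two_pos.le, div_eq_mul_inv, ← Real.rpow_neg two_pos.le,
        mul_comm]
      gcongr
      calc (2 : ℝ) ^ (- -(3 / 4) : ℝ) ≤ 2 ^ (1 : ℝ) :=
            Real.rpow_le_rpow_of_exponent_le (by norm_num) (by norm_num)
        _ = 2 := by norm_num
    · refine le_trans ?_ (le_add_of_nonneg_left (mul_nonneg two_pos.le (hgpos _).le))
      rw [min_eq_right h]
      have : max 1 (N - j.val) = N - 1 - j.val + 1 := by omega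
      rw [this]
  refine (Finset.sum_le_sum fun j _ => hterm j).trans ?_
  rw [← Finset.mul_sum, Finset.sum_add_distrib, ← Finset.mul_sum, sum_zmod_val g,
    sum_zmod_val (N := N) fun k => g (N - 1 - k), Finset.sum_range_reflect g N]
  have h1 := sum_rpow_le N
  have h2 : (N : ℝ) ^ (3 / 4 : ℝ) * (N : ℝ) ^ (1 / 4 : ℝ) = N := by
    rw [← Real.rpow_add h0]; norm_num
  have h3 : 0 ≤ (N : ℝ) ^ (3 / 4 : ℝ) := by positivity
  calc (N : ℝ) ^ (3 / 4 : ℝ) * (2 * ∑ k ∈ Finset.range N, g k + ∑ k ∈ Finset.range N, g k)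
      ≤ (N : ℝ) ^ (3 / 4 : ℝ) * (12 * (N : ℝ) ^ (1 / 4 : ℝ)) := by gcongr; linarith
    _ = 12 * N := by rw [mul_left_comm, h2]

/-- A dimensional constant bounding the Fourier sums below. -/
def gC (d : ℕ) : ℝ := (12 * (d : ℝ) ^ (3 / 8 : ℝ)) ^ d

lemma sum_symb_le (hd : 3 ≤ d) :
    ((N : ℝ) ^ d)⁻¹ * ∑ ξ : Torus d N with ξ ≠ 0, symb ξ ^ (-(9 / 8) : ℝ) ≤ gC d := by
  have h0 : (0 : ℝ) < N := by exact_mod_cast Nat.pos_of_ne_zero (NeZero.ne N)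
  rw [inv_mul_le_iff₀ (by positivity)]
  calc ∑ ξ : Torus d N with ξ ≠ 0, symb ξ ^ (-(9 / 8) : ℝ)
      ≤ ∑ ξ : Torus d N with ξ ≠ 0,
          ∏ i, ((d : ℝ) ^ (3 / 8 : ℝ) * nrm (ξ i) ^ (-(3 / 4) : ℝ)) :=
        Finset.sum_le_sum fun ξ hξ => symb_rpow_le hd (Finset.mem_filter.1 hξ).2
    _ ≤ ∑ ξ : Torus d N, ∏ i, ((d : ℝ) ^ (3 / 8 : ℝ) * nrm (ξ i) ^ (-(3 / 4) : ℝ)) := by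
        refine Finset.sum_le_sum_of_subset_of_nonneg (Finset.filter_subset _ _) fun ξ _ _ => ?_
        exact Finset.prod_nonneg fun i _ => by
          have := nrm_pos (ξ i)
          positivity
    _ = (∑ j : ZMod N, (d : ℝ) ^ (3 / 8 : ℝ) * nrm j ^ (-(3 / 4) : ℝ)) ^ d := by
        rw [Fintype.sum_pow]
    _ ≤ ((d : ℝ) ^ (3 / 8 : ℝ) * (12 * N)) ^ d := by
        rw [← Finset.mul_sum]
        gcongr
        · exact mul_nonneg (by positivity) (Finset.sum_nonneg fun j _ => by
            have := nrm_pos j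
            positivity)
        · exact sum_nrm_le
    _ = (N : ℝ) ^ d * gC d := by
        rw [gC, ← mul_pow]; congr 1; ring

lemma gC_pos (hd : 0 < d) : 0 < gC d := by
  unfold gC; positivity

lemma one_sub_pow_div_le {y : ℝ} (h0 : 0 < y) (h1 : y ≤ 1) {S : ℕ} (hS : 1 ≤ S) :
    (1 - y) ^ S / y ≤ (S : ℝ) ^ (-(1 / 8) : ℝ) * y ^ (-(9 / 8) : ℝ) := by
  have hS' : (0 : ℝ) < S := by exact_mod_cast hS
  have key : (1 - y) ^ S ≤ (S * y) ^ (-(1 / 8) : ℝ) := by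
    rcases le_total (S * y) 1 with h | h
    · exact (pow_le_one₀ (by linarith) (by linarith)).trans
        (Real.one_le_rpow_of_pos_of_le_one_of_nonpos (by positivity) h (by norm_num))
    · have e1 : (1 - y) ^ S ≤ Real.exp (-(S * y)) := by
        calc (1 - y) ^ S ≤ (Real.exp (-y)) ^ S := by
              refine pow_le_pow_left₀ (by linarith) ?_ S
              linarith [Real.add_one_le_exp (-y)]
          _ = Real.exp (-(S * y)) := by rw [← Real.exp_nat_mul]; ring_nf
      refine e1.trans ?_
      rw [Real.exp_neg, Real.rpow_neg (by positivity)]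
      gcongr
      calc (S * y) ^ (1 / 8 : ℝ) ≤ (S * y) ^ (1 : ℝ) :=
            Real.rpow_le_rpow_of_exponent_le h (by norm_num)
        _ ≤ Real.exp (S * y) := by rw [Real.rpow_one]; linarith [Real.add_one_le_exp (S * y)]
  rw [div_eq_mul_inv]
  calc (1 - y) ^ S * y⁻¹ ≤ (S * y) ^ (-(1 / 8) : ℝ) * y⁻¹ := by gcongr
    _ = (S : ℝ) ^ (-(1 / 8) : ℝ) * y ^ (-(9 / 8) : ℝ) := by
      rw [Real.mul_rpow hS'.le h0.le, mul_assoc, ← Real.rpow_neg_one y, ← Real.rpow_add h0]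
      norm_num

lemma sum_symb_tail_le (hd : 3 ≤ d) {S : ℕ} (hS : 1 ≤ S) :
    ((N : ℝ) ^ d)⁻¹ * ∑ ξ : Torus d N with ξ ≠ 0, (1 - symb ξ) ^ S / symb ξ
      ≤ gC d * (S : ℝ) ^ (-(1 / 8) : ℝ) := by
  have h0 : (0 : ℝ) < N := by exact_mod_cast Nat.pos_of_ne_zero (NeZero.ne N)
  calc ((N : ℝ) ^ d)⁻¹ * ∑ ξ : Torus d N with ξ ≠ 0, (1 - symb ξ) ^ S / symb ξ
      ≤ ((N : ℝ) ^ d)⁻¹ * ∑ ξ : Torus d N with ξ ≠ 0,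
          (S : ℝ) ^ (-(1 / 8) : ℝ) * symb ξ ^ (-(9 / 8) : ℝ) := by
        gcongr with ξ hξ
        exact one_sub_pow_div_le (symb_pos (by omega) (Finset.mem_filter.1 hξ).2)
          (symb_le_one ξ) hS
    _ = (((N : ℝ) ^ d)⁻¹ * ∑ ξ : Torus d N with ξ ≠ 0, symb ξ ^ (-(9 / 8) : ℝ))
          * (S : ℝ) ^ (-(1 / 8) : ℝ) := by rw [← Finset.mul_sum]; ring
    _ ≤ _ := by gcongr; exact sum_symb_le hd

end FourierSum

section Lazy

variable {d : ℕ} {R : Type*} [CommRing R]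

/-- Transition probabilities of the lazy walk started at the origin. -/
def lazyIter {d : ℕ} {R : Type*} [CommRing R] : ℕ → (Fin d → R) → ℝ
  | 0 => fun x => if x = 0 then 1 else 0
  | k + 1 => fun x => (lazyIter k x + avg (lazyIter k) x) / 2

lemma lazyIter_nonneg (k : ℕ) (x : Fin d → R) : 0 ≤ lazyIter k x := by
  induction k generalizing x with
  | zero => unfold lazyIter; split_ifs <;> simp
  | succ k ih => unfold lazyIter; have := avg_nonneg (x := x) fun p => ih (x + dir p); linarith [ih x]

lemma lazyIter_neg (k : ℕ) (x : Fin d → R) : lazyIter k (-x) = lazyIter k x := by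
  induction k generalizing x with
  | zero => simp [lazyIter]
  | succ k ih =>
    have h : (fun z => lazyIter k (-z)) = (lazyIter k : (Fin d → R) → ℝ) := funext fun z => ih z
    simp only [lazyIter]
    rw [ih, ← avg_neg, h]

lemma dir_int_abs_le (p : Fin d × Bool) (i : Fin d) : |(dir p : Lat d) i| ≤ 1 := by
  obtain ⟨j, s⟩ := p
  unfold dir
  by_cases h : i = j
  · subst h; cases s <;> simp
  · simp [h]

/-- The projection from the lattice to the torus. -/
def proj (N : ℕ) (x : Lat d) : Torus d N := fun i => (x i : ZMod N)

lemma proj_add (N : ℕ) (x y : Lat d) : proj N (x + y) = proj N x + proj N y := by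
  ext i; simp [proj]

lemma proj_sub (N : ℕ) (x y : Lat d) : proj N (x - y) = proj N x - proj N y := by
  ext i; simp [proj]

lemma proj_dir (N : ℕ) (p : Fin d × Bool) : proj N (dir p : Lat d) = dir p := by
  obtain ⟨i, s⟩ := p
  ext j
  unfold dir proj
  by_cases h : j = i
  · subst h; cases s <;> simp
  · simp [h]

lemma proj_eq_zero_iff {N : ℕ} {x : Lat d} (h : ∀ i, |x i| < N) : proj N x = 0 ↔ x = 0 := by
  constructor
  · intro h0
    ext i
    have hi : ((x i : ℤ) : ZMod N) = 0 := congrFun h0 i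
    rw [ZMod.intCast_zmod_eq_zero_iff_dvd] at hi
    exact Int.eq_zero_of_abs_lt_dvd hi (h i)
  · rintro rfl; ext i; simp [proj]

lemma lazyIter_proj {N : ℕ} (k : ℕ) (x : Lat d) (h : ∀ i, |x i| + k < N) :
    lazyIter k (proj N x) = lazyIter k x := by
  induction k generalizing x with
  | zero =>
    have hiff := proj_eq_zero_iff (x := x) fun i => by simpa using h i
    by_cases hx : x = 0
    · simp only [lazyIter, if_pos hx, if_pos (hiff.2 hx)]
    · simp only [lazyIter, if_neg hx, if_neg (mt hiff.1 hx)]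
  | succ k ih =>
    simp only [lazyIter, avg]
    have e : ∀ p, lazyIter k (proj N x + dir p) = lazyIter k (x + dir p) := by
      intro p
      rw [← proj_dir, ← proj_add]
      refine ih _ fun i => ?_
      have h1 := abs_add_le (x i) ((dir p : Lat d) i)
      have h2 := dir_int_abs_le p i
      have h3 := h i
      push_cast at h3
      simp only [Pi.add_apply]
      linarith
    rw [ih x fun i => by have := h i; push_cast at this; linarith]
    simp_rw [e]

lemma lazyIter_eq_zero (k : ℕ) (x : Lat d) (i : Fin d) (h : (k : ℤ) < |x i|) :
    lazyIter k x = 0 := by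
  induction k generalizing x with
  | zero =>
    simp only [lazyIter]
    rw [if_neg]
    rintro rfl
    simp at h
  | succ k ih =>
    push_cast at h
    simp only [lazyIter, avg]
    rw [ih x (by linarith), Finset.sum_eq_zero]
    · simp
    · intro p _
      refine ih _ ?_
      have h1 := abs_sub_abs_le_abs_sub (x i) (-(dir p : Lat d) i)
      have h2 := dir_int_abs_le p i
      rw [abs_neg, sub_neg_eq_add] at h1
      simp only [Pi.add_apply]
      linarith

end Lazy

section GreenTorus

variable {d N : ℕ} [NeZero N]

/-- The zero-mean Green function of the simple random walk on the torus. -/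
def greenT {d N : ℕ} [NeZero N] (x : Torus d N) : ℝ :=
  ((N : ℝ) ^ d)⁻¹ * ∑ ξ : Torus d N with ξ ≠ 0, (chr ξ x).re / (2 * symb ξ)

/-- The remainder of the time-series expansion of `greenT` after `S` lazy steps. -/
def greenTail {d N : ℕ} [NeZero N] (S : ℕ) (x : Torus d N) : ℝ :=
  ((N : ℝ) ^ d)⁻¹ * ∑ ξ : Torus d N with ξ ≠ 0, (1 - symb ξ) ^ S / (2 * symb ξ) * (chr ξ x).re

lemma card_pow_pos : (0 : ℝ) < (N : ℝ) ^ d := by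
  have : (0 : ℝ) < N := by exact_mod_cast Nat.pos_of_ne_zero (NeZero.ne N)
  positivity

lemma lazyIter_torus (hd : 0 < d) (k : ℕ) (x : Torus d N) :
    lazyIter k x = ((N : ℝ) ^ d)⁻¹ * ∑ ξ : Torus d N, (1 - symb ξ) ^ k * (chr ξ x).re := by
  have h0 : (N : ℝ) ^ d ≠ 0 := card_pow_pos.ne'
  induction k generalizing x with
  | zero =>
    simp only [lazyIter, pow_zero, one_mul]
    rw [sum_chr]
    by_cases hx : x = 0
    · simp [hx, h0]
    · simp [hx]
  | succ k ih =>
    have h1 : (lazyIter k : Torus d N → ℝ)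
        = fun x => ((N : ℝ) ^ d)⁻¹ * ∑ ξ : Torus d N, (1 - symb ξ) ^ k * (chr ξ x).re :=
      funext ih
    simp only [lazyIter]
    rw [h1, avg_const_mul, avg_sum]
    simp_rw [avg_const_mul, avg_chr hd]
    rw [← mul_add, mul_div_assoc, ← Finset.sum_add_distrib, Finset.sum_div]
    congr 1
    refine Finset.sum_congr rfl fun ξ _ => ?_
    ring

lemma sum_ne_zero_chr (x : Torus d N) :
    ((N : ℝ) ^ d)⁻¹ * ∑ ξ : Torus d N with ξ ≠ 0, (chr ξ x).re
      = (if x = 0 then 1 else 0) - ((N : ℝ) ^ d)⁻¹ := by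
  have h0 : (N : ℝ) ^ d ≠ 0 := card_pow_pos.ne'
  have h := Finset.sum_filter_add_sum_filter_not Finset.univ (fun ξ : Torus d N => ξ ≠ 0)
    (fun ξ => (chr ξ x).re)
  rw [sum_chr] at h
  have h2 : ∑ ξ : Torus d N with ¬ ξ ≠ 0, (chr ξ x).re = 1 := by
    simp [Finset.filter_eq', chr_zero_left]
  rw [h2] at h
  rw [eq_sub_of_add_eq h, mul_sub, mul_one]
  split_ifs <;> simp [h0]

lemma greenT_sub_avg (hd : 0 < d) (x : Torus d N) :
    greenT x - avg greenT x = (if x = 0 then 1 else 0) - ((N : ℝ) ^ d)⁻¹ := by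
  rw [← sum_ne_zero_chr]
  have h1 : (greenT : Torus d N → ℝ) = fun x => ((N : ℝ) ^ d)⁻¹ *
      ∑ ξ : Torus d N with ξ ≠ 0, (2 * symb ξ)⁻¹ * (chr ξ x).re := by
    funext x; unfold greenT; congr 1
    exact Finset.sum_congr rfl fun ξ _ => by rw [div_eq_inv_mul]
  rw [h1, avg_const_mul, avg_sum]
  simp_rw [avg_const_mul, avg_chr hd]
  rw [← mul_sub, ← Finset.sum_sub_distrib]
  congr 1
  refine Finset.sum_congr rfl fun ξ hξ => ?_
  have := (symb_pos hd (Finset.mem_filter.1 hξ).2).ne'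
  field_simp
  ring

lemma greenT_eq (hd : 0 < d) (S : ℕ) (x : Torus d N) :
    greenT x = 1 / 2 * ∑ k ∈ Finset.range S, (lazyIter k x - ((N : ℝ) ^ d)⁻¹)
      + greenTail S x := by
  have h1 : ∀ k, lazyIter k x - ((N : ℝ) ^ d)⁻¹
      = ((N : ℝ) ^ d)⁻¹ * ∑ ξ : Torus d N with ξ ≠ 0, (1 - symb ξ) ^ k * (chr ξ x).re := by
    intro k
    rw [lazyIter_torus hd, ← Finset.sum_filter_add_sum_filter_not Finset.univ
      (fun ξ : Torus d N => ξ ≠ 0)]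
    have h2 : ∑ ξ : Torus d N with ¬ ξ ≠ 0, (1 - symb ξ) ^ k * (chr ξ x).re = 1 := by
      simp [Finset.filter_eq', chr_zero_left, symb]
    rw [h2]; ring
  simp_rw [h1]
  unfold greenT greenTail
  rw [← Finset.mul_sum, Finset.sum_comm, mul_left_comm, ← mul_add]
  congr 1
  rw [Finset.mul_sum, ← Finset.sum_add_distrib]
  refine Finset.sum_congr rfl fun ξ hξ => ?_
  have hy := (symb_pos hd (Finset.mem_filter.1 hξ).2).ne'
  rw [← Finset.sum_mul]
  have hg := geom_sum_mul_neg (1 - symb ξ) S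
  rw [sub_sub_cancel] at hg
  rw [(eq_div_iff hy).2 hg]
  field_simp
  ring

lemma abs_greenTail_le (hd : 3 ≤ d) {S : ℕ} (hS : 1 ≤ S) (x : Torus d N) :
    |greenTail S x| ≤ 1 / 2 * (gC d * (S : ℝ) ^ (-(1 / 8) : ℝ)) := by
  refine le_trans ?_ (mul_le_mul_of_nonneg_left (sum_symb_tail_le (N := N) hd hS)
    (by norm_num : (0 : ℝ) ≤ 1 / 2))
  unfold greenTail
  rw [abs_mul, abs_of_pos (inv_pos.2 card_pow_pos), mul_left_comm]
  refine mul_le_mul_of_nonneg_left ?_ (inv_pos.2 card_pow_pos).le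
  rw [Finset.mul_sum]
  refine (Finset.abs_sum_le_sum_abs _ _).trans (Finset.sum_le_sum fun ξ hξ => ?_)
  have hy := symb_pos (by omega) (Finset.mem_filter.1 hξ).2
  have h1 : 0 ≤ (1 - symb ξ) ^ S / (2 * symb ξ) :=
    div_nonneg (pow_nonneg (by linarith [symb_le_one ξ]) S) (by linarith)
  rw [abs_mul, abs_of_nonneg h1]
  refine (mul_le_of_le_one_right h1 (abs_chr_re_le ξ x)).trans_eq ?_
  field_simp

lemma abs_greenT_le (hd : 3 ≤ d) (x : Torus d N) : |greenT x| ≤ gC d := by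
  refine le_trans ?_ (sum_symb_le (N := N) hd)
  unfold greenT
  rw [abs_mul, abs_of_pos (inv_pos.2 card_pow_pos)]
  refine mul_le_mul_of_nonneg_left ?_ (inv_pos.2 card_pow_pos).le
  refine (Finset.abs_sum_le_sum_abs _ _).trans (Finset.sum_le_sum fun ξ hξ => ?_)
  have hy := symb_pos (by omega) (Finset.mem_filter.1 hξ).2
  rw [abs_div, abs_of_pos (by linarith : 0 < 2 * symb ξ)]
  calc |(chr ξ x).re| / (2 * symb ξ) ≤ 1 / (1 * symb ξ) := by
        gcongr
        · exact abs_chr_re_le ξ x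
        · norm_num
    _ = symb ξ ^ (-1 : ℝ) := by rw [Real.rpow_neg_one, one_mul, one_div]
    _ ≤ _ := Real.rpow_le_rpow_of_exponent_ge hy (symb_le_one ξ) (by norm_num)

end GreenTorus

section Green

variable {d : ℕ}

lemma sum_Ico_lazyIter_le (hd : 3 ≤ d) {S S' : ℕ} (hS : 1 ≤ S) (hSS : S ≤ S') (x : Lat d) :
    ∑ k ∈ Finset.Ico S S', lazyIter k x ≤ 2 * (gC d * (S : ℝ) ^ (-(1 / 8) : ℝ)) := by
  have key : ∀ᶠ N : ℕ in atTop, ∑ k ∈ Finset.Ico S S', lazyIter k x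
      ≤ 2 * (gC d * (S : ℝ) ^ (-(1 / 8) : ℝ)) + (S' : ℝ) * ((N : ℝ) ^ d)⁻¹ := by
    filter_upwards [eventually_gt_atTop (∑ i, (x i).natAbs + S')] with N hN
    have : NeZero N := ⟨by omega⟩
    have e1 : ∀ k ∈ Finset.Ico S S', lazyIter k x = lazyIter k (proj N x) := by
      intro k hk
      refine (lazyIter_proj k x fun i => ?_).symm
      have h1 : (x i).natAbs ≤ ∑ i, (x i).natAbs :=
        Finset.single_le_sum (f := fun i => (x i).natAbs) (fun _ _ => Nat.zero_le _)
          (Finset.mem_univ i)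
      have h2 := (Finset.mem_Ico.1 hk).2
      rw [Int.abs_eq_natAbs]
      exact_mod_cast (by omega : (x i).natAbs + k < N)
    rw [Finset.sum_congr rfl e1]
    have a1 := greenT_eq (by omega) S (proj N x)
    have a2 := greenT_eq (by omega) S' (proj N x)
    have b1 := abs_le.1 (abs_greenTail_le hd hS (proj N x))
    have b2 := abs_le.1 (abs_greenTail_le hd (hS.trans hSS) (proj N x))
    have hmono : (S' : ℝ) ^ (-(1 / 8) : ℝ) ≤ (S : ℝ) ^ (-(1 / 8) : ℝ) :=
      Real.rpow_le_rpow_of_nonpos (by exact_mod_cast hS) (by exact_mod_cast hSS) (by norm_num)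
    have hmono' := mul_le_mul_of_nonneg_left hmono (gC_pos (d := d) (by omega)).le
    have c := Finset.sum_Ico_eq_sub (fun k => lazyIter k (proj N x) - ((N : ℝ) ^ d)⁻¹) hSS
    rw [Finset.sum_sub_distrib, Finset.sum_const, Nat.card_Ico, nsmul_eq_mul,
      Nat.cast_sub hSS] at c
    have hp : 0 ≤ (S : ℝ) * ((N : ℝ) ^ d)⁻¹ := by positivity
    linarith
  have hlim : Tendsto (fun N : ℕ => 2 * (gC d * (S : ℝ) ^ (-(1 / 8) : ℝ))
      + (S' : ℝ) * ((N : ℝ) ^ d)⁻¹) atTop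
      (nhds (2 * (gC d * (S : ℝ) ^ (-(1 / 8) : ℝ)) + (S' : ℝ) * 0)) := by
    refine tendsto_const_nhds.add (Tendsto.const_mul _ ?_)
    exact tendsto_inv_atTop_zero.comp
      ((tendsto_pow_atTop (by omega)).comp tendsto_natCast_atTop_atTop)
  rw [mul_zero, add_zero] at hlim
  exact ge_of_tendsto hlim key

lemma lazyIter_zero_le (x : Lat d) : lazyIter 0 x ≤ 1 := by
  simp only [lazyIter]; split_ifs <;> norm_num

lemma lazyIter_summable (hd : 3 ≤ d) (x : Lat d) : Summable fun k => lazyIter k x := by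
  refine summable_of_sum_range_le (c := 1 + 2 * (gC d * ((1 : ℕ) : ℝ) ^ (-(1 / 8) : ℝ)))
    (fun k => lazyIter_nonneg k x) fun n => ?_
  have hpos := gC_pos (d := d) (by omega)
  rcases Nat.eq_zero_or_pos n with rfl | hn
  · simp; positivity
  · rw [Finset.sum_range_eq_add_Ico _ hn]
    exact add_le_add (lazyIter_zero_le x) (sum_Ico_lazyIter_le hd le_rfl hn x)

/-- The Green function of the simple random walk on the lattice. -/
def green {d : ℕ} (x : Lat d) : ℝ := 1 / 2 * ∑' k, lazyIter k x

lemma green_nonneg (x : Lat d) : 0 ≤ green x :=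
  mul_nonneg (by norm_num) (tsum_nonneg fun k => lazyIter_nonneg k x)

lemma green_neg (x : Lat d) : green (-x) = green x := by
  simp [green, lazyIter_neg]

lemma sum_lazyIter_le_green (hd : 3 ≤ d) (S : ℕ) (x : Lat d) :
    1 / 2 * ∑ k ∈ Finset.range S, lazyIter k x ≤ green x :=
  mul_le_mul_of_nonneg_left
    ((lazyIter_summable hd x).sum_le_tsum _ fun k _ => lazyIter_nonneg k x) (by norm_num)

lemma green_tendsto (hd : 3 ≤ d) (x : Lat d) :
    Tendsto (fun S : ℕ => 1 / 2 * ∑ k ∈ Finset.range S, lazyIter k x) atTop (nhds (green x)) :=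
  (lazyIter_summable hd x).hasSum.tendsto_sum_nat.const_mul _

lemma green_le (hd : 3 ≤ d) {S : ℕ} (hS : 1 ≤ S) (x : Lat d) :
    green x ≤ 1 / 2 * ∑ k ∈ Finset.range S, lazyIter k x + gC d * (S : ℝ) ^ (-(1 / 8) : ℝ) := by
  refine le_of_tendsto (green_tendsto hd x) ?_
  filter_upwards [eventually_ge_atTop S] with S' hS'
  have := sum_Ico_lazyIter_le hd hS hS' x
  rw [← Finset.sum_range_add_sum_Ico _ hS']
  linarith

lemma green_le_const (hd : 3 ≤ d) (x : Lat d) : green x ≤ 1 + gC d := by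
  have h := green_le hd le_rfl x
  have := lazyIter_zero_le x
  rw [Finset.sum_range_one, Nat.cast_one, Real.one_rpow] at h
  linarith

lemma green_decay (hd : 3 ≤ d) {x : Lat d} {i : Fin d} (hx : x i ≠ 0) :
    green x ≤ gC d * ((x i).natAbs : ℝ) ^ (-(1 / 8) : ℝ) := by
  have h := green_le hd (Int.natAbs_pos.2 hx) x
  rw [Finset.sum_eq_zero, mul_zero, zero_add] at h
  · exact h
  · intro k hk
    refine lazyIter_eq_zero k x i ?_
    rw [Int.abs_eq_natAbs]
    exact_mod_cast Finset.mem_range.1 hk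

lemma avg_green (hd : 3 ≤ d) (x : Lat d) :
    avg green x = green x - if x = 0 then 1 else 0 := by
  have h1 := avg_tendsto (fun z => green_tendsto hd z) x
  have h2 : ∀ S : ℕ, avg (fun z => 1 / 2 * ∑ k ∈ Finset.range S, lazyIter k z) x
      = 2 * (1 / 2 * ∑ k ∈ Finset.range (S + 1), lazyIter k x)
        - (1 / 2 * ∑ k ∈ Finset.range S, lazyIter k x) - if x = 0 then 1 else 0 := by
    intro S
    rw [avg_const_mul, avg_sum, Finset.sum_range_succ']
    have h3 : ∀ k, lazyIter (k + 1) x = (lazyIter k x + avg (lazyIter k) x) / 2 := fun k => rfl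
    simp_rw [h3]
    rw [← Finset.sum_div, Finset.sum_add_distrib]
    have h4 : lazyIter 0 x = if x = 0 then 1 else 0 := by
      by_cases hx : x = 0 <;> simp [lazyIter, hx]
    rw [h4]
    ring
  simp_rw [h2] at h1
  have h5 := (((((tendsto_add_atTop_iff_nat 1).2 (green_tendsto hd x)).const_mul 2).sub
    (green_tendsto hd x)).sub_const (if x = 0 then (1 : ℝ) else 0))
  rw [tendsto_nhds_unique h1 h5]
  ring

lemma inv_le_rpow_eighth {t : ℝ} (ht : 1 ≤ t) : t⁻¹ ≤ t ^ (-(1 / 8) : ℝ) := by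
  rw [← Real.rpow_neg_one]
  exact Real.rpow_le_rpow_of_exponent_le ht (by norm_num)

lemma mul_inv_pow_le (hd : 3 ≤ d) {N S : ℕ} (hS : 1 ≤ S) (hSN : S ≤ N) :
    (S : ℝ) * ((N : ℝ) ^ d)⁻¹ ≤ (N : ℝ)⁻¹ := by
  have h0 : (1 : ℝ) ≤ N := by exact_mod_cast hS.trans hSN
  have hS' : (S : ℝ) ≤ N := by exact_mod_cast hSN
  rw [← div_eq_mul_inv, div_le_iff₀ (by positivity)]
  calc (S : ℝ) ≤ N ^ 1 := by simpa using hS'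
    _ ≤ (N : ℝ) ^ (d - 1) := pow_le_pow_right₀ h0 (by omega)
    _ = (N : ℝ)⁻¹ * (N : ℝ) ^ d := by
      rw [inv_mul_eq_div, eq_div_iff (by positivity), ← pow_succ, Nat.sub_add_cancel (by omega)]

lemma abs_greenT_sub_green_le (hd : 3 ≤ d) {N : ℕ} [NeZero N] (hN : 4 ≤ N) {x : Lat d}
    (hx : ∀ i, 4 * |x i| ≤ N) :
    |greenT (proj N x) - green x| ≤ (1 + 4 * gC d) * (N : ℝ) ^ (-(1 / 8) : ℝ) := by
  have hS : 1 ≤ N / 2 := by omega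
  have hgC := gC_pos (d := d) (by omega)
  set S := N / 2 with hSdef
  have e1 : ∀ k ∈ Finset.range S, lazyIter k (proj N x) = lazyIter k x := by
    intro k hk
    refine lazyIter_proj k x fun i => ?_
    have := Finset.mem_range.1 hk
    have := hx i
    omega
  have h1 := greenT_eq (by omega) S (proj N x)
  rw [Finset.sum_sub_distrib, Finset.sum_congr rfl e1, Finset.sum_const, Finset.card_range,
    nsmul_eq_mul] at h1
  have h2 := abs_le.1 (abs_greenTail_le hd hS (proj N x))
  have h3 := green_le hd hS x
  have h4 := sum_lazyIter_le_green hd S x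
  have h5 := (mul_inv_pow_le hd hS (by omega : S ≤ N)).trans
    (inv_le_rpow_eighth (by exact_mod_cast (by omega : 1 ≤ N)))
  have h6 : (S : ℝ) ^ (-(1 / 8) : ℝ) ≤ 2 * (N : ℝ) ^ (-(1 / 8) : ℝ) := by
    have hN4 : (N : ℝ) / 4 ≤ S := by
      rw [div_le_iff₀ (by norm_num)]
      exact_mod_cast (by omega : N ≤ S * 4)
    have hNpos : (0 : ℝ) < N := by exact_mod_cast (by omega : 0 < N)
    refine (Real.rpow_le_rpow_of_nonpos (by positivity) hN4 (by norm_num)).trans ?_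
    rw [Real.div_rpow hNpos.le (by norm_num), div_eq_mul_inv, ← Real.rpow_neg (by norm_num),
      mul_comm]
    gcongr
    calc (4 : ℝ) ^ (- -(1 / 8) : ℝ) ≤ 4 ^ (1 / 2 : ℝ) :=
          Real.rpow_le_rpow_of_exponent_le (by norm_num) (by norm_num)
      _ = 2 := by
          rw [show (4 : ℝ) = 2 ^ (2 : ℝ) by norm_num, ← Real.rpow_mul (by norm_num)]; norm_num
  have h7 := mul_le_mul_of_nonneg_left h6 hgC.le
  have h8 : 0 ≤ (S : ℝ) * ((N : ℝ) ^ d)⁻¹ := by positivity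
  rw [abs_le]
  constructor <;> nlinarith

lemma abs_greenT_decay (hd : 3 ≤ d) {N : ℕ} [NeZero N] {x : Lat d}
    (hx : ∀ i, 2 * |x i| ≤ N) {i : Fin d} (hi : x i ≠ 0) :
    |greenT (proj N x)| ≤ (1 + gC d) * ((x i).natAbs : ℝ) ^ (-(1 / 8) : ℝ) := by
  have hgC := gC_pos (d := d) (by omega)
  set S := (x i).natAbs with hSdef
  have hS : 1 ≤ S := Int.natAbs_pos.2 hi
  have hSN : S ≤ N := by have := hx i; rw [Int.abs_eq_natAbs] at this; omega
  have e1 : ∀ k ∈ Finset.range S, lazyIter k (proj N x) = 0 := by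
    intro k hk
    have hk := Finset.mem_range.1 hk
    have hi' := hx i
    have habs := Int.abs_eq_natAbs (x i)
    rw [lazyIter_proj k x fun j => by have := hx j; omega]
    exact lazyIter_eq_zero k x i (by omega)
  have h1 := greenT_eq (by omega) S (proj N x)
  rw [Finset.sum_sub_distrib, Finset.sum_eq_zero e1, Finset.sum_const, Finset.card_range,
    nsmul_eq_mul] at h1
  have h2 := abs_le.1 (abs_greenTail_le hd hS (proj N x))
  have hS1 : (1 : ℝ) ≤ S := by exact_mod_cast hS
  have h5 := ((mul_inv_pow_le hd hS hSN).trans (inv_anti₀ (by positivity)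
    (by exact_mod_cast hSN : (S : ℝ) ≤ N))).trans (inv_le_rpow_eighth hS1)
  have h8 : 0 ≤ (S : ℝ) * ((N : ℝ) ^ d)⁻¹ := by positivity
  have h9 : 0 ≤ gC d * (S : ℝ) ^ (-(1 / 8) : ℝ) := by positivity
  rw [abs_le]
  constructor <;> nlinarith

end Green

section Return

variable {d : ℕ} {R : Type*} [CommRing R]

/-- The probability that the walk started at `x` returns to `B` through `y`. -/
def ret {d : ℕ} {R : Type*} [CommRing R] (B : Finset (Fin d → R)) (x y : Fin d → R) : ℝ :=
  avg (harm B y) x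

lemma ret_nonneg (B : Finset (Fin d → R)) (x y : Fin d → R) : 0 ≤ ret B x y :=
  avg_nonneg fun _ => harm_nonneg _ _

lemma sum_harm (hd : 0 < d) (B : Finset (Fin d → R)) (z : Fin d → R) :
    ∑ y ∈ B, harm B y z = hit B (fun _ => 1) z := by
  rw [hit_eq_sum hd (fun _ => zero_le_one) fun _ => le_rfl]
  simp

lemma hit_one_le (hd : 0 < d) (B : Finset (Fin d → R)) (z : Fin d → R) :
    hit B (fun _ => 1) z ≤ 1 :=
  hit_le_of_super (g := fun _ => 1) (fun _ => zero_le_one) (fun _ _ => le_rfl)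
    (fun z _ => (avg_const hd 1 z).le) z

lemma sum_ret (hd : 0 < d) (B : Finset (Fin d → R)) (x : Fin d → R) :
    ∑ y ∈ B, ret B x y = avg (hit B fun _ => 1) x := by
  unfold ret
  rw [← avg_sum]
  congr 1
  funext z
  exact sum_harm hd B z

lemma sum_ret_le (hd : 0 < d) (B : Finset (Fin d → R)) (x : Fin d → R) :
    ∑ y ∈ B, ret B x y ≤ 1 := by
  rw [sum_ret hd]
  exact avg_le_const hd (hit_one_le hd B)

lemma harm_le_of_interior {B : Finset (Fin d → R)} {y : Fin d → R}
    (hy : ∀ p, y + dir p ∈ B) (z : Fin d → R) : harm B y z ≤ if z = y then 1 else 0 := by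
  refine hit_le_of_super (g := fun z => if z = y then 1 else 0) ?_ (fun _ _ => le_rfl) ?_ z
  · intro z; split_ifs <;> simp
  · intro z hz
    have h0 : avg (fun z => if z = y then (1 : ℝ) else 0) z = 0 := by
      unfold avg
      rw [Finset.sum_eq_zero, mul_zero]
      intro p _
      refine if_neg ?_
      rintro rfl
      refine hz ?_
      have := hy (p.1, !p.2)
      rwa [← neg_dir, add_neg_cancel_right] at this
    rw [h0]
    split_ifs <;> simp

lemma ret_pos_cases {B : Finset (Fin d → R)} {x y : Fin d → R} (h : 0 < ret B x y) :
    (∃ p, x + dir p = y) ∨ ((∃ p, x + dir p ∉ B) ∧ ∃ p, y + dir p ∉ B) := by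
  by_contra hcon
  push Not at hcon
  obtain ⟨h1, h2⟩ := hcon
  refine h.ne' ?_
  have h0 : ∀ p, harm B y (x + dir p) = 0 := by
    intro p
    by_cases hp : x + dir p ∈ B
    · rw [harm_on hp, if_neg (h1 p)]
    · have := harm_le_of_interior (h2 ⟨p, hp⟩) (x + dir p)
      rw [if_neg (h1 p)] at this
      exact le_antisymm this (harm_nonneg _ _)
  unfold ret avg
  simp [h0]

lemma ret_adj_ge {B : Finset (Fin d → R)} {x : Fin d → R} (p : Fin d × Bool)
    (hy : x + dir p ∈ B) : (2 * d : ℝ)⁻¹ ≤ ret B x (x + dir p) := by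
  unfold ret avg
  refine le_mul_of_one_le_right (by positivity) ?_
  have := Finset.single_le_sum (f := fun q => harm B (x + dir p) (x + dir q))
    (fun q _ => harm_nonneg _ _) (Finset.mem_univ p)
  refine le_trans ?_ this
  simp [harm_on hy]

end Return

section Potential

variable {d : ℕ}

/-- The probability that the walk started at `x` never returns to `B`. -/
def esc {d : ℕ} (B : Finset (Lat d)) (x : Lat d) : ℝ := 1 - ∑ y ∈ B, ret B x y

/-- The capacity of `B`. -/
def capa {d : ℕ} (B : Finset (Lat d)) : ℝ := ∑ x ∈ B, esc B x

lemma esc_nonneg (hd : 3 ≤ d) (B : Finset (Lat d)) (x : Lat d) : 0 ≤ esc B x :=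
  sub_nonneg.2 (sum_ret_le (by omega) B x)

lemma esc_le_one (B : Finset (Lat d)) (x : Lat d) : esc B x ≤ 1 :=
  sub_le_self _ (Finset.sum_nonneg fun y _ => ret_nonneg B x y)

lemma green_eq_sum_harm (hd : 3 ≤ d) (B : Finset (Lat d)) {y : Lat d} (hy : y ∈ B) (z : Lat d) :
    green (z - y) = ∑ x ∈ B, green (x - y) * harm B x z := by
  have hM : ∀ z : Lat d, green (z - y) ≤ 1 + gC d := fun z => green_le_const hd _
  have h0 : ∀ z : Lat d, 0 ≤ green (z - y) := fun z => green_nonneg _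
  rw [← hit_eq_sum (f := fun z => green (z - y)) (by omega) h0 hM]
  refine le_antisymm ?_ (hit_le_of_super h0 (fun _ _ => le_rfl) (fun z _ => ?_) z)
  · refine le_of_tendsto' (green_tendsto hd (z - y)) fun n => ?_
    refine le_hit (g := fun n z => 1 / 2 * ∑ k ∈ Finset.range n, lazyIter k (z - y))
      (c := 1 / 2) (by omega) h0 hM (by norm_num) (by norm_num) ?_ ?_ ?_ n z
    · intro n z _
      exact sum_lazyIter_le_green hd n _
    · intro z _; simp
    · intro n z hz
      have hne : z - y ≠ 0 := fun h => hz (by rw [sub_eq_zero.1 h]; exact hy)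
      rw [avg_const_mul, avg_sum, Finset.sum_range_succ']
      simp_rw [avg_shift]
      have h4 : lazyIter 0 (z - y) = 0 := by simp [lazyIter, hne]
      have h3 : ∀ k, lazyIter (k + 1) (z - y)
          = (lazyIter k (z - y) + avg (lazyIter k) (z - y)) / 2 := fun k => rfl
      simp_rw [h3]
      rw [h4, ← Finset.sum_div, Finset.sum_add_distrib]
      apply le_of_eq
      ring
  · rw [avg_shift, avg_green hd]
    split_ifs <;> simp

lemma sum_ret_green (hd : 3 ≤ d) (B : Finset (Lat d)) {y : Lat d} (hy : y ∈ B) (x : Lat d) :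
    ∑ w ∈ B, ret B x w * green (w - y) = green (x - y) - if x = y then 1 else 0 := by
  have h1 : (fun z => green (z - y)) = fun z => ∑ w ∈ B, green (w - y) * harm B w z :=
    funext fun z => green_eq_sum_harm hd B hy z
  have h2 : avg (fun z => green (z - y)) x = ∑ w ∈ B, ret B x w * green (w - y) := by
    rw [h1, avg_sum]
    refine Finset.sum_congr rfl fun w _ => ?_
    rw [avg_const_mul, mul_comm]
    rfl
  rw [← h2, avg_shift, avg_green hd]
  simp only [sub_eq_zero]

lemma green_sub_comm (x y : Lat d) : green (x - y) = green (y - x) := by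
  rw [← green_neg, neg_sub]

lemma matrix_identity (hd : 3 ≤ d) (B : Finset (Lat d)) :
    (1 - Matrix.of fun x y : B => ret B x y) * (Matrix.of fun x y : B => green (x.1 - y.1)) = 1 := by
  ext x y
  rw [sub_mul, one_mul, Matrix.sub_apply, Matrix.mul_apply, Matrix.one_apply]
  simp only [Matrix.of_apply]
  rw [Finset.sum_coe_sort B (fun w => ret B x w * green (w - y.1)), sum_ret_green hd B y.2]
  simp only [Subtype.ext_iff, sub_sub_cancel]

lemma sum_green_ret (hd : 3 ≤ d) (B : Finset (Lat d)) {x y : Lat d} (hx : x ∈ B) (hy : y ∈ B) :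
    ∑ w ∈ B, green (x - w) * ret B w y = green (x - y) - if x = y then 1 else 0 := by
  have h := mul_eq_one_comm.1 (matrix_identity hd B)
  have h1 := congrFun (congrFun h ⟨x, hx⟩) ⟨y, hy⟩
  rw [mul_sub, mul_one, Matrix.sub_apply, Matrix.mul_apply, Matrix.one_apply] at h1
  simp only [Matrix.of_apply] at h1
  rw [Finset.sum_coe_sort B (fun w => green (x - w) * ret B w y)] at h1
  simp only [Subtype.ext_iff] at h1
  linarith

lemma ret_symm (hd : 3 ≤ d) (B : Finset (Lat d))
    {x y : Lat d} (hx : x ∈ B) (hy : y ∈ B) : ret B x y = ret B y x := by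
  set M : Matrix B B ℝ := 1 - Matrix.of fun x y : B => ret B x y with hM
  set G : Matrix B B ℝ := Matrix.of fun x y : B => green (x.1 - y.1) with hG
  have h : M * G = 1 := matrix_identity hd B
  have hGt : G.transpose = G := by
    ext a b
    simp only [hG, Matrix.transpose_apply, Matrix.of_apply]
    exact green_sub_comm _ _
  have h2 : G * M.transpose = 1 := by
    have := congrArg Matrix.transpose h
    rwa [Matrix.transpose_mul, hGt, Matrix.transpose_one] at this
  have h3 : M = M.transpose := by
    calc M = M * (G * M.transpose) := by rw [h2, mul_one]
      _ = M.transpose := by rw [← mul_assoc, h, one_mul]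
  have h4 := congrFun (congrFun h3 ⟨x, hx⟩) ⟨y, hy⟩
  simp only [hM, Matrix.transpose_apply, Matrix.sub_apply, Matrix.one_apply, Matrix.of_apply,
    Subtype.ext_iff, eq_comm (a := y)] at h4
  linarith

lemma sum_green_esc (hd : 3 ≤ d) (B : Finset (Lat d))
    {x : Lat d} (hx : x ∈ B) : ∑ w ∈ B, green (x - w) * esc B w = 1 := by
  unfold esc
  simp_rw [mul_sub, mul_one, Finset.mul_sum]
  rw [Finset.sum_sub_distrib, Finset.sum_comm,
    Finset.sum_congr rfl fun y hy => sum_green_ret hd B hx hy, Finset.sum_sub_distrib]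
  simp [hx]

lemma hit_one_eq (hd : 3 ≤ d) (B : Finset (Lat d)) (z : Lat d) :
    hit B (fun _ => 1) z = ∑ w ∈ B, green (z - w) * esc B w := by
  rw [← sum_harm (by omega)]
  calc ∑ x ∈ B, harm B x z
      = ∑ x ∈ B, ∑ w ∈ B, green (x - w) * harm B x z * esc B w := by
        refine Finset.sum_congr rfl fun x hx => ?_
        conv_lhs => rw [← mul_one (harm B x z), ← sum_green_esc hd B hx, Finset.mul_sum]
        exact Finset.sum_congr rfl fun w _ => by ring
    _ = _ := by
        rw [Finset.sum_comm]
        refine Finset.sum_congr rfl fun w hw => ?_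
        rw [← Finset.sum_mul, ← green_eq_sum_harm hd B hw]

lemma esc_eq (hd : 3 ≤ d) (B : Finset (Lat d))
    (x : Lat d) : esc B x = 1 - avg (hit B fun _ => 1) x := by
  rw [esc, sum_ret (by omega)]

lemma capa_nonneg (hd : 3 ≤ d) (B : Finset (Lat d)) : 0 ≤ capa B :=
  Finset.sum_nonneg fun x _ => esc_nonneg hd B x

lemma capa_le_card (B : Finset (Lat d)) : capa B ≤ B.card := by
  refine (Finset.sum_le_sum fun x _ => esc_le_one B x).trans ?_
  simp

lemma sum_esc_green_sum (hd : 3 ≤ d) (B : Finset (Lat d)) :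
    ∑ x ∈ B, esc B x * ∑ y ∈ B, green (x - y) = B.card := by
  simp_rw [Finset.mul_sum]
  rw [Finset.sum_comm]
  have : ∀ y ∈ B, ∑ x ∈ B, esc B x * green (x - y) = 1 := by
    intro y hy
    rw [← sum_green_esc hd B hy]
    exact Finset.sum_congr rfl fun x _ => by rw [mul_comm, green_sub_comm]
  rw [Finset.sum_congr rfl this]
  simp

lemma card_le_mul_capa (hd : 3 ≤ d) (B : Finset (Lat d))
    {K : ℝ} (hK : ∀ x ∈ B, ∑ y ∈ B, green (x - y) ≤ K) :
    (B.card : ℝ) ≤ K * capa B := by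
  rw [← sum_esc_green_sum hd B, capa, Finset.mul_sum]
  refine Finset.sum_le_sum fun x hx => ?_
  rw [mul_comm]
  exact mul_le_mul_of_nonneg_right (hK x hx) (esc_nonneg hd B x)

lemma sum_esc_hit (hd : 3 ≤ d) {B : Finset (Lat d)} {V : Finset (Lat d)} (hV : V ⊆ B) :
    ∑ x ∈ B, esc B x * hit V (fun _ => 1) x = capa V := by
  simp_rw [hit_one_eq hd V, Finset.mul_sum]
  rw [Finset.sum_comm]
  refine Finset.sum_congr rfl fun y hy => ?_
  have : ∑ x ∈ B, esc B x * green (x - y) = 1 := by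
    rw [← sum_green_esc hd B (hV hy)]
    exact Finset.sum_congr rfl fun x _ => by rw [mul_comm, green_sub_comm]
  calc ∑ x ∈ B, esc B x * (green (x - y) * esc V y)
      = (∑ x ∈ B, esc B x * green (x - y)) * esc V y := by
        rw [Finset.sum_mul]; exact Finset.sum_congr rfl fun x _ => by ring
    _ = esc V y := by rw [this, one_mul]

/-- The avoidance probability of `V ⊆ B` decomposed at the first return to `B`. -/
lemma one_sub_hit_eq (hd : 3 ≤ d) {B : Finset (Lat d)}
    {V : Finset (Lat d)} (hV : V ⊆ B) {x : Lat d} (hx : x ∉ V) :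
    1 - hit V (fun _ => 1) x
      = esc B x + ∑ y ∈ B, ret B x y * (1 - hit V (fun _ => 1) y) := by
  have h1 : hit V (fun _ => 1) = fun z => ∑ y ∈ B, hit V (fun _ => 1) y * harm B y z := by
    funext z
    rw [hit_one_eq hd V]
    rw [Finset.sum_congr rfl fun w hw => by rw [green_eq_sum_harm hd B (hV hw) z]]
    simp_rw [Finset.sum_mul]
    rw [Finset.sum_comm]
    refine Finset.sum_congr rfl fun y _ => ?_
    rw [hit_one_eq hd V, Finset.sum_mul]
    exact Finset.sum_congr rfl fun w _ => by ring
  have h2 : hit V (fun _ => 1) x = ∑ y ∈ B, hit V (fun _ => 1) y * ret B x y := by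
    rw [hit_off (M := 1) (by omega) (fun _ => zero_le_one) (fun _ => le_rfl) hx]
    conv_lhs => rw [h1]
    rw [avg_sum]
    exact Finset.sum_congr rfl fun y _ => avg_const_mul _ _ _
  have h3 : ∑ y ∈ B, ret B x y * (1 - hit V (fun _ => 1) y)
      = ∑ y ∈ B, ret B x y - ∑ y ∈ B, hit V (fun _ => 1) y * ret B x y := by
    rw [← Finset.sum_sub_distrib]
    exact Finset.sum_congr rfl fun y _ => by ring
  rw [h3, ← h2, esc]
  ring

/-- A function dominated by its image under the return kernel vanishes. -/
lemma eq_zero_of_abs_le_ret (hd : 3 ≤ d) {B : Finset (Lat d)} {φ : Lat d → ℝ}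
    (h : ∀ x ∈ B, |φ x| ≤ ∑ y ∈ B, ret B x y * |φ y|) {z : Lat d} (hz : z ∈ B) : φ z = 0 := by
  have h1 : ∑ x ∈ B, green (z - x) * (|φ x| - ∑ y ∈ B, ret B x y * |φ y|) ≤ 0 :=
    Finset.sum_nonpos fun x hx =>
      mul_nonpos_of_nonneg_of_nonpos (green_nonneg _) (sub_nonpos.2 (h x hx))
  have h2 : ∑ x ∈ B, green (z - x) * (|φ x| - ∑ y ∈ B, ret B x y * |φ y|) = |φ z| := by
    simp_rw [mul_sub, Finset.mul_sum]
    rw [Finset.sum_sub_distrib, Finset.sum_comm]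
    have : ∀ y ∈ B, ∑ x ∈ B, green (z - x) * (ret B x y * |φ y|)
        = (green (z - y) - if z = y then 1 else 0) * |φ y| := by
      intro y hy
      rw [← sum_green_ret hd B hz hy, Finset.sum_mul]
      exact Finset.sum_congr rfl fun x _ => by ring
    rw [Finset.sum_congr rfl this]
    simp_rw [sub_mul]
    rw [Finset.sum_sub_distrib]
    simp [hz]
  rw [h2] at h1
  exact abs_nonpos_iff.1 h1

end Potential

section Comparison

variable {d : ℕ}

lemma sum_ret_torus (hd : 0 < d) {N : ℕ} [NeZero N] {A : Finset (Torus d N)} {y : Torus d N}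
    (f : Torus d N → ℝ) :
    ∑ x ∈ A, ((if x = y then 1 else 0) - ret A x y) * f x
      = ∑ z, harm A y z * (f z - avg f z) := by
  have h1 : ∑ z, (harm A y z - avg (harm A y) z) * f z
      = ∑ z, harm A y z * (f z - avg f z) := by
    simp_rw [sub_mul, mul_sub]
    rw [Finset.sum_sub_distrib, Finset.sum_sub_distrib, sum_avg_mul]
  rw [← h1]
  rw [← Finset.sum_subset (Finset.subset_univ A)]
  · refine Finset.sum_congr rfl fun x hx => ?_
    rw [harm_on hx]
    by_cases h : x = y <;> simp [h, ret]
  · intro z _ hz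
    rw [harm_off hd y hz, sub_self, zero_mul]

/-- The chart of the torus centred at `z`. -/
def emb {d N : ℕ} (z : Torus d N) (x : Lat d) : Torus d N := z + proj N x

lemma emb_sub_emb {N : ℕ} (z : Torus d N) (x y : Lat d) : emb z x - emb z y = proj N (x - y) := by
  rw [proj_sub]; simp [emb]

/-- The return kernel corrected to be doubly stochastic. -/
def hatRet {d : ℕ} (B : Finset (Lat d)) (x y : Lat d) : ℝ :=
  ret B x y + esc B x * esc B y / capa B

lemma hatRet_nonneg (hd : 3 ≤ d) (B : Finset (Lat d)) (x y : Lat d) : 0 ≤ hatRet B x y :=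
  add_nonneg (ret_nonneg B x y) (div_nonneg (mul_nonneg (esc_nonneg hd B x) (esc_nonneg hd B y))
    (capa_nonneg hd B))

lemma hatRet_symm (hd : 3 ≤ d) {B : Finset (Lat d)} {x y : Lat d} (hx : x ∈ B) (hy : y ∈ B) :
    hatRet B x y = hatRet B y x := by
  unfold hatRet; rw [ret_symm hd B hx hy, mul_comm (esc B x)]

lemma sum_hatRet (hd : 3 ≤ d) {B : Finset (Lat d)} (hcap : capa B ≠ 0) {y : Lat d} (hy : y ∈ B) :
    ∑ x ∈ B, hatRet B x y = 1 := by
  rw [Finset.sum_congr rfl fun x hx => hatRet_symm hd hx hy]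
  unfold hatRet
  rw [Finset.sum_add_distrib, ← Finset.sum_div, ← Finset.mul_sum]
  have : ∑ x ∈ B, esc B x = capa B := rfl
  rw [this, mul_div_cancel_right₀ _ hcap, esc]
  ring

lemma sum_green_hatRet (hd : 3 ≤ d) {B : Finset (Lat d)} {x y : Lat d} (hx : x ∈ B) (hy : y ∈ B) :
    ∑ w ∈ B, green (x - w) * ((if w = y then 1 else 0) - hatRet B w y)
      = (if x = y then 1 else 0) - esc B y / capa B := by
  have e : ∀ w, green (x - w) * ((if w = y then 1 else 0) - hatRet B w y)
      = green (x - w) * (if w = y then 1 else 0) - green (x - w) * ret B w y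
        - green (x - w) * esc B w * (esc B y / capa B) := by
    intro w; unfold hatRet; ring
  simp_rw [e]
  rw [Finset.sum_sub_distrib, Finset.sum_sub_distrib, ← Finset.sum_mul, sum_green_esc hd B hx,
    sum_green_ret hd B hx hy]
  simp [hy]

lemma abs_ret_emb_sub_hatRet_le (hd : 3 ≤ d) {N : ℕ} [NeZero N] (z : Torus d N)
    {B : Finset (Lat d)} (hinj : Set.InjOn (emb z) B) (hcap : capa B ≠ 0) {η : ℝ}
    (hη : ∀ x ∈ B, ∀ y ∈ B, |green (x - y) - greenT (proj N (x - y))| ≤ η)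
    {v y : Lat d} (hv : v ∈ B) (hy : y ∈ B) :
    |ret (B.image (emb z)) (emb z v) (emb z y) - hatRet B v y| ≤ 4 * η := by
  set A := B.image (emb z) with hA
  set q : Lat d → ℝ := fun x => (if x = y then 1 else 0) - ret A (emb z x) (emb z y) with hq
  set p : Lat d → ℝ := fun w => (if w = v then 1 else 0) - hatRet B w v with hp
  have hη0 : 0 ≤ η := (abs_nonneg _).trans (hη v hv v hv)
  have hyA : emb z y ∈ A := Finset.mem_image_of_mem _ hy
  have hiff : ∀ x ∈ B, (emb z x = emb z y ↔ x = y) := fun x hx => hinj.eq_iff hx hy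
  have hsum : ∀ f : Torus d N → ℝ, ∑ x ∈ B, q x * f (emb z x)
      = ∑ w, harm A (emb z y) w * (f w - avg f w) := by
    intro f
    rw [← sum_ret_torus (by omega), hA, Finset.sum_image fun a ha b hb h => hinj ha hb h]
    refine Finset.sum_congr rfl fun x hx => ?_
    simp only [hq, hiff x hx, hA]
  have hq0 : ∑ x ∈ B, q x = 0 := by
    have := hsum fun _ => 1
    simpa [avg_const (show 0 < d by omega)] using this
  obtain ⟨c, hc⟩ : ∃ c : ℝ, ∀ w ∈ B, ∑ x ∈ B, q x * greenT (proj N (x - w))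
      = (if w = y then 1 else 0) - c := by
    refine ⟨∑ s, harm A (emb z y) s * ((N : ℝ) ^ d)⁻¹, fun w hw => ?_⟩
    have h1 := hsum fun s => greenT (s - emb z w)
    simp_rw [avg_shift, greenT_sub_avg (show 0 < d by omega), emb_sub_emb, mul_sub, sub_eq_zero]
      at h1
    rw [h1, Finset.sum_sub_distrib]
    congr 1
    simp only [mul_ite, mul_one, mul_zero, Finset.sum_ite_eq', Finset.mem_univ, if_true]
    rw [harm_on (Finset.mem_image_of_mem _ hw)]
    simp only [hiff w hw]
  have hp0 : ∑ w ∈ B, p w = 0 := by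
    simp only [hp]
    rw [Finset.sum_sub_distrib, sum_hatRet hd hcap hv]
    simp [hv]
  have hpG : ∀ x ∈ B, ∑ w ∈ B, green (x - w) * p w
      = (if x = v then 1 else 0) - esc B v / capa B := fun x hx => sum_green_hatRet hd hx hv
  have main : ∑ x ∈ B, ∑ w ∈ B, q x * (green (x - w) - greenT (proj N (x - w))) * p w
      = q v - p y := by
    have e1 : ∀ x w, q x * (green (x - w) - greenT (proj N (x - w))) * p w
        = q x * (green (x - w) * p w) - q x * greenT (proj N (x - w)) * p w := by
      intro x w; ring
    simp_rw [e1, Finset.sum_sub_distrib]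
    congr 1
    · simp_rw [← Finset.mul_sum]
      rw [Finset.sum_congr rfl fun x hx => by rw [hpG x hx]]
      simp_rw [mul_sub]
      rw [Finset.sum_sub_distrib, ← Finset.sum_mul, hq0]
      simp [hv]
    · rw [Finset.sum_comm]
      simp_rw [← Finset.sum_mul]
      rw [Finset.sum_congr rfl fun w hw => by rw [hc w hw]]
      simp_rw [sub_mul]
      rw [Finset.sum_sub_distrib, ← Finset.mul_sum, hp0]
      simp [hy]
  have hval : ret A (emb z v) (emb z y) - hatRet B v y = -(q v - p y) := by
    simp only [hq, hp, hatRet_symm hd hv hy, eq_comm (a := v)]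
    ring
  have hq2 : ∑ x ∈ B, |q x| ≤ 2 := by
    have h1 : ∑ x ∈ B, ret A (emb z x) (emb z y) = 1 := by
      have := hq0
      simp only [hq] at this
      rw [Finset.sum_sub_distrib, Finset.sum_ite_eq', if_pos hy] at this
      linarith
    calc ∑ x ∈ B, |q x| ≤ ∑ x ∈ B, ((if x = y then 1 else 0) + ret A (emb z x) (emb z y)) := by
          refine Finset.sum_le_sum fun x _ => ?_
          refine (abs_sub _ _).trans_eq ?_
          rw [abs_of_nonneg (ret_nonneg A _ _), abs_of_nonneg]
          split_ifs <;> simp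
      _ = 2 := by
          rw [Finset.sum_add_distrib, h1, Finset.sum_ite_eq', if_pos hy]; norm_num
  have hp2 : ∑ w ∈ B, |p w| ≤ 2 := by
    calc ∑ w ∈ B, |p w| ≤ ∑ w ∈ B, ((if w = v then 1 else 0) + hatRet B w v) := by
          refine Finset.sum_le_sum fun x _ => ?_
          refine (abs_sub _ _).trans_eq ?_
          rw [abs_of_nonneg (hatRet_nonneg hd B _ _), abs_of_nonneg]
          split_ifs <;> simp
      _ = 2 := by
          rw [Finset.sum_add_distrib, sum_hatRet hd hcap hv, Finset.sum_ite_eq', if_pos hv]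
          norm_num
  rw [hval, abs_neg, ← main]
  calc |∑ x ∈ B, ∑ w ∈ B, q x * (green (x - w) - greenT (proj N (x - w))) * p w|
      ≤ ∑ x ∈ B, ∑ w ∈ B, |q x| * η * |p w| := by
        refine (Finset.abs_sum_le_sum_abs _ _).trans (Finset.sum_le_sum fun x hx => ?_)
        refine (Finset.abs_sum_le_sum_abs _ _).trans (Finset.sum_le_sum fun w hw => ?_)
        rw [abs_mul, abs_mul]
        gcongr
        exact hη x hx w hw
    _ = (∑ x ∈ B, |q x|) * (∑ w ∈ B, |p w|) * η := by
        rw [Finset.sum_mul_sum, Finset.sum_mul]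
        refine Finset.sum_congr rfl fun x _ => ?_
        rw [Finset.sum_mul]
        exact Finset.sum_congr rfl fun w _ => by ring
    _ ≤ 2 * 2 * η := by gcongr
    _ = 4 * η := by ring

lemma avg_coord (hd : 0 < d) (x : Lat d) (i : Fin d) : avg (fun z : Lat d => (z i : ℝ)) x = x i := by
  unfold avg
  have hd' : (d : ℝ) ≠ 0 := by positivity
  have h : ∀ j : Fin d, (((x + (dir (j, true) : Lat d) : Lat d) i : ℤ) : ℝ)
      + (((x + (dir (j, false) : Lat d) : Lat d) i : ℤ) : ℝ) = 2 * x i := by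
    intro j
    have : (dir (j, false) : Lat d) = - dir (j, true) := by rw [neg_dir]; rfl
    rw [this]
    simp only [Pi.add_apply, Pi.neg_apply]
    push_cast
    ring
  rw [Fintype.sum_prod_type]
  simp_rw [Fintype.sum_bool, h]
  simp only [Finset.sum_const, Finset.card_univ, Fintype.card_fin, nsmul_eq_mul]
  field_simp

/-- The lattice box of radius `r`. -/
def box (d r : ℕ) : Finset (Lat d) := Fintype.piFinset fun _ => Finset.Icc (-(r : ℤ)) r

lemma mem_box {r : ℕ} {x : Lat d} : x ∈ box d r ↔ ∀ i, |x i| ≤ r := by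
  simp [box, abs_le]

lemma card_box (r : ℕ) : (box d r).card = (2 * r + 1) ^ d := by
  simp only [box, Fintype.card_piFinset, Int.card_Icc, Finset.prod_const, Finset.card_univ,
    Fintype.card_fin]
  congr 1
  omega

lemma esc_box_ge (hd : 3 ≤ d) {r M : ℕ} (hM : 2 ≤ M)
    (hMr : ((box d r).card : ℝ) * (gC d * (M : ℝ) ^ (-(1 / 8) : ℝ)) ≤ 1 / 2)
    {y : Lat d} (hy : y ∈ box d r) {p : Fin d × Bool} (hp : y + dir p ∉ box d r) :
    (4 * d * M : ℝ)⁻¹ ≤ esc (box d r) y := by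
  obtain ⟨i, s⟩ := p
  have hd0 : 0 < d := by omega
  have hdR : (0 : ℝ) < d := by exact_mod_cast hd0
  have hMR : (2 : ℝ) ≤ M := by exact_mod_cast hM
  set σ : ℤ := if s then 1 else -1 with hσ
  have hσ2 : σ = 1 ∨ σ = -1 := by cases s <;> simp [hσ]
  have hyb := mem_box.1 hy
  have hdir : ∀ j, (dir (i, s) : Lat d) j = if j = i then σ else 0 := by
    intro j; simp only [dir, Pi.single_apply, hσ]
  have hyi : σ * y i = r := by
    by_contra hne
    refine hp (mem_box.2 fun j => ?_)
    have h1 := abs_le.1 (hyb j)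
    rw [Pi.add_apply, hdir]
    split_ifs with hj
    · subst hj
      rw [abs_le]
      rcases hσ2 with h | h <;> rw [h] at hne ⊢ <;> constructor <;> omega
    · simpa using hyb j
  set ℓ : Lat d → ℤ := fun z => σ * z i - r with hℓ
  set h : Lat d → ℝ := hit (box d r) fun _ => 1 with hh
  set ψ : Lat d → ℝ := fun z => if 0 < ℓ z ∧ ℓ z < M then 1 - ℓ z / (2 * M) else 1 with hψ
  have hh1 : ∀ z, h z ≤ 1 := hit_one_le hd0 _
  have hh0 : ∀ z, 0 ≤ h z := fun z => hit_nonneg (fun _ => zero_le_one) z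
  have hfar : ∀ z, (M : ℤ) ≤ ℓ z → h z ≤ 1 / 2 := by
    intro z hz
    rw [hh, hit_one_eq hd]
    refine le_trans ?_ hMr
    rw [← nsmul_eq_mul]
    refine Finset.sum_le_card_nsmul _ _ _ fun w hw => ?_
    have hw1 := abs_le.1 (mem_box.1 hw i)
    have hbig : M ≤ ((z - w) i).natAbs := by
      simp only [hℓ] at hz
      rw [Pi.sub_apply]
      rcases hσ2 with h' | h' <;> rw [h'] at hz <;> omega
    have hne : (z - w) i ≠ 0 := by intro h0; rw [h0] at hbig; simp at hbig; omega
    refine (mul_le_of_le_one_right (green_nonneg _) (esc_le_one _ _)).trans ?_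
    refine (green_decay hd hne).trans ?_
    have := (gC_pos hd0 : 0 < gC d)
    exact mul_le_mul_of_nonneg_left
      (Real.rpow_le_rpow_of_nonpos (by linarith) (by exact_mod_cast hbig) (by norm_num)) this.le
  have hψ1 : ∀ z, ψ z ≤ 1 := by
    intro z
    simp only [hψ]
    split_ifs with hc
    · have : (0 : ℝ) ≤ ℓ z := by exact_mod_cast hc.1.le
      have : 0 ≤ (ℓ z : ℝ) / (2 * M) := by positivity
      linarith
    · exact le_rfl
  have hψ0 : ∀ z, 0 ≤ ψ z := by
    intro z
    simp only [hψ]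
    split_ifs with hc
    · have : (ℓ z : ℝ) ≤ M := by exact_mod_cast hc.2.le
      have : (ℓ z : ℝ) / (2 * M) ≤ 1 := by rw [div_le_one (by linarith)]; linarith
      linarith
    · exact zero_le_one
  have havgl : ∀ z, avg (fun z => 1 - (ℓ z : ℝ) / (2 * M)) z = 1 - ℓ z / (2 * M) := by
    intro z
    have e : (fun z : Lat d => 1 - (ℓ z : ℝ) / (2 * M))
        = fun z => (1 + (r : ℝ) / (2 * M)) - (σ / (2 * M) : ℝ) * (z i : ℝ) := by
      funext z; simp only [hℓ]; push_cast; ring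
    rw [e, avg_sub, avg_const hd0, avg_const_mul, avg_coord hd0]
    simp only [hℓ]; push_cast; ring
  have key : ∀ z, h z ≤ min (h z) (ψ z) := by
    refine hit_le_of_super (g := fun z => min (h z) (ψ z)) (fun z => le_min (hh0 z) (hψ0 z)) ?_ ?_
    · intro z hz
      have hz1 := abs_le.1 (mem_box.1 hz i)
      have h2 : ¬ (0 < ℓ z ∧ ℓ z < M) := by
        simp only [hℓ]
        rcases hσ2 with h' | h' <;> rw [h'] <;> omega
      simp only [hψ, if_neg h2]
      rw [hh, hit_on hz, min_self]
    · intro z hz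
      refine le_min ?_ ?_
      · conv_rhs => rw [hh, hit_off (M := 1) hd0 (fun _ => zero_le_one) (fun _ => le_rfl) hz]
        exact avg_mono fun p => min_le_left _ _
      · by_cases hc : 0 < ℓ z ∧ ℓ z < M
        · simp only [hψ, if_pos hc]
          rw [← havgl z]
          refine avg_mono fun p => ?_
          have hstep : |ℓ (z + dir p) - ℓ z| ≤ 1 := by
            have := dir_int_abs_le p i
            have e : ℓ (z + dir p) - ℓ z = σ * (dir p : Lat d) i := by
              simp only [hℓ, Pi.add_apply]; ring
            rw [e, abs_mul]
            rcases hσ2 with h' | h' <;> rw [h'] <;> simpa using this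
          rw [abs_le] at hstep
          by_cases hin : 0 < ℓ (z + dir p) ∧ ℓ (z + dir p) < M
          · exact (min_le_right _ _).trans_eq (by rw [if_pos hin])
          · by_cases hbig : (M : ℤ) ≤ ℓ (z + dir p)
            · have hMe : ℓ (z + dir p) = M := by omega
              refine (min_le_left _ _).trans ((hfar _ hbig).trans_eq ?_)
              rw [hMe]
              push_cast
              field_simp
              norm_num
            · have h0 : ℓ (z + dir p) = 0 := by omega
              refine (min_le_left _ _).trans ((hh1 _).trans_eq ?_)
              rw [h0]
              simp
        · simp only [hψ, if_neg hc]
          exact avg_le_const hd0 fun w => (min_le_left _ _).trans (hh1 w)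
  have hstep : h (y + dir (i, s)) ≤ 1 - 1 / (2 * M) := by
    refine ((key _).trans (min_le_right _ _)).trans_eq ?_
    have hl : ℓ (y + dir (i, s)) = 1 := by
      simp only [hℓ, Pi.add_apply, hdir, if_true, mul_add, hyi]
      rcases hσ2 with h' | h' <;> rw [h'] <;> ring
    simp only [hψ]
    rw [hl, if_pos ⟨one_pos, by exact_mod_cast hM⟩]
    norm_num
  rw [esc_eq hd]
  have hfin : (2 * d : ℝ)⁻¹ * (1 / (2 * M)) ≤ avg (fun z => 1 - h z) y := by
    unfold avg
    gcongr
    have := Finset.single_le_sum (f := fun q => 1 - h (y + dir q))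
      (fun q _ => sub_nonneg.2 (hh1 _)) (Finset.mem_univ (i, s))
    linarith
  rw [avg_sub, avg_const hd0] at hfin
  refine le_trans (le_of_eq ?_) hfin
  field_simp
  norm_num

end Comparison

section GreenSums

variable {d : ℕ}

lemma emb_injOn {N r : ℕ} (hN : 2 * r + 1 < N) (z : Torus d N) {x y : Lat d}
    (hxy : ∀ i, |x i - y i| ≤ 2 * r + 1) (h : emb z x = emb z y) : x = y := by
  have h1 : proj N (x - y) = 0 := by rw [← emb_sub_emb z, h, sub_self]
  exact sub_eq_zero.1 ((proj_eq_zero_iff fun i => (hxy i).trans_lt (by exact_mod_cast hN)).1 h1)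

lemma emb_injOn_box {N r : ℕ} (hN : 2 * r + 1 < N) (z : Torus d N) :
    Set.InjOn (emb z) (box d r : Set (Lat d)) := by
  intro x hx y hy h
  refine emb_injOn hN z (fun i => ?_) h
  have h1 := abs_le.1 (mem_box.1 hx i)
  have h2 := abs_le.1 (mem_box.1 hy i)
  rw [abs_le]
  constructor <;> linarith

lemma emb_add_dir {N : ℕ} (z : Torus d N) (x : Lat d) (p : Fin d × Bool) :
    emb z x + dir p = emb z (x + dir p) := by
  simp only [emb, proj_add, proj_dir, add_assoc]

lemma exists_emb_eq {N : ℕ} [NeZero N] (z x : Torus d N) :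
    ∃ w : Lat d, emb z w = x ∧ ∀ i, 2 * |w i| ≤ N := by
  refine ⟨fun i => ((x - z) i).valMinAbs, ?_, fun i => ?_⟩
  · funext i
    simp [emb, proj]
  · have := ((x - z) i).natAbs_valMinAbs_le
    change 2 * |((x - z) i).valMinAbs| ≤ (N : ℤ)
    rw [Int.abs_eq_natAbs]
    omega

lemma sum_le_of_decay {ι : Type*} (s : Finset ι) {w : ι → Lat d} (hw : Set.InjOn w s) {j : ℕ}
    {f : ι → ℝ} {c₁ c₂ : ℝ} (h1 : ∀ i ∈ s, f i ≤ c₁) (hc1 : 0 ≤ c₁) (hc2 : 0 ≤ c₂)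
    (h2 : ∀ i ∈ s, ∀ k, j < (w i k).natAbs → f i ≤ c₂) :
    ∑ i ∈ s, f i ≤ (2 * j + 1 : ℕ) ^ d * c₁ + s.card * c₂ := by
  rw [← Finset.sum_filter_add_sum_filter_not s fun i => w i ∈ box d j]
  refine add_le_add ?_ ?_
  · refine (Finset.sum_le_card_nsmul _ _ c₁ fun i hi => h1 i (Finset.mem_filter.1 hi).1).trans ?_
    rw [nsmul_eq_mul]
    refine mul_le_mul_of_nonneg_right ?_ hc1
    rw [← Nat.cast_pow, ← card_box]
    refine Nat.cast_le.2 (Finset.card_le_card_of_injOn w (fun i hi => ?_) fun a ha b hb h => ?_)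
    · exact (Finset.mem_filter.1 hi).2
    · exact hw (Finset.mem_filter.1 ha).1 (Finset.mem_filter.1 hb).1 h
  · refine (Finset.sum_le_card_nsmul _ _ c₂ fun i hi => ?_).trans ?_
    · obtain ⟨his, hn⟩ := Finset.mem_filter.1 hi
      rw [mem_box] at hn
      push Not at hn
      obtain ⟨k, hk⟩ := hn
      rw [Int.abs_eq_natAbs] at hk
      exact h2 i his k (by exact_mod_cast hk)
    · rw [nsmul_eq_mul]
      refine mul_le_mul_of_nonneg_right ?_ hc2
      exact_mod_cast Finset.card_filter_le _ _

lemma sum_green_le (hd : 3 ≤ d) (B : Finset (Lat d)) {j : ℕ} (hj : 1 ≤ j) (x : Lat d) :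
    ∑ y ∈ B, green (x - y)
      ≤ (2 * j + 1 : ℕ) ^ d * (1 + gC d) + B.card * ((1 + gC d) * (j : ℝ) ^ (-(1 / 8) : ℝ)) := by
  have hg : 0 < gC d := gC_pos (by omega)
  refine sum_le_of_decay B (w := fun y => x - y) (fun a _ b _ h => by simpa using h)
    (fun y _ => green_le_const hd _) (by positivity) (by positivity) fun y _ k hk => ?_
  have hne : (x - y) k ≠ 0 := fun h => by simp only [h] at hk; simp at hk
  refine (green_decay hd hne).trans ?_
  have : (0 : ℝ) < j := by exact_mod_cast hj
  refine mul_le_mul (by linarith) ?_ (by positivity) (by positivity)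
  exact Real.rpow_le_rpow_of_nonpos this (by exact_mod_cast hk.le) (by norm_num)

lemma sum_abs_greenT_le (hd : 3 ≤ d) {N : ℕ} [NeZero N] (z : Torus d N) {B : Finset (Lat d)}
    (hinj : Set.InjOn (emb z) B) {j : ℕ} (hj : 1 ≤ j) (x : Torus d N) :
    ∑ y ∈ B, |greenT (x - emb z y)|
      ≤ (2 * j + 1 : ℕ) ^ d * (1 + gC d) + B.card * ((1 + gC d) * (j : ℝ) ^ (-(1 / 8) : ℝ)) := by
  have hg : 0 < gC d := gC_pos (by omega)
  choose w hw hw2 using fun y : Lat d => exists_emb_eq (0 : Torus d N) (x - emb z y)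
  have hw' : ∀ y, proj N (w y) = x - emb z y := fun y => by rw [← hw y]; simp [emb]
  refine sum_le_of_decay B (w := w) (fun a ha b hb h => ?_)
    (fun y _ => (abs_greenT_le hd _).trans (by linarith)) (by positivity) (by positivity)
    fun y _ k hk => ?_
  · refine hinj ha hb ?_
    have := hw' a
    rw [h, hw' b] at this
    exact (sub_right_inj.1 this).symm
  · have hne : w y k ≠ 0 := fun h => by rw [h] at hk; simp at hk
    rw [← hw']
    refine (abs_greenT_decay hd (hw2 y) hne).trans ?_
    have : (0 : ℝ) < j := by exact_mod_cast hj
    refine mul_le_mul_of_nonneg_left ?_ (by positivity)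
    exact Real.rpow_le_rpow_of_nonpos this (by exact_mod_cast hk.le) (by norm_num)

lemma ret_emb_le (hd : 3 ≤ d) {N r : ℕ} [NeZero N] (hN : 8 * (r + 1) ≤ N) (z : Torus d N)
    (hcap : 0 < capa (box d r)) {em ε : ℝ} (hem : 0 < em) (hem1 : em ≤ (2 * d : ℝ)⁻¹)
    (hesc : ∀ y ∈ box d r, (∃ p, y + dir p ∉ box d r) → em ≤ esc (box d r) y)
    (hε0 : 0 ≤ ε)
    (hε : 4 * ((1 + 4 * gC d) * (N : ℝ) ^ (-(1 / 8) : ℝ)) ≤ ε * (em ^ 2 / (box d r).card))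
    {v y : Lat d} (hv : v ∈ box d r) (hy : y ∈ box d r) :
    ret ((box d r).image (emb z)) (emb z v) (emb z y) ≤ (1 + ε) * hatRet (box d r) v y := by
  set B := box d r with hB
  have hinj : Set.InjOn (emb z) B := emb_injOn_box (by omega) z
  have h0 := hatRet_nonneg hd B v y
  rcases (ret_nonneg (B.image (emb z)) (emb z v) (emb z y)).eq_or_lt with h | h
  · rw [← h]; positivity
  have hcard : (1 : ℝ) ≤ B.card := by
    exact_mod_cast Finset.card_pos.2 ⟨v, hv⟩
  have hlow : em ^ 2 / B.card ≤ hatRet B v y := by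
    have hs0 : 0 ≤ esc B v * esc B y / capa B :=
      div_nonneg (mul_nonneg (esc_nonneg hd B v) (esc_nonneg hd B y)) hcap.le
    have hex : ∀ x : Lat d, (∃ p, emb z x + dir p ∉ B.image (emb z)) → ∃ p, x + dir p ∉ B := by
      rintro x ⟨p, hp⟩
      refine ⟨p, fun hmem => hp ?_⟩
      rw [emb_add_dir]
      exact Finset.mem_image_of_mem _ hmem
    rcases ret_pos_cases h with ⟨p, hp⟩ | ⟨h1, h2⟩
    · rw [emb_add_dir] at hp
      have he : v + dir p = y := by
        refine emb_injOn (r := r) (by omega) z (fun i => ?_) hp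
        have h1 := abs_le.1 (mem_box.1 hv i)
        have h2 := abs_le.1 (mem_box.1 hy i)
        have h3 := abs_le.1 (dir_int_abs_le p i)
        rw [Pi.add_apply, abs_le]
        constructor <;> linarith
      have h1 : (2 * d : ℝ)⁻¹ ≤ ret B v y := by
        rw [← he]; exact ret_adj_ge p (by rw [he]; exact hy)
      have h2 : em ^ 2 / B.card ≤ em := by
        have hem2 : em ≤ 1 := hem1.trans (inv_le_one_of_one_le₀ (by
          have : (3 : ℝ) ≤ d := by exact_mod_cast hd
          linarith))
        rw [div_le_iff₀ (by linarith)]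
        nlinarith
      unfold hatRet
      linarith
    · have h3 := hesc v hv (hex v h1)
      have h4 := hesc y hy (hex y h2)
      have h5 : em ^ 2 / B.card ≤ esc B v * esc B y / capa B := by
        have : em ^ 2 ≤ esc B v * esc B y := by rw [sq]; exact mul_le_mul h3 h4 hem.le (hem.le.trans h3)
        exact div_le_div₀ (by nlinarith) this hcap (capa_le_card B)
      unfold hatRet
      linarith [ret_nonneg B v y]
  have hcmp := abs_ret_emb_sub_hatRet_le hd z hinj hcap.ne' (B := B)
    (η := (1 + 4 * gC d) * (N : ℝ) ^ (-(1 / 8) : ℝ)) (fun x hx y hy => ?_) hv hy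
  · have := (abs_le.1 hcmp).2
    have : ε * (em ^ 2 / B.card) ≤ ε * hatRet B v y := mul_le_mul_of_nonneg_left hlow hε0
    linarith
  · rw [abs_sub_comm]
    refine abs_greenT_sub_green_le hd (by omega) fun i => ?_
    have h1 := abs_le.1 (mem_box.1 hx i)
    have h2 := abs_le.1 (mem_box.1 hy i)
    have : |(x - y) i| ≤ 2 * r := by
      rw [Pi.sub_apply, abs_le]; constructor <;> linarith
    omega

end GreenSums

/-! ### Weighted lists -/

section Lists

variable {β : Type*}

lemma tsum_list (f : List β → ℝ≥0∞) : ∑' l, f l = f [] + ∑' x, ∑' l, f (x :: l) := by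
  rw [ENNReal.tsum_eq_add_tsum_ite [], ← ENNReal.tsum_prod (f := fun x l => f (x :: l))]
  congr 1
  have hinj : Function.Injective fun p : β × List β => p.1 :: p.2 := by
    rintro ⟨a, l⟩ ⟨b, l'⟩ h
    simpa using h
  rw [← hinj.tsum_eq]
  · simp
  · intro l hl
    cases l with
    | nil => simp at hl
    | cons a l => exact ⟨(a, l), rfl⟩

/-- The weight of a trajectory with kernel `q` and final weight `e`. -/
def wq (q : β → β → ℝ≥0∞) (e : β → ℝ≥0∞) : List β → ℝ≥0∞
  | [] => 0
  | [x] => e x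
  | x :: y :: l => q x y * wq q e (y :: l)

/-- The weight of a trajectory with initial weight `i`. -/
def wt (i : β → ℝ≥0∞) (q : β → β → ℝ≥0∞) (e : β → ℝ≥0∞) : List β → ℝ≥0∞
  | [] => 0
  | x :: l => i x * wq q e (x :: l)

/-- Convolution of weights with respect to concatenation. -/
def conv (f g : List β → ℝ≥0∞) (l : List β) : ℝ≥0∞ :=
  ∑' p : List β × List β, if p.1 ++ p.2 = l then f p.1 * g p.2 else 0

/-- Convolution powers. -/
def cp (w : List β → ℝ≥0∞) : ℕ → List β → ℝ≥0∞
  | 0 => fun l => if l = [] then 1 else 0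
  | m + 1 => conv w (cp w m)

variable {q : β → β → ℝ≥0∞} {e i χ : β → ℝ≥0∞} {w : List β → ℝ≥0∞}

lemma tsum_conv_mul (f g : List β → ℝ≥0∞) (χ : β → ℝ≥0∞) :
    ∑' l, conv f g l * (l.map χ).prod
      = (∑' l, f l * (l.map χ).prod) * ∑' l, g l * (l.map χ).prod := by
  unfold conv
  simp_rw [← ENNReal.tsum_mul_right]
  rw [ENNReal.tsum_comm]
  simp_rw [ite_mul, zero_mul, ENNReal.tsum_prod', ← ENNReal.tsum_mul_left]
  refine tsum_congr fun a => tsum_congr fun b => ?_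
  rw [tsum_eq_single (a ++ b) fun l hl => if_neg hl.symm, if_pos rfl, List.map_append,
    List.prod_append]
  ring

lemma tsum_cp_mul (m : ℕ) :
    ∑' l, cp w m l * (l.map χ).prod = (∑' l, w l * (l.map χ).prod) ^ m := by
  induction m with
  | zero =>
    rw [tsum_eq_single [] fun l hl => by simp [cp, hl]]
    simp [cp]
  | succ m ih => rw [cp, tsum_conv_mul, ih, pow_succ']

lemma cp_eq_zero (hw : w [] = 0) {m : ℕ} {l : List β} (h : l.length < m) : cp w m l = 0 := by
  induction m generalizing l with
  | zero => exact absurd h (Nat.not_lt_zero _)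
  | succ m ih =>
    simp only [cp, conv, ENNReal.tsum_eq_zero]
    rintro ⟨a, b⟩
    split_ifs with hab
    · cases a with
      | nil => simp [hw]
      | cons x a =>
        rw [ih, mul_zero]
        rw [← hab] at h
        simp at h ⊢
        omega
    · rfl

lemma mul_conv_le_conv_cons {f g h : List β → ℝ≥0∞} {y : β} {c : ℝ≥0∞}
    (hf : ∀ a, c * f a ≤ h (y :: a)) (l : List β) :
    c * conv f g l ≤ conv h g (y :: l) := by
  unfold conv
  rw [← ENNReal.tsum_mul_left]
  have hinj : Function.Injective fun p : List β × List β => (y :: p.1, p.2) := by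
    rintro ⟨a, l⟩ ⟨b, l'⟩ h
    simpa using h
  refine le_trans (ENNReal.tsum_le_tsum fun p => ?_) (ENNReal.tsum_comp_le_tsum_of_injective hinj _)
  simp only [List.cons_append, List.cons.injEq, true_and]
  split_ifs
  · rw [← mul_assoc]
    exact mul_le_mul_left (hf _) _
  · simp

lemma wq_hat_le (x : β) (l : List β) :
    wq (fun x y => q x y + e x * i y) e (x :: l)
      ≤ ∑' m, conv (fun a => wq q e (x :: a)) (cp (wt i q e) m) l := by
  induction l generalizing x with
  | nil =>
    refine le_trans ?_ (ENNReal.le_tsum 0)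
    refine le_trans ?_ (ENNReal.le_tsum ([], []))
    simp [cp, wq]
  | cons y l ih =>
    simp only [wq, add_mul]
    have h1 : q x y * wq (fun x y => q x y + e x * i y) e (y :: l)
        ≤ ∑' m, ∑' p : List β × List β, if p.1 = [] then 0 else
          if p.1 ++ p.2 = y :: l then wq q e (x :: p.1) * cp (wt i q e) m p.2 else 0 := by
      refine (mul_le_mul_right (ih y) _).trans ?_
      rw [← ENNReal.tsum_mul_left]
      refine ENNReal.tsum_le_tsum fun m => ?_
      refine (mul_conv_le_conv_cons (y := y) (h := fun a => if a = [] then 0 else wq q e (x :: a))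
        (fun a => ?_) l).trans ?_
      · simp [wq]
      · refine ENNReal.tsum_le_tsum fun p => ?_
        by_cases hp : p.1 = []
        · simp only [if_pos hp, zero_mul, ite_self, le_refl]
        · simp only [if_neg hp, le_refl]
    have h2 : e x * i y * wq (fun x y => q x y + e x * i y) e (y :: l)
        ≤ ∑' m, ∑' p : List β × List β, if p.1 = [] then
          (if p.1 ++ p.2 = y :: l then wq q e (x :: p.1) * cp (wt i q e) m p.2 else 0) else 0 := by
      have h3 : i y * wq (fun x y => q x y + e x * i y) e (y :: l)
          ≤ ∑' m, cp (wt i q e) (m + 1) (y :: l) := by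
        refine (mul_le_mul_right (ih y) _).trans ?_
        rw [← ENNReal.tsum_mul_left]
        refine ENNReal.tsum_le_tsum fun m => ?_
        exact mul_conv_le_conv_cons (fun a => le_rfl) l
      rw [mul_assoc]
      refine (mul_le_mul_right h3 _).trans ?_
      rw [← ENNReal.tsum_mul_left]
      refine le_trans (ENNReal.tsum_le_tsum fun m => ?_)
        (ENNReal.tsum_comp_le_tsum_of_injective (add_left_injective 1) _)
      refine le_trans ?_ (ENNReal.le_tsum ([], y :: l))
      simp [wq]
    refine (add_le_add h1 h2).trans_eq ?_
    rw [← ENNReal.tsum_add]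
    refine tsum_congr fun m => ?_
    rw [← ENNReal.tsum_add]
    refine tsum_congr fun p => ?_
    split_ifs <;> simp

lemma wt_hat_le (l : List β) :
    wt i (fun x y => q x y + e x * i y) e l ≤ ∑' m, cp (wt i q e) m l := by
  cases l with
  | nil => simp [wt]
  | cons x l =>
    simp only [wt]
    refine (mul_le_mul_right (wq_hat_le x l) _).trans ?_
    rw [← ENNReal.tsum_mul_left]
    refine le_trans (ENNReal.tsum_le_tsum fun m => ?_)
      (ENNReal.tsum_comp_le_tsum_of_injective (add_left_injective 1) _)
    exact mul_conv_le_conv_cons (fun a => le_rfl) l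

variable [Fintype β]

lemma tsum_wq_cons (χ : β → ℝ≥0∞) (c : List β → ℝ≥0∞) (x : β) :
    ∑' l, wq q e (x :: l) * ((x :: l).map χ).prod * c l
      = χ x * (e x * c [] + ∑ y, q x y * ∑' l, wq q e (y :: l) * ((y :: l).map χ).prod
          * c (y :: l)) := by
  rw [tsum_list, tsum_fintype, mul_add, Finset.mul_sum]
  congr 1
  · simp [wq]; ring
  · refine Finset.sum_congr rfl fun y _ => ?_
    rw [← ENNReal.tsum_mul_left, ← ENNReal.tsum_mul_left]
    refine tsum_congr fun l => ?_
    simp only [wq, List.map_cons, List.prod_cons]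
    ring

lemma tsum_wq_le {h : β → ℝ≥0∞} (H : ∀ x, χ x * (e x + ∑ y, q x y * h y) ≤ h x) (x : β) :
    ∑' l, wq q e (x :: l) * ((x :: l).map χ).prod ≤ h x := by
  have key : ∀ n x, ∑' l : List β, wq q e (x :: l) * ((x :: l).map χ).prod
      * (if l.length < n then 1 else 0) ≤ h x := by
    intro n
    induction n with
    | zero => intro x; simp
    | succ n ih =>
      intro x
      rw [tsum_wq_cons χ (fun l => if l.length < n + 1 then 1 else 0)]
      refine le_trans ?_ (H x)
      simp only [List.length_nil, Nat.zero_lt_succ, if_true, mul_one, List.length_cons,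
        Nat.add_lt_add_iff_right]
      gcongr with y
      exact ih y
  rw [ENNReal.tsum_eq_iSup_sum]
  refine iSup_le fun s => ?_
  refine le_trans ?_ (key (s.sup List.length + 1) x)
  refine le_trans (le_of_eq ?_) (ENNReal.sum_le_tsum s)
  refine Finset.sum_congr rfl fun l hl => ?_
  rw [if_pos (Nat.lt_succ_of_le (Finset.le_sup (f := List.length) hl)), mul_one]

lemma tsum_wt (χ : β → ℝ≥0∞) : ∑' l, wt i q e l * (l.map χ).prod
    = ∑ x, i x * ∑' l, wq q e (x :: l) * ((x :: l).map χ).prod := by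
  rw [tsum_list, tsum_fintype]
  simp only [wt, zero_mul, zero_add]
  refine Finset.sum_congr rfl fun x _ => ?_
  rw [← ENNReal.tsum_mul_left]
  exact tsum_congr fun l => by ring

end Lists

/-! ### Trajectory weights of a finite subset of the lattice -/

section TrajectoryWeights

variable {d : ℕ}

/-- The return kernel on a finite set. -/
def qB {d : ℕ} (B : Finset (Lat d)) (x y : B) : ℝ≥0∞ := ENNReal.ofReal (ret B x.1 y.1)

/-- The escape probabilities of a finite set. -/
def eB {d : ℕ} (B : Finset (Lat d)) (x : B) : ℝ≥0∞ := ENNReal.ofReal (esc B x.1)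

/-- The normalised equilibrium measure of a finite set. -/
def iB {d : ℕ} (B : Finset (Lat d)) (x : B) : ℝ≥0∞ := ENNReal.ofReal (esc B x.1 / capa B)

lemma eB_add_sum (hd : 3 ≤ d) (B : Finset (Lat d)) {h : Lat d → ℝ} (hh : ∀ x ∈ B, 0 ≤ h x) (x : B) :
    eB B x + ∑ y, qB B x y * ENNReal.ofReal (h y.1)
      = ENNReal.ofReal (esc B x.1 + ∑ y ∈ B, ret B x.1 y * h y) := by
  have e : ∀ y : B, 0 ≤ ret B x.1 y.1 * h y.1 := fun y =>
    mul_nonneg (ret_nonneg B _ _) (hh _ y.2)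
  rw [← Finset.sum_coe_sort B fun y => ret B x.1 y * h y,
    ENNReal.ofReal_add (esc_nonneg hd B _) (Finset.sum_nonneg fun y _ => e y),
    ENNReal.ofReal_sum_of_nonneg fun y _ => e y]
  congr 1
  refine Finset.sum_congr rfl fun y _ => ?_
  rw [qB, ENNReal.ofReal_mul (ret_nonneg B _ _)]

lemma sum_iB_mul (hd : 3 ≤ d) (B : Finset (Lat d)) {h : Lat d → ℝ} (hh : ∀ x ∈ B, 0 ≤ h x) :
    ∑ x, iB B x * ENNReal.ofReal (h x.1)
      = ENNReal.ofReal ((∑ x ∈ B, esc B x * h x) / capa B) := by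
  have e : ∀ y : B, 0 ≤ esc B y.1 / capa B := fun y =>
    div_nonneg (esc_nonneg hd B _) (capa_nonneg hd B)
  rw [Finset.sum_div, ← Finset.sum_coe_sort B fun y => esc B y * h y / capa B,
    ENNReal.ofReal_sum_of_nonneg fun y _ => by
      have := mul_nonneg (e y) (hh _ y.2)
      rwa [div_mul_eq_mul_div] at this]
  refine Finset.sum_congr rfl fun y _ => ?_
  rw [iB, ← ENNReal.ofReal_mul (e y), div_mul_eq_mul_div]

lemma tsum_wt_avoid (hd : 3 ≤ d) {B V : Finset (Lat d)} (hV : V ⊆ B) (hcap : capa B ≠ 0) :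
    ∑' l, wt (iB B) (qB B) (eB B) l * (l.map fun x => if x.1 ∈ V then 0 else 1).prod
      = ENNReal.ofReal (1 - capa V / capa B) := by
  set χ : B → ℝ≥0∞ := fun x => if x.1 ∈ V then 0 else 1 with hχ
  set F : B → ℝ≥0∞ := fun x => ∑' l, wq (qB B) (eB B) (x :: l) * ((x :: l).map χ).prod with hF
  have hd0 : 0 < d := by omega
  have hF1 : ∀ x, F x ≤ 1 := by
    intro x
    refine tsum_wq_le (h := fun _ => 1) (fun x => ?_) x
    have h1 := eB_add_sum hd B (h := fun _ => 1) (fun _ _ => zero_le_one) x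
    simp only [ENNReal.ofReal_one] at h1
    rw [h1]
    simp only [mul_one]
    rw [esc, sub_add_cancel, ENNReal.ofReal_one, mul_one]
    simp only [hχ]
    split_ifs <;> simp
  have hFeq : ∀ x, F x = χ x * (eB B x + ∑ y, qB B x y * F y) := by
    intro x
    have := tsum_wq_cons (q := qB B) (e := eB B) χ (fun _ => 1) x
    simpa only [mul_one] using this
  set f : Lat d → ℝ := fun x => if hx : x ∈ B then (F ⟨x, hx⟩).toReal else 0 with hf
  have hf0 : ∀ x, 0 ≤ f x := fun x => by
    simp only [hf]; split_ifs <;> simp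
  have hFf : ∀ x : B, F x = ENNReal.ofReal (f x.1) := by
    intro x
    simp only [hf, dif_pos x.2]
    rw [ENNReal.ofReal_toReal ((hF1 x).trans_lt ENNReal.one_lt_top).ne]
  have hfeq : ∀ x ∈ B, x ∉ V → f x = esc B x + ∑ y ∈ B, ret B x y * f y := by
    intro x hx hxV
    have h1 := hFeq ⟨x, hx⟩
    simp only [hχ, if_neg hxV, one_mul] at h1
    simp_rw [hFf] at h1
    rw [eB_add_sum hd B (fun x _ => hf0 x)] at h1
    rwa [ENNReal.ofReal_eq_ofReal_iff (hf0 _)] at h1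
    exact add_nonneg (esc_nonneg hd B _) (Finset.sum_nonneg fun y _ =>
      mul_nonneg (ret_nonneg B _ _) (hf0 y))
  have hfV : ∀ x ∈ V, f x = 0 := by
    intro x hx
    have h1 := hFeq ⟨x, hV hx⟩
    simp only [hχ, if_pos hx, zero_mul] at h1
    simp only [hf, dif_pos (hV hx), h1, ENNReal.toReal_zero]
  have hφ : ∀ x ∈ B, f x - (1 - hit V (fun _ => 1) x) = 0 := by
    intro x hx
    refine eq_zero_of_abs_le_ret hd (φ := fun x => f x - (1 - hit V (fun _ => 1) x))
      (fun x hx => ?_) hx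
    by_cases hxV : x ∈ V
    · simp only [hfV x hxV, hit_on hxV, sub_self, abs_zero]
      exact Finset.sum_nonneg fun y _ => mul_nonneg (ret_nonneg B _ _) (abs_nonneg _)
    · rw [hfeq x hx hxV, one_sub_hit_eq hd hV hxV, add_sub_add_left_eq_sub,
        ← Finset.sum_sub_distrib]
      refine (Finset.abs_sum_le_sum_abs _ _).trans (Finset.sum_le_sum fun y _ => ?_)
      rw [← mul_sub, abs_mul, abs_of_nonneg (ret_nonneg B _ _)]
  rw [tsum_wt]
  have : ∀ x : B, (∑' l, wq (qB B) (eB B) (x :: l) * ((x :: l).map χ).prod)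
      = ENNReal.ofReal (f x.1) := hFf
  simp_rw [this]
  rw [sum_iB_mul hd B fun x _ => hf0 x]
  congr 1
  have h2 : ∑ x ∈ B, esc B x * f x = capa B - capa V := by
    rw [← sum_esc_hit hd hV, capa, ← Finset.sum_sub_distrib]
    refine Finset.sum_congr rfl fun x hx => ?_
    have := hφ x hx
    rw [show f x = 1 - hit V (fun _ => 1) x by linarith]
    ring
  rw [h2, sub_div, div_self hcap]

lemma tsum_wt_pow_le (hd : 3 ≤ d) (B : Finset (Lat d)) {h : Lat d → ℝ} {s : ℝ} (hs : 0 ≤ s)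
    (hh : ∀ x ∈ B, 0 ≤ h x)
    (H : ∀ x ∈ B, s * (esc B x + ∑ y ∈ B, ret B x y * h y) ≤ h x) :
    ∑' l, wt (iB B) (qB B) (eB B) l * (l.map fun _ => ENNReal.ofReal s).prod
      ≤ ENNReal.ofReal ((∑ x ∈ B, esc B x * h x) / capa B) := by
  rw [tsum_wt, ← sum_iB_mul hd B hh]
  refine Finset.sum_le_sum fun x _ => mul_le_mul_right ?_ _
  refine tsum_wq_le (χ := fun _ => ENNReal.ofReal s) (h := fun x => ENNReal.ofReal (h x.1))
    (fun x => ?_) x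
  rw [eB_add_sum hd B hh, ← ENNReal.ofReal_mul hs]
  exact ENNReal.ofReal_le_ofReal (H _ x.2)

lemma sum_ret_mul_affine (hd : 3 ≤ d) (B : Finset (Lat d)) (a : ℝ) (x : Lat d) (hx : x ∈ B) :
    esc B x + ∑ y ∈ B, ret B x y * (1 + a * ∑ z ∈ B, green (y - z))
      = 1 + a * ∑ z ∈ B, green (x - z) - a := by
  have h1 : ∑ y ∈ B, ret B x y * ∑ z ∈ B, green (y - z) = ∑ z ∈ B, green (x - z) - 1 := by
    simp_rw [Finset.mul_sum]
    rw [Finset.sum_comm, Finset.sum_congr rfl fun z hz => sum_ret_green hd B hz x,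
      Finset.sum_sub_distrib]
    simp [hx]
  have h2 : ∑ y ∈ B, ret B x y * (1 + a * ∑ z ∈ B, green (y - z))
      = ∑ y ∈ B, ret B x y + a * ∑ y ∈ B, ret B x y * ∑ z ∈ B, green (y - z) := by
    rw [Finset.mul_sum, ← Finset.sum_add_distrib]
    exact Finset.sum_congr rfl fun y _ => by ring
  rw [h2, h1, esc]
  ring

lemma sum_esc_mul_affine (hd : 3 ≤ d) {B : Finset (Lat d)} (hcap : capa B ≠ 0) (a : ℝ) :
    (∑ x ∈ B, esc B x * (1 + a * ∑ z ∈ B, green (x - z))) / capa B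
      = 1 + a * (B.card / capa B) := by
  have h2 : ∑ x ∈ B, esc B x * (1 + a * ∑ z ∈ B, green (x - z))
      = capa B + a * ∑ y ∈ B, esc B y * ∑ z ∈ B, green (y - z) := by
    rw [Finset.mul_sum, capa, ← Finset.sum_add_distrib]
    exact Finset.sum_congr rfl fun y _ => by ring
  rw [h2, sum_esc_green_sum hd, add_div, div_self hcap, mul_div_assoc]

variable {B : Finset (Lat d)} {K a : ℝ}

lemma tsum_cp_pow_le (hd : 3 ≤ d) (hcap : capa B ≠ 0) {s : ℝ} (hs : 0 ≤ s)
    (hh : ∀ x ∈ B, 0 ≤ 1 + a * ∑ z ∈ B, green (x - z))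
    (H : ∀ x ∈ B, s * (1 + a * ∑ z ∈ B, green (x - z) - a) ≤ 1 + a * ∑ z ∈ B, green (x - z))
    (m : ℕ) :
    ∑' l, cp (wt (iB B) (qB B) (eB B)) m l * ENNReal.ofReal (s ^ l.length)
      ≤ ENNReal.ofReal (Real.exp (a * (m * (B.card / capa B)))) := by
  have h1 := tsum_wt_pow_le hd B (h := fun x => 1 + a * ∑ z ∈ B, green (x - z)) hs hh
    fun x hx => by rw [sum_ret_mul_affine hd B a x hx]; exact H x hx
  have h2 := tsum_cp_mul (w := wt (iB B) (qB B) (eB B)) (χ := fun _ => ENNReal.ofReal s) m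
  simp only [List.map_const', List.prod_replicate] at h2 h1
  simp only [ENNReal.ofReal_pow hs]
  rw [sum_esc_mul_affine hd hcap] at h1
  rw [h2]
  refine (pow_le_pow_left' (h1.trans (ENNReal.ofReal_le_ofReal
    (show _ ≤ Real.exp (a * (B.card / capa B)) by
      linarith [Real.add_one_le_exp (a * (B.card / capa B))]))) m).trans_eq ?_
  rw [← ENNReal.ofReal_pow (Real.exp_pos _).le, ← Real.exp_nat_mul]
  congr 2
  ring

lemma tsum_cp_ge_le (hd : 3 ≤ d) (hcap : capa B ≠ 0) (ha0 : 0 ≤ a) (ha1 : a < 1)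
    (hK : ∀ x ∈ B, ∑ z ∈ B, green (x - z) ≤ K) (hK0 : 0 ≤ K) (m : ℕ) (n : ℝ) :
    ∑' l, cp (wt (iB B) (qB B) (eB B)) m l * (if n ≤ l.length then 1 else 0)
      ≤ ENNReal.ofReal (Real.exp (a * (m * (B.card / capa B) - n / (1 + a * K)))) := by
  have hp : 0 < 1 + a * K - a := by nlinarith
  have hp1 : 0 < 1 + a * K := by nlinarith
  set s := (1 + a * K) / (1 + a * K - a) with hs
  have hs0 : 0 < s := div_pos hp1 hp
  have hG0 : ∀ x, 0 ≤ ∑ z ∈ B, green (x - z) := fun x => Finset.sum_nonneg fun z _ => green_nonneg _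
  have h1 := tsum_cp_pow_le hd hcap (s := s) (a := a) hs0.le
    (fun x _ => add_nonneg zero_le_one (mul_nonneg ha0 (hG0 x))) (fun x hx => ?_) m
  · have hse : Real.exp (a / (1 + a * K)) ≤ s := by
      have h2 := Real.add_one_le_exp (-(a / (1 + a * K)))
      rw [Real.exp_neg] at h2
      have h3 : s⁻¹ = -(a / (1 + a * K)) + 1 := by
        rw [hs, inv_div]; field_simp; ring
      rw [← h3] at h2
      exact (inv_le_inv₀ hs0 (Real.exp_pos _)).1 h2
    calc _ ≤ ∑' l, ENNReal.ofReal (Real.exp (-(n * (a / (1 + a * K)))))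
            * (cp (wt (iB B) (qB B) (eB B)) m l * ENNReal.ofReal (s ^ l.length)) := by
          refine ENNReal.tsum_le_tsum fun l => ?_
          rw [mul_left_comm]
          gcongr
          split_ifs with hn
          · rw [← ENNReal.ofReal_mul (Real.exp_pos _).le, ENNReal.one_le_ofReal]
            calc (1 : ℝ) ≤ Real.exp (-(n * (a / (1 + a * K)))) * Real.exp (a / (1 + a * K)) ^ l.length := by
                  rw [← Real.exp_nat_mul, ← Real.exp_add, Real.one_le_exp_iff]
                  have : 0 ≤ a / (1 + a * K) := by positivity
                  nlinarith
              _ ≤ _ := by gcongr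
          · simp
      _ ≤ _ := by
          rw [ENNReal.tsum_mul_left]
          refine (mul_le_mul_right h1 _).trans_eq ?_
          rw [← ENNReal.ofReal_mul (Real.exp_pos _).le, ← Real.exp_add]
          congr 2
          ring
  · rw [hs, div_mul_eq_mul_div, div_le_iff₀ hp]
    have := mul_le_mul_of_nonneg_left (hK x hx) (mul_nonneg ha0 ha0)
    nlinarith

lemma tsum_cp_le_le (hd : 3 ≤ d) (hcap : capa B ≠ 0) (ha0 : 0 ≤ a) (haK : a * K < 1)
    (hK : ∀ x ∈ B, ∑ z ∈ B, green (x - z) ≤ K) (m : ℕ) (n : ℝ) :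
    ∑' l, cp (wt (iB B) (qB B) (eB B)) m l * (if l.length ≤ n then 1 else 0)
      ≤ ENNReal.ofReal (Real.exp (a * (n / (1 - a * K) - m * (B.card / capa B)))) := by
  have hp1 : 0 < 1 - a * K := by linarith
  have hp : 0 < 1 - a * K + a := by linarith
  set s := (1 - a * K) / (1 - a * K + a) with hs
  have hs0 : 0 < s := div_pos hp1 hp
  have h1 := tsum_cp_pow_le hd hcap (s := s) (a := -a) hs0.le
    (fun x hx => ?_) (fun x hx => ?_) m
  · have hse : s⁻¹ ≤ Real.exp (a / (1 - a * K)) := by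
      refine le_trans (le_of_eq ?_) (Real.add_one_le_exp _)
      rw [hs, inv_div]; field_simp; ring
    calc _ ≤ ∑' l, ENNReal.ofReal (Real.exp (n * (a / (1 - a * K))))
            * (cp (wt (iB B) (qB B) (eB B)) m l * ENNReal.ofReal (s ^ l.length)) := by
          refine ENNReal.tsum_le_tsum fun l => ?_
          rw [mul_left_comm]
          gcongr
          split_ifs with hn
          · rw [← ENNReal.ofReal_mul (Real.exp_pos _).le, ENNReal.one_le_ofReal]
            have h5 : s⁻¹ ^ l.length ≤ Real.exp (n * (a / (1 - a * K))) := by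
              refine (pow_le_pow_left₀ (inv_nonneg.2 hs0.le) hse _).trans ?_
              rw [← Real.exp_nat_mul]
              exact Real.exp_le_exp.2 (mul_le_mul_of_nonneg_right hn (by positivity))
            calc (1 : ℝ) = s⁻¹ ^ l.length * s ^ l.length := by
                  rw [← mul_pow, inv_mul_cancel₀ hs0.ne', one_pow]
              _ ≤ _ := by gcongr
          · simp
      _ ≤ _ := by
          rw [ENNReal.tsum_mul_left]
          refine (mul_le_mul_right h1 _).trans_eq ?_
          rw [← ENNReal.ofReal_mul (Real.exp_pos _).le, ← Real.exp_add]
          congr 2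
          ring
  · nlinarith [hK x hx]
  · rw [hs, div_mul_eq_mul_div, div_le_iff₀ hp]
    have := mul_le_mul_of_nonneg_left (hK x hx) (mul_nonneg ha0 ha0)
    nlinarith

end TrajectoryWeights

/-! ### Supermartingale bounds for the simple random walk -/

section Walk

variable {d : ℕ} {R : Type*} [CommRing R]

lemma dir_apply (p : Fin d × Bool) (j : Fin d) :
    (dir p : Fin d → R) j = if j = p.1 then (if p.2 then 1 else -1) else 0 := by
  unfold dir
  rw [Pi.single_apply]

lemma dir_injective (h2 : (2 : R) ≠ 0) : Function.Injective (dir : Fin d × Bool → Fin d → R) := by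
  have h1 : (1 : R) ≠ 0 := fun h => h2 (by rw [← one_add_one_eq_two, h, add_zero])
  have hm : (1 : R) ≠ -1 := fun h => h2 (by
    rw [← one_add_one_eq_two]; nth_rw 1 [h]; exact neg_add_cancel 1)
  rintro ⟨i, s⟩ ⟨j, t⟩ h
  have hi := congrFun h i
  simp only [dir_apply, if_true] at hi
  have hij : i = j := by
    by_contra hne
    rw [if_neg hne] at hi
    cases s <;> simp [h1] at hi
  subst hij
  cases s <;> cases t <;> simp [hm, hm.symm] at hi ⊢

lemma adj_iff_dir (h1 : (1 : R) ≠ 0) (x y : Fin d → R) : adj x y ↔ ∃ p, y = x + dir p := by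
  constructor
  · rintro ⟨-, i, hi, hj⟩
    have key : ∀ s : Bool, y i = x i + (if s then 1 else -1) → y = x + dir (i, s) := by
      intro s hs
      funext j
      rw [Pi.add_apply, dir_apply]
      by_cases h : j = i
      · subst h; simpa using hs
      · simp [h, hj j h]
    rcases hi with hi | hi
    · exact ⟨(i, true), key true (by simpa using hi)⟩
    · exact ⟨(i, false), key false (by simp [hi])⟩
  · rintro ⟨⟨i, s⟩, rfl⟩
    refine ⟨fun h => ?_, i, ?_, fun j hj => ?_⟩
    · have := congrFun h i
      rw [Pi.add_apply, dir_apply] at this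
      cases s <;> simp [h1] at this
    · rw [Pi.add_apply, dir_apply]
      cases s <;> simp
    · rw [Pi.add_apply, dir_apply]
      simp [hj]

lemma tsum_srwStep_mul (h2 : (2 : R) ≠ 0) (x : Fin d → R) (g : (Fin d → R) → ℝ≥0∞) :
    ∑' y, srwStep x y * g y = ∑ p : Fin d × Bool, ((2 * d : ℕ) : ℝ≥0∞)⁻¹ * g (x + dir p) := by
  have h1 : (1 : R) ≠ 0 := fun h => h2 (by rw [← one_add_one_eq_two, h, add_zero])
  have hinj : Function.Injective fun p : Fin d × Bool => x + (dir p : Fin d → R) :=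
    fun p q h => dir_injective h2 (add_left_cancel h)
  rw [← hinj.tsum_eq, tsum_fintype]
  · refine Finset.sum_congr rfl fun p _ => ?_
    simp only [srwStep]
    rw [if_pos ((adj_iff_dir h1 _ _).2 ⟨p, rfl⟩)]
  · intro y hy
    by_contra hne
    refine hy ?_
    simp only [srwStep]
    rw [if_neg, zero_mul]
    rintro h
    obtain ⟨p, rfl⟩ := (adj_iff_dir h1 _ _).1 h
    exact hne ⟨p, rfl⟩

lemma tsum_srwStep_ofReal (h2 : (2 : R) ≠ 0) (hd : 0 < d) (x : Fin d → R) {f : (Fin d → R) → ℝ}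
    (hf : ∀ p, 0 ≤ f (x + dir p)) :
    ∑' y, srwStep x y * ENNReal.ofReal (f y) = ENNReal.ofReal (avg f x) := by
  rw [tsum_srwStep_mul h2, avg, ENNReal.ofReal_mul (by positivity),
    ENNReal.ofReal_sum_of_nonneg fun p _ => hf p, Finset.mul_sum,
    ENNReal.ofReal_inv_of_pos (by positivity)]
  congr! 3
  rw [show (2 * d : ℝ) = ((2 * d : ℕ) : ℝ) by push_cast; ring, ENNReal.ofReal_natCast]

/-- The trajectory up to time `t`, most recent site first. -/
def hist {α : Type*} : ℕ → (ℕ → α) → List α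
  | 0, ω => [ω 0]
  | t + 1, ω => ω (t + 1) :: hist t ω

lemma length_hist {α : Type*} (t : ℕ) (ω : ℕ → α) : (hist t ω).length = t + 1 := by
  induction t with
  | zero => rfl
  | succ t ih => simp [hist, ih]

lemma hist_eq_iff {α : Type*} (t : ℕ) (ω ω' : ℕ → α) :
    hist t ω = hist t ω' ↔ ∀ k, k ≤ t → ω k = ω' k := by
  induction t with
  | zero => simp [hist]
  | succ t ih =>
    simp only [hist, List.cons.injEq, ih]
    constructor
    · rintro ⟨h1, h2⟩ k hk
      rcases Nat.le_succ_iff.1 hk with h | h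
      · exact h2 k h
      · exact h ▸ h1
    · intro h
      exact ⟨h _ le_rfl, fun k hk => h k (by omega)⟩

/-- The probability weight of a trajectory, most recent site first. -/
def pathW {d : ℕ} {R : Type*} [CommRing R] (init : (Fin d → R) → ℝ≥0∞) :
    List (Fin d → R) → ℝ≥0∞
  | [] => 0
  | [x] => init x
  | y :: x :: l => srwStep x y * pathW init (x :: l)

lemma hist_cons {α : Type*} (t : ℕ) (ω : ℕ → α) : ∃ l, hist t ω = ω t :: l := by
  cases t with
  | zero => exact ⟨[], rfl⟩
  | succ t => exact ⟨_, rfl⟩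

lemma pathW_hist (init : (Fin d → R) → ℝ≥0∞) (t : ℕ) (w : ℕ → Fin d → R) :
    pathW init (hist t w)
      = init (w 0) * ∏ k ∈ Finset.range t, srwStep (w k) (w (k + 1)) := by
  induction t with
  | zero => simp [hist, pathW]
  | succ t ih =>
    obtain ⟨l, hl⟩ := hist_cons t w
    rw [Finset.prod_range_succ, hist]
    rw [hl] at ih ⊢
    rw [pathW, ih]
    ring

variable [MeasurableSpace R] {μ : Measure (ℕ → Fin d → R)} {init : (Fin d → R) → ℝ≥0∞}

lemma measure_hist_le (hμ : IsWalkLaw μ init) (t : ℕ) (l : List (Fin d → R)) :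
    μ {ω | hist t ω = l} ≤ if l.length = t + 1 then pathW init l else 0 := by
  by_cases h : ∃ w, hist t w = l
  · obtain ⟨w, rfl⟩ := h
    simp only [length_hist, if_true, hist_eq_iff]
    rw [hμ.2, pathW_hist]
  · have : {ω | hist t ω = l} = ∅ := by
      ext ω
      simp only [Set.mem_ofPred_eq, Set.mem_empty_iff_false, iff_false]
      exact fun h' => h ⟨ω, h'⟩
    rw [this, measure_empty]
    exact zero_le

lemma measure_one_le_hist (hμ : IsWalkLaw μ init) [Countable R] {Ψ : List (Fin d → R) → ℝ≥0∞}
    {κ : ℝ≥0∞}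
    (H : ∀ x l, ∑' y, srwStep x y * Ψ (y :: x :: l) ≤ κ * Ψ (x :: l)) (t : ℕ) :
    μ {ω | 1 ≤ Ψ (hist t ω)} ≤ κ ^ t * ∑' x, init x * Ψ [x] := by
  have h1 : ∀ t, (∑' l : List (Fin d → R), (if l.length = t + 1 then pathW init l else 0) * Ψ l)
      ≤ κ ^ t * ∑' x, init x * Ψ [x] := by
    intro t
    induction t with
    | zero =>
      rw [tsum_list]
      simp only [List.length_nil, List.length_cons, pow_zero, one_mul]
      rw [if_neg (by omega), zero_mul, zero_add]
      refine ENNReal.tsum_le_tsum fun x => ?_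
      rw [tsum_list]
      simp [pathW]
    | succ t ih =>
      rw [tsum_list, ENNReal.tsum_comm]
      simp only [List.length_nil, List.length_cons]
      rw [if_neg (by omega), zero_mul, zero_add, pow_succ', mul_assoc]
      refine le_trans ?_ (mul_le_mul_right ih κ)
      rw [← ENNReal.tsum_mul_left]
      refine ENNReal.tsum_le_tsum fun l => ?_
      cases l with
      | nil => simp
      | cons x l =>
        by_cases hl : (x :: l).length = t + 1
        · simp only [hl, if_true, pathW]
          calc _ = ∑' y, pathW init (x :: l) * (srwStep x y * Ψ (y :: x :: l)) :=
                tsum_congr fun y => by ring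
            _ ≤ pathW init (x :: l) * (κ * Ψ (x :: l)) := by
                rw [ENNReal.tsum_mul_left]
                exact mul_le_mul_right (H x l) _
            _ = _ := by ring
        · have : ¬ (x :: l).length + 1 = t + 1 + 1 := by omega
          simp only [if_neg hl, if_neg this]
          simp
  refine le_trans ?_ (h1 t)
  calc μ {ω | 1 ≤ Ψ (hist t ω)}
      ≤ μ (⋃ l, {ω | hist t ω = l ∧ 1 ≤ Ψ l}) := by
        refine measure_mono fun ω hω => ?_
        simp only [Set.mem_iUnion, Set.mem_ofPred_eq] at hω ⊢
        exact ⟨_, rfl, hω⟩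
    _ ≤ ∑' l, μ {ω | hist t ω = l ∧ 1 ≤ Ψ l} := measure_iUnion_le _
    _ ≤ _ := by
        refine ENNReal.tsum_le_tsum fun l => ?_
        by_cases h : 1 ≤ Ψ l
        · simp only [h, and_true]
          exact (measure_hist_le hμ t l).trans (le_mul_of_one_le_right zero_le h)
        · simp [h]

/-- The state at time `t` of an automaton driven by a trajectory. -/
def autom {α σ : Type*} (s₀ : α → σ) (upd : σ → α → α → σ) (ω : ℕ → α) : ℕ → σ
  | 0 => s₀ (ω 0)
  | t + 1 => upd (autom s₀ upd ω t) (ω t) (ω (t + 1))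

/-- The state of an automaton after a trajectory ending at a given site. -/
def automL {α σ : Type*} (s₀ : α → σ) (upd : σ → α → α → σ) : α → List α → σ
  | x, [] => s₀ x
  | y, x :: l => upd (automL s₀ upd x l) x y

lemma measure_one_le_autom (hμ : IsWalkLaw μ init) [Countable R] {σ : Type*}
    (s₀ : (Fin d → R) → σ) (upd : σ → (Fin d → R) → (Fin d → R) → σ)
    {Φ : σ → (Fin d → R) → ℝ≥0∞} {κ : ℝ≥0∞}
    (H : ∀ s x, ∑' y, srwStep x y * Φ (upd s x y) y ≤ κ * Φ s x) (t : ℕ) :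
    μ {ω | 1 ≤ Φ (autom s₀ upd ω t) (ω t)} ≤ κ ^ t * ∑' x, init x * Φ (s₀ x) x := by
  set Ψ : List (Fin d → R) → ℝ≥0∞ := fun l => match l with
    | [] => 0
    | x :: l => Φ (automL s₀ upd x l) x with hΨ
  have h1 : ∀ ω, Ψ (hist t ω) = Φ (autom s₀ upd ω t) (ω t) := by
    intro ω
    have h2 : ∀ t, ∃ l, hist t ω = ω t :: l ∧ automL s₀ upd (ω t) l = autom s₀ upd ω t := by
      intro t
      induction t with
      | zero => exact ⟨[], rfl, rfl⟩
      | succ t ih =>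
        obtain ⟨l, hl, hl'⟩ := ih
        refine ⟨_, rfl, ?_⟩
        rw [hl, automL, hl', autom]
    obtain ⟨l, hl, hl'⟩ := h2 t
    rw [hl, ← hl']
  simp_rw [← h1]
  exact measure_one_le_hist hμ (fun x l => H (automL s₀ upd x l) x) t

end Walk

/-! ### The simple random walk on the lattice and the capacity -/

section WalkLaw

variable {d : ℕ}

/-- The trajectory started at `x` with given steps. -/
def walkOf {d : ℕ} (x : Lat d) (s : ℕ → Fin d × Bool) (k : ℕ) : Lat d :=
  x + ∑ j ∈ Finset.range k, dir (s j)

lemma measurable_walkOf (x : Lat d) : Measurable (walkOf x) := by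
  refine measurable_pi_lambda _ fun k => ?_
  unfold walkOf
  refine measurable_const.add (Finset.measurable_sum _ fun j _ => ?_)
  exact (measurable_of_countable (dir : Fin d × Bool → Lat d)).comp (measurable_pi_apply j)

/-- The law of the simple random walk on the lattice started at `x`. -/
def walkLaw {d : ℕ} (x : Lat d) : Measure (ℕ → Lat d) :=
  (Measure.infinitePi fun _ : ℕ => ProbabilityTheory.uniformOn
    (Set.univ : Set (Fin d × Bool))).map (walkOf x)

lemma uniformOn_univ_apply (s : Set (Fin d × Bool)) :
    ProbabilityTheory.uniformOn (Set.univ : Set (Fin d × Bool)) s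
      = Measure.count s * ((2 * d : ℕ) : ℝ≥0∞)⁻¹ := by
  rw [ProbabilityTheory.uniformOn_univ, Fintype.card_prod, Fintype.card_fin, Fintype.card_bool,
    mul_comm d, div_eq_mul_inv]

lemma isProb_uniformOn (hd : 0 < d) :
    IsProbabilityMeasure (ProbabilityTheory.uniformOn (Set.univ : Set (Fin d × Bool))) := by
  have : Nonempty (Fin d × Bool) := ⟨(⟨0, hd⟩, true)⟩
  exact ProbabilityTheory.isProbabilityMeasure_uniformOn Set.finite_univ Set.univ_nonempty

lemma srwStep_eq_uniformOn (x y : Lat d) :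
    srwStep x y = ProbabilityTheory.uniformOn (Set.univ : Set (Fin d × Bool))
      {p | x + dir p = y} := by
  rw [uniformOn_univ_apply, srwStep]
  by_cases h : adj x y
  · obtain ⟨p, rfl⟩ := (adj_iff_dir one_ne_zero x y).1 h
    rw [if_pos h]
    have : {q : Fin d × Bool | x + (dir q : Lat d) = x + dir p} = {p} := by
      ext q
      simp only [add_right_inj, Set.mem_ofPred_eq, Set.mem_singleton_iff]
      exact (dir_injective two_ne_zero).eq_iff
    rw [this, Measure.count_singleton, one_mul]
  · rw [if_neg h]
    have : {q : Fin d × Bool | x + (dir q : Lat d) = y} = ∅ := by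
      ext q
      simp only [Set.mem_ofPred_eq, Set.mem_empty_iff_false, iff_false]
      rintro rfl
      exact h ((adj_iff_dir one_ne_zero _ _).2 ⟨q, rfl⟩)
    rw [this, measure_empty, zero_mul]

lemma isWalkLaw_walkLaw (hd : 0 < d) (x : Lat d) : IsWalkLaw (walkLaw x) (pointInit x) := by
  have := isProb_uniformOn hd
  refine ⟨Measure.isProbabilityMeasure_map (measurable_walkOf x).aemeasurable, fun n w => ?_⟩
  have hm : MeasurableSet {ω : ℕ → Lat d | ∀ k, k ≤ n → ω k = w k} := by
    have : {ω : ℕ → Lat d | ∀ k, k ≤ n → ω k = w k}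
        = ⋂ k ∈ Finset.range (n + 1), (fun ω => ω k) ⁻¹' {w k} := by
      ext ω
      simp
    rw [this]
    exact Finset.measurableSet_biInter _ fun k _ =>
      (measurable_pi_apply k) (MeasurableSet.singleton _)
  rw [walkLaw, Measure.map_apply (measurable_walkOf x) hm, pointInit]
  by_cases h : w 0 = x
  · have h1 : walkOf x ⁻¹' {ω : ℕ → Lat d | ∀ k, k ≤ n → ω k = w k}
        = Set.pi (Finset.range n) fun k => {p | w k + dir p = w (k + 1)} := by
      ext s
      simp only [Set.mem_preimage, Set.mem_ofPred_eq, Set.mem_pi, Finset.coe_range, Set.mem_Iio]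
      constructor
      · intro H k hk
        rw [← H k hk.le, ← H (k + 1) hk, walkOf, walkOf, Finset.sum_range_succ, add_assoc]
      · intro H k hk
        induction k with
        | zero => simp [walkOf, h]
        | succ k ih =>
          rw [← H k hk, ← ih (by omega), walkOf, walkOf, Finset.sum_range_succ, add_assoc]
    rw [h1, Measure.infinitePi_pi _ fun k _ => MeasurableSet.of_discrete, if_pos h, one_mul]
    exact Finset.prod_congr rfl fun k _ => (srwStep_eq_uniformOn _ _).symm
  · have h1 : walkOf x ⁻¹' {ω : ℕ → Lat d | ∀ k, k ≤ n → ω k = w k} = ∅ := by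
      ext s
      simp only [Set.mem_preimage, Set.mem_ofPred_eq, Set.mem_empty_iff_false, iff_false]
      intro H
      exact h (by rw [← H 0 (by omega)]; simp [walkOf])
    rw [h1, measure_empty, if_neg h, zero_mul]

lemma tsum_pointInit_mul {α : Type*} (x : α) (f : α → ℝ≥0∞) :
    ∑' y, pointInit x y * f y = f x := by
  rw [tsum_eq_single x]
  · simp [pointInit]
  · intro y hy
    simp [pointInit, hy]

lemma walkLaw_esc_compl_le (hd : 0 < d) (V : Finset (Lat d)) (x : Lat d) {μ : Measure (ℕ → Lat d)}
    (hμ : IsWalkLaw μ (pointInit x)) :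
    μ (escEvent (V : Set (Lat d)))ᶜ ≤ ENNReal.ofReal (avg (hit V fun _ => 1) x) := by
  have h0 : ∀ z : Lat d, 0 ≤ hit V (fun _ => 1) z := hit_nonneg (fun _ => zero_le_one)
  set upd : Prop → Lat d → Lat d → Prop := fun s _ y => s ∨ y ∈ V
  have hst : ∀ (ω : ℕ → Lat d) t, autom (fun _ => False) upd ω t ↔ ∃ k, 1 ≤ k ∧ k ≤ t ∧ ω k ∈ V := by
    intro ω t
    induction t with
    | zero => simp only [autom, false_iff]; rintro ⟨k, h1, h2, -⟩; omega
    | succ t ih =>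
      simp only [autom, upd, ih]
      constructor
      · rintro (⟨k, h1, h2, h3⟩ | h)
        · exact ⟨k, h1, by omega, h3⟩
        · exact ⟨t + 1, by omega, le_rfl, h⟩
      · rintro ⟨k, h1, h2, h3⟩
        rcases Nat.le_succ_iff.1 h2 with h | h
        · exact Or.inl ⟨k, h1, h, h3⟩
        · rw [h] at h3
          exact Or.inr h3
  have h1 : ∀ t, μ {ω | ∃ k, 1 ≤ k ∧ k ≤ t ∧ ω k ∈ V}
      ≤ ENNReal.ofReal (avg (hit V fun _ => 1) x) := by
    intro t
    have := measure_one_le_autom hμ (fun _ => False) upd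
      (Φ := fun s z => if s then 1 else ENNReal.ofReal (avg (hit V fun _ => 1) z)) (κ := 1) ?_ t
    · simp only [if_false, one_pow, one_mul, tsum_pointInit_mul] at this
      refine le_trans (measure_mono fun ω hω => ?_) this
      simp only [Set.mem_ofPred_eq] at hω ⊢
      rw [if_pos ((hst ω t).2 hω)]
    · intro s z
      rw [one_mul]
      by_cases hs : s
      · simp only [upd, hs, true_or, if_true]
        rw [← ENNReal.ofReal_one, tsum_srwStep_ofReal two_ne_zero hd z fun _ => zero_le_one,
          avg_const hd]
      · simp only [upd, hs, false_or, if_false]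
        rw [← tsum_srwStep_ofReal two_ne_zero hd z fun _ => h0 _]
        refine (tsum_congr fun y => ?_).le
        congr 1
        split_ifs with hy
        · rw [hit_on hy, ENNReal.ofReal_one]
        · rw [hit_off hd (fun _ => zero_le_one) (fun _ => le_rfl) hy]
  have h2 : (escEvent (V : Set (Lat d)))ᶜ = ⋃ t, {ω | ∃ k, 1 ≤ k ∧ k ≤ t ∧ ω k ∈ V} := by
    ext ω
    simp only [escEvent, Set.mem_compl_iff, Set.mem_ofPred_eq, Set.mem_iUnion, Finset.mem_coe]
    push Not
    exact ⟨fun ⟨n, h, h'⟩ => ⟨n, n, h, le_rfl, h'⟩, fun ⟨t, n, h, _, h'⟩ => ⟨n, h, h'⟩⟩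
  rw [h2, Monotone.measure_iUnion]
  · exact iSup_le h1
  · rintro s t hst ω ⟨k, h, h', h''⟩
    exact ⟨k, h, h'.trans hst, h''⟩

lemma walkLaw_esc_le (hd : 0 < d) (V : Finset (Lat d)) (x : Lat d) {μ : Measure (ℕ → Lat d)}
    (hμ : IsWalkLaw μ (pointInit x)) :
    μ (escEvent (V : Set (Lat d))) ≤ ENNReal.ofReal (1 - avg (hit V fun _ => 1) x) := by
  have hle : ∀ n (z : Lat d), hitIter V (fun _ => 1) n z ≤ 1 := fun n z =>
    hitIter_le_of_super (g := fun _ => 1) (fun _ => zero_le_one) (fun _ _ => le_rfl)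
      (fun z _ => (avg_const hd 1 z).le) n z
  set F : ℕ → Lat d → ℝ := fun r => match r with
    | 0 => fun _ => 1
    | r + 1 => fun z => 1 - avg (hitIter V (fun _ => 1) r) z with hF
  have hF0 : ∀ r z, 0 ≤ F r z := by
    intro r z
    cases r with
    | zero => exact zero_le_one
    | succ r => exact sub_nonneg.2 (avg_le_const hd (hle r))
  have hF1 : ∀ r z, avg (fun y => if y ∈ V then 0 else F r y) z = F (r + 1) z := by
    intro r z
    simp only [hF]
    have h1 : (fun y => if y ∈ V then 0 else F r y)
        = fun y => 1 - hitIter V (fun _ => 1) r y := by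
      funext y
      cases r <;> by_cases hy : y ∈ V <;> simp [hF, hitIter, hy]
    simp only [hF] at h1
    rw [h1, avg_sub, avg_const hd]
  set upd : ℕ × Prop → Lat d → Lat d → ℕ × Prop := fun s _ y => (s.1 + 1, s.2 ∧ y ∉ V)
  have hst : ∀ (ω : ℕ → Lat d) t, (autom (fun _ => (0, True)) upd ω t).1 = t ∧
      (ω ∈ escEvent (V : Set (Lat d)) → (autom (fun _ => (0, True)) upd ω t).2) := by
    intro ω t
    induction t with
    | zero => simp [autom]
    | succ t ih =>
      refine ⟨by simp [autom, upd, ih.1], fun h => ?_⟩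
      simp only [autom, upd]
      exact ⟨ih.2 h, by simpa using h (t + 1) (by omega)⟩
  have h1 : ∀ n, μ (escEvent (V : Set (Lat d))) ≤ ENNReal.ofReal (F n x) := by
    intro n
    have := measure_one_le_autom hμ (fun _ => (0, True)) upd
      (Φ := fun s z => if s.2 then ENNReal.ofReal (F (n - s.1) z) else 0) (κ := 1) ?_ n
    · simp only [if_true, one_pow, one_mul, tsum_pointInit_mul, Nat.sub_zero] at this
      refine le_trans (measure_mono fun ω hω => ?_) this
      simp only [Set.mem_ofPred_eq]
      rw [if_pos ((hst ω n).2 hω), (hst ω n).1, Nat.sub_self]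
      simp [hF]
    · rintro ⟨k, s⟩ z
      rw [one_mul]
      by_cases hs : s
      · simp only [upd, hs, true_and, if_true]
        have h3 : ∀ y, (if y ∉ V then ENNReal.ofReal (F (n - (k + 1)) y) else 0)
            = ENNReal.ofReal (if y ∈ V then 0 else F (n - (k + 1)) y) := by
          intro y
          by_cases hy : y ∈ V <;> simp [hy]
        simp_rw [h3]
        rw [tsum_srwStep_ofReal two_ne_zero hd z fun p => by
          split_ifs
          · exact le_rfl
          · exact hF0 _ _]
        refine ENNReal.ofReal_le_ofReal ?_
        rw [hF1]
        rcases Nat.lt_or_ge k n with h | h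
        · rw [show n - (k + 1) + 1 = n - k by omega]
        · rw [show n - (k + 1) = 0 by omega, show n - k = 0 by omega]
          simp only [hF]
          have := avg_nonneg (x := z) (f := hitIter V (fun _ => 1) 0)
            fun p => hitIter_nonneg (fun _ => zero_le_one) _ _
          linarith
      · simp [upd, hs]
  have h2 : Tendsto (fun n => F (n + 1) x) atTop (nhds (1 - avg (hit V fun _ => 1) x)) :=
    tendsto_const_nhds.sub (avg_tendsto (fun z =>
      hit_tendsto hd (fun _ => zero_le_one) (fun _ => le_rfl) z) x)
  exact ge_of_tendsto ((ENNReal.continuous_ofReal.tendsto _).comp h2)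
    (Eventually.of_forall fun n => h1 (n + 1))

lemma walkLaw_esc (hd : 3 ≤ d) (V : Finset (Lat d)) (x : Lat d) :
    (walkLaw x (escEvent (V : Set (Lat d)))).toReal = esc V x := by
  have hd0 : 0 < d := by omega
  have hμ := isWalkLaw_walkLaw hd0 x
  have := hμ.1
  have h0 : 0 ≤ avg (hit V fun _ => 1) x := avg_nonneg fun p =>
    hit_nonneg (fun _ => zero_le_one) _
  rw [esc_eq hd, ← ENNReal.toReal_ofReal (r := 1 - avg (hit V fun _ => 1) x)]
  · congr 1
    refine le_antisymm (walkLaw_esc_le hd0 V x hμ) ?_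
    rw [ENNReal.ofReal_sub _ h0, ENNReal.ofReal_one, tsub_le_iff_right]
    calc (1 : ℝ≥0∞) = walkLaw x (escEvent (V : Set (Lat d)) ∪ (escEvent (V : Set (Lat d)))ᶜ) := by
          rw [Set.union_compl_self, measure_univ]
      _ ≤ _ := (measure_union_le _ _).trans (add_le_add le_rfl (walkLaw_esc_compl_le hd0 V x hμ))
  · rw [← esc_eq hd]
    exact esc_nonneg hd V x

lemma isCap_capa (hd : 3 ≤ d) (V : Finset (Lat d)) : IsCap d V (capa V) := by
  have hd0 : 0 < d := by omega
  refine ⟨walkLaw, isWalkLaw_walkLaw hd0, ?_⟩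
  rw [finsum_mem_coe_finset, capa]
  exact Finset.sum_congr rfl fun x _ => (walkLaw_esc hd V x).symm

end WalkLaw

/-! ### The law of random interlacements in a finite set -/

section InterlacementLaw

variable {d : ℕ} {B : Finset (Lat d)}

/-- The set of sites of a list. -/
def occ {d : ℕ} {B : Finset (Lat d)} (l : List B) : Finset (Lat d) := (l.map Subtype.val).toFinset

lemma mem_occ {l : List B} {x : Lat d} : x ∈ occ l ↔ ∃ h : x ∈ B, (⟨x, h⟩ : B) ∈ l := by
  simp [occ]

lemma occ_subset (l : List B) : occ l ⊆ B := fun _ hx => (mem_occ.1 hx).1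

lemma capa_mono (hd : 3 ≤ d) {V : Finset (Lat d)} (hV : V ⊆ B) : capa V ≤ capa B := by
  rw [← sum_esc_hit hd hV, capa]
  exact Finset.sum_le_sum fun x _ =>
    mul_le_of_le_one_right (esc_nonneg hd B x) (hit_one_le (by omega) V x)

lemma prod_map_avoid (T : Finset (Lat d)) (l : List B) :
    (l.map fun x => if x.1 ∈ B \ T then (0 : ℝ≥0∞) else 1).prod
      = if occ l ⊆ T then 1 else 0 := by
  induction l with
  | nil => simp [occ]
  | cons x l ih =>
    rw [List.map_cons, List.prod_cons, ih]
    have h1 : occ (x :: l) = insert x.1 (occ l) := by simp [occ]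
    rw [h1]
    have h2 : (x.1 ∈ B \ T) ↔ x.1 ∉ T := by simp
    simp only [h2, Finset.insert_subset_iff]
    by_cases h3 : x.1 ∈ T <;> simp [h3]

lemma eq_of_sum_powerset_eq {α : Type*} {f g : Finset α → ℝ≥0∞} {B : Finset α}
    (hfin : ∀ T, T ⊆ B → ∑ S ∈ T.powerset, f S ≠ ∞)
    (h : ∀ T, T ⊆ B → ∑ S ∈ T.powerset, f S = ∑ S ∈ T.powerset, g S) (T : Finset α)
    (hT : T ⊆ B) : f T = g T := by
  induction T using Finset.strongInduction with
  | H T ih =>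
    have h1 := h T hT
    have hm := Finset.mem_powerset_self T
    rw [← Finset.add_sum_erase _ _ hm, ← Finset.add_sum_erase _ _ hm] at h1
    have h2 : ∑ S ∈ T.powerset.erase T, f S = ∑ S ∈ T.powerset.erase T, g S := by
      refine Finset.sum_congr rfl fun S hS => ?_
      obtain ⟨h3, h4⟩ := Finset.mem_erase.1 hS
      have h5 := Finset.mem_powerset.1 h4
      exact ih S (Finset.ssubset_iff_subset_ne.2 ⟨h5, h3⟩) (h5.trans hT)
    rw [← h2] at h1
    refine (ENNReal.add_left_inj ?_).1 h1
    refine ne_top_of_le_ne_top (hfin T hT) ?_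
    exact Finset.sum_le_sum_of_subset (Finset.erase_subset _ _)

/-- The Poisson weights. -/
def pois (lam : ℝ) (m : ℕ) : ℝ≥0∞ :=
  ENNReal.ofReal (Real.exp (-lam) * (lam ^ m / m.factorial))

lemma tsum_pois_mul_pow {lam p : ℝ} (hl : 0 ≤ lam) (hp : 0 ≤ p) :
    ∑' m, pois lam m * ENNReal.ofReal p ^ m = ENNReal.ofReal (Real.exp (-(lam * (1 - p)))) := by
  have h1 : ∀ m : ℕ, pois lam m * ENNReal.ofReal p ^ m
      = ENNReal.ofReal (Real.exp (-lam) * ((lam * p) ^ m / m.factorial)) := by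
    intro m
    rw [pois, ← ENNReal.ofReal_pow hp, ← ENNReal.ofReal_mul (by positivity)]
    congr 1
    rw [mul_pow]
    ring
  have h2 : HasSum (fun m : ℕ => Real.exp (-lam) * ((lam * p) ^ m / m.factorial))
      (Real.exp (-lam) * Real.exp (lam * p)) := by
    have := (NormedSpace.expSeries_div_hasSum_exp (lam * p)).mul_left (Real.exp (-lam))
    rwa [← Real.exp_eq_exp_ℝ] at this
  simp_rw [h1]
  rw [← ENNReal.ofReal_tsum_of_nonneg (fun m => by positivity) h2.summable, h2.tsum_eq,
    ← Real.exp_add]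
  congr 2
  ring

variable {Ω : Type*} [MeasurableSpace Ω] {P : Measure Ω} {I : Ω → Set (Lat d)} {v : ℝ}

lemma measurableSet_trace (hI : IsInterlacement d v P I) (B S : Finset (Lat d)) :
    MeasurableSet {ω | ∀ x ∈ B, (x ∈ I ω ↔ x ∈ S)} := by
  have : {ω | ∀ x ∈ B, (x ∈ I ω ↔ x ∈ S)} = ⋂ x ∈ B, {ω | (x ∈ I ω ↔ x ∈ S)} := by
    ext ω
    simp
  rw [this]
  refine Finset.measurableSet_biInter _ fun x _ => ?_
  by_cases hx : x ∈ S
  · simpa [hx] using hI.2.1 x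
  · simp only [hx, iff_false]
    exact (hI.2.1 x).compl

lemma sum_measure_trace (hI : IsInterlacement d v P I) (B : Finset (Lat d))
    {𝒮 : Finset (Finset (Lat d))} (h𝒮 : 𝒮 ⊆ B.powerset) :
    ∑ S ∈ 𝒮, P {ω | ∀ x ∈ B, (x ∈ I ω ↔ x ∈ S)}
      = P {ω | ∃ S ∈ 𝒮, ∀ x ∈ B, (x ∈ I ω ↔ x ∈ S)} := by
  rw [← measure_biUnion_finset]
  · congr 1
    ext ω
    simp
  · intro S hS S' hS' hne
    refine Set.disjoint_left.2 fun ω h1 h2 => hne ?_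
    ext x
    by_cases hx : x ∈ B
    · exact (h1 x hx).symm.trans (h2 x hx)
    · exact iff_of_false (fun h => hx (Finset.mem_powerset.1 (h𝒮 hS) h))
        (fun h => hx (Finset.mem_powerset.1 (h𝒮 hS') h))
  · exact fun S _ => measurableSet_trace hI B S

lemma measure_trace_eq (hd : 3 ≤ d) (hcap : 0 < capa B) (hv : 0 ≤ v)
    (hI : IsInterlacement d v P I) {S : Finset (Lat d)} (hS : S ⊆ B) :
    P {ω | ∀ x ∈ B, (x ∈ I ω ↔ x ∈ S)}
      = ∑' m, pois (v * capa B) m *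
          ∑' l, cp (wt (iB B) (qB B) (eB B)) m l * (if occ l = S then 1 else 0) := by
  have hP := hI.1
  refine eq_of_sum_powerset_eq (B := B)
    (f := fun S => P {ω | ∀ x ∈ B, (x ∈ I ω ↔ x ∈ S)})
    (g := fun S => ∑' m, pois (v * capa B) m *
      ∑' l, cp (wt (iB B) (qB B) (eB B)) m l * (if occ l = S then 1 else 0))
    (fun T hT => ?_) (fun T hT => ?_) S hS
  · rw [sum_measure_trace hI B (Finset.powerset_mono.2 hT)]
    exact measure_ne_top _ _
  · rw [sum_measure_trace hI B (Finset.powerset_mono.2 hT)]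
    have h1 : {ω | ∃ S ∈ T.powerset, ∀ x ∈ B, (x ∈ I ω ↔ x ∈ S)}
        = {ω | ∀ x ∈ ((B \ T : Finset (Lat d)) : Set (Lat d)), x ∉ I ω} := by
      ext ω
      simp only [Finset.mem_powerset, Set.mem_ofPred_eq, Finset.mem_coe, Finset.mem_sdiff]
      constructor
      · rintro ⟨S, hS, h⟩ x ⟨hx, hxT⟩ hxI
        exact hxT (hS ((h x hx).1 hxI))
      · intro h
        refine ⟨B.filter fun x => x ∈ I ω, fun x hx => ?_, fun x hx => ?_⟩
        · obtain ⟨h2, h3⟩ := Finset.mem_filter.1 hx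
          by_contra h4
          exact h x ⟨h2, h4⟩ h3
        · simp [hx]
    rw [h1, hI.2.2 _ (Finset.finite_toSet _) _ (isCap_capa hd _)]
    rw [← Summable.tsum_finsetSum fun _ _ => ENNReal.summable]
    simp_rw [← Finset.mul_sum]
    have h2 : ∀ m, (∑ S ∈ T.powerset, ∑' l, cp (wt (iB B) (qB B) (eB B)) m l *
        (if occ l = S then 1 else 0)) = ENNReal.ofReal (1 - capa (B \ T) / capa B) ^ m := by
      intro m
      rw [← tsum_wt_avoid hd Finset.sdiff_subset hcap.ne', ← tsum_cp_mul,
        ← Summable.tsum_finsetSum fun _ _ => ENNReal.summable]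
      refine tsum_congr fun l => ?_
      rw [prod_map_avoid, ← Finset.mul_sum, Finset.sum_ite_eq]
      simp only [Finset.mem_powerset]
    simp_rw [h2]
    rw [tsum_pois_mul_pow (mul_nonneg hv hcap.le)]
    · congr 2
      field_simp
      ring
    · rw [sub_nonneg, div_le_one hcap]
      exact capa_mono hd Finset.sdiff_subset

lemma tsum_cp_le_measure (hd : 3 ≤ d) (hcap : 0 < capa B) (hv : 0 ≤ v)
    (hI : IsInterlacement d v P I) {bad : Set (Lat d) → Prop}
    (hbad : ∀ A A' : Set (Lat d), (∀ x ∈ B, (x ∈ A ↔ x ∈ A')) → bad A → bad A') (m : ℕ) :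
    pois (v * capa B) m *
      ∑' l, cp (wt (iB B) (qB B) (eB B)) m l * (if bad (occ l) then 1 else 0)
      ≤ P {ω | bad (I ω)} := by
  set 𝒮 : Finset (Finset (Lat d)) := B.powerset.filter fun S : Finset (Lat d) => bad S with h𝒮
  have h1 : ∀ l : List B, (if bad (occ l) then (1 : ℝ≥0∞) else 0)
      = ∑ S ∈ 𝒮, if occ l = S then 1 else 0 := by
    intro l
    rw [Finset.sum_ite_eq]
    simp [h𝒮, occ_subset l]
  simp_rw [h1, Finset.mul_sum]
  rw [Summable.tsum_finsetSum fun _ _ => ENNReal.summable, Finset.mul_sum]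
  calc _ ≤ ∑ S ∈ 𝒮, P {ω | ∀ x ∈ B, (x ∈ I ω ↔ x ∈ S)} := by
        refine Finset.sum_le_sum fun S hS => ?_
        rw [measure_trace_eq hd hcap hv hI (Finset.mem_powerset.1 (Finset.mem_filter.1 hS).1)]
        exact ENNReal.le_tsum (f := fun m => pois (v * capa B) m *
          ∑' l, cp (wt (iB B) (qB B) (eB B)) m l * (if occ l = S then 1 else 0)) m
    _ = _ := sum_measure_trace hI B (Finset.filter_subset _ _)
    _ ≤ _ := by
        refine measure_mono ?_
        rintro ω ⟨S, hS, h⟩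
        exact hbad S _ (fun x hx => by simpa using (h x hx).symm) (Finset.mem_filter.1 hS).2

lemma factorial_le_exp {m : ℕ} (hm : 1 ≤ m) :
    (m.factorial : ℝ) ≤ Real.exp 1 * (m : ℝ) ^ (m + 1) * Real.exp (-m) := by
  induction m, hm using Nat.le_induction with
  | base => simp [← Real.exp_add]
  | succ m hm ih =>
    have hm0 : (0 : ℝ) < m := by exact_mod_cast hm
    have h1 : (m / (m + 1 : ℝ)) ^ (m + 1) ≤ Real.exp (-1) := by
      have h2 : m / (m + 1 : ℝ) ≤ Real.exp (-(1 / (m + 1))) := by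
        refine le_trans (le_of_eq ?_) (Real.add_one_le_exp _)
        field_simp
        ring
      refine (pow_le_pow_left₀ (by positivity) h2 _).trans_eq ?_
      rw [← Real.exp_nat_mul]
      congr 1
      push_cast
      field_simp
    rw [div_pow, div_le_iff₀ (by positivity)] at h1
    rw [Nat.factorial_succ]
    push_cast
    calc (m + 1 : ℝ) * m.factorial
        ≤ (m + 1) * (Real.exp 1 * (m : ℝ) ^ (m + 1) * Real.exp (-m)) := by gcongr
      _ ≤ (m + 1) * (Real.exp 1 * (Real.exp (-1) * (m + 1 : ℝ) ^ (m + 1)) * Real.exp (-m)) := by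
          gcongr
      _ = _ := by
          rw [show -(m + 1 : ℝ) = -1 + -m by ring, Real.exp_add]
          ring

lemma one_le_mul_pois {m : ℕ} (hm : 1 ≤ m) : 1 ≤ ENNReal.ofReal (Real.exp 1 * m) * pois m m := by
  have hm0 : (0 : ℝ) < m := by exact_mod_cast hm
  rw [pois, ← ENNReal.ofReal_mul (by positivity), ENNReal.one_le_ofReal,
    show Real.exp 1 * m * (Real.exp (-m) * ((m : ℝ) ^ m / m.factorial))
      = Real.exp 1 * (m : ℝ) ^ (m + 1) * Real.exp (-m) / m.factorial by ring,
    le_div_iff₀ (by positivity), one_mul]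
  exact factorial_le_exp hm

lemma tsum_cp_bad_le (hd : 3 ≤ d) (hcap : 0 < capa B) {m : ℕ} (hm : 1 ≤ m)
    (hI : IsInterlacement d (m / capa B) P I) {bad : Set (Lat d) → Prop}
    (hbad : ∀ A A' : Set (Lat d), (∀ x ∈ B, (x ∈ A ↔ x ∈ A')) → bad A → bad A') :
    ∑' l, cp (wt (iB B) (qB B) (eB B)) m l * (if bad (occ l) then 1 else 0)
      ≤ ENNReal.ofReal (Real.exp 1 * m) * P {ω | bad (I ω)} := by
  have h := tsum_cp_le_measure hd hcap (by positivity) hI hbad m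
  rw [div_mul_cancel₀ _ hcap.ne'] at h
  refine le_trans ?_ (mul_le_mul_right h _)
  rw [← mul_assoc]
  exact le_mul_of_one_le_left zero_le (one_le_mul_pois hm)

end InterlacementLaw

/-! ### The successive visits of the walk to a finite set -/

section Visits

variable {d : ℕ} {R : Type*} [CommRing R]

/-- The successive sites of `V` visited up to time `t`, in chronological order. -/
def vis {α : Type*} (V : Finset α) (ω : ℕ → α) : ℕ → List α
  | 0 => if ω 0 ∈ V then [ω 0] else []
  | t + 1 => vis V ω t ++ if ω (t + 1) ∈ V then [ω (t + 1)] else []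

lemma mem_vis {α : Type*} (V : Finset α) (ω : ℕ → α) (t : ℕ) (x : α) :
    x ∈ vis V ω t ↔ x ∈ V ∧ x ∈ visited t ω := by
  induction t with
  | zero =>
    simp only [vis, visited, Set.mem_ofPred_eq, nonpos_iff_eq_zero, exists_eq_left]
    split_ifs with h
    · rw [List.mem_singleton]
      exact ⟨fun hx => by subst hx; exact ⟨h, rfl⟩, fun hx => hx.2.symm⟩
    · simp only [List.not_mem_nil, false_iff]
      rintro ⟨h1, rfl⟩
      exact h h1
  | succ t ih =>
    simp only [vis, List.mem_append, ih, visited, Set.mem_ofPred_eq]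
    constructor
    · rintro (⟨h1, k, hk, h2⟩ | h)
      · exact ⟨h1, k, by omega, h2⟩
      · split_ifs at h with h'
        · rw [List.mem_singleton] at h
          exact ⟨h ▸ h', t + 1, le_rfl, h.symm⟩
        · simp at h
    · rintro ⟨h1, k, hk, h2⟩
      rcases Nat.le_succ_iff.1 hk with h | h
      · exact Or.inl ⟨h1, k, h, h2⟩
      · subst h
        subst h2
        right
        rw [if_pos h1]
        exact List.mem_singleton.2 rfl

/-- The probability weight of performing the visits `l` and then leaving `V`, starting at a site
of `V`. -/
def visW {d : ℕ} {R : Type*} [CommRing R] (V : Finset (Fin d → R)) :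
    List (Fin d → R) → (Fin d → R) → ℝ
  | [] => fun x => if ∃ p, x + dir p ∉ V then 1 else 0
  | b :: l => fun x => ret V x b * visW V l b

/-- The probability weight of performing the visits `l`, starting at a site outside `V`. -/
def visH {d : ℕ} {R : Type*} [CommRing R] (V : Finset (Fin d → R)) :
    List (Fin d → R) → (Fin d → R) → ℝ
  | [] => fun x => if x ∈ V then 0 else 1
  | b :: l => fun x => harm V b x * visW V l b

lemma visW_nonneg (V : Finset (Fin d → R)) (l : List (Fin d → R)) (x : Fin d → R) :
    0 ≤ visW V l x := by
  induction l generalizing x with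
  | nil => simp only [visW]; split_ifs <;> simp
  | cons b l ih => exact mul_nonneg (ret_nonneg V _ _) (ih b)

lemma visH_nonneg (V : Finset (Fin d → R)) (l : List (Fin d → R)) (x : Fin d → R) :
    0 ≤ visH V l x := by
  cases l with
  | nil => simp only [visH]; split_ifs <;> simp
  | cons b l => exact mul_nonneg (harm_nonneg _ _) (visW_nonneg V l b)

lemma avg_visH_le (hd : 0 < d) (V : Finset (Fin d → R)) (l : List (Fin d → R)) (x : Fin d → R) :
    avg (visH V l) x ≤ if x ∈ V then visW V l x else visH V l x := by
  cases l with
  | nil =>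
    have h1 : avg (visH V []) x ≤ 1 := avg_le_const hd fun z => by
      simp only [visH]; split_ifs <;> simp
    split_ifs with hx
    · simp only [visW]
      split_ifs with h
      · exact h1
      · push Not at h
        unfold avg
        rw [Finset.sum_eq_zero, mul_zero]
        intro p _
        simp [visH, h p]
    · simpa [visH, hx] using h1
  | cons b l =>
    have h1 : avg (visH V (b :: l)) x = avg (harm V b) x * visW V l b := by
      rw [mul_comm, ← avg_const_mul]
      simp only [visH]
      congr 1
      funext y
      ring
    rw [h1]
    split_ifs with hx
    · exact le_rfl
    · simp only [visH]
      rw [harm_off hd b hx]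

variable [MeasurableSpace R] {μ : Measure (ℕ → Fin d → R)} {init : (Fin d → R) → ℝ≥0∞}

lemma measure_vis_eq_le (h2 : (2 : R) ≠ 0) (hd : 0 < d) [Countable R] (hμ : IsWalkLaw μ init)
    (V : Finset (Fin d → R)) (t : ℕ) (l : List (Fin d → R)) :
    μ {ω | ω 0 ∉ V ∧ ω t ∉ V ∧ vis V ω t = l}
      ≤ ∑' x, init x * if x ∈ V then 0 else ENNReal.ofReal (visH V l x) := by
  set s₀ : (Fin d → R) → Option (List (Fin d → R)) := fun x => if x ∈ V then none else some l
    with hs₀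
  set upd : Option (List (Fin d → R)) → (Fin d → R) → (Fin d → R) → Option (List (Fin d → R)) :=
    fun s _ y => match s with
      | none => none
      | some rem => if y ∈ V then (match rem with
          | [] => none
          | a :: rem' => if y = a then some rem' else none) else some rem with hupd
  set Φ : Option (List (Fin d → R)) → (Fin d → R) → ℝ≥0∞ := fun s x => match s with
    | none => 0
    | some rem => ENNReal.ofReal (if x ∈ V then visW V rem x else visH V rem x) with hΦ
  have hst : ∀ (ω : ℕ → Fin d → R), ω 0 ∉ V → ∀ t rem, vis V ω t ++ rem = l →
      autom s₀ upd ω t = some rem := by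
    intro ω h0 t
    induction t with
    | zero =>
      intro rem h
      simp only [vis, if_neg h0, List.nil_append] at h
      simp [autom, hs₀, h0, h]
    | succ t ih =>
      intro rem h
      simp only [vis, List.append_assoc] at h
      have := ih _ h
      rw [autom, this]
      by_cases hy : ω (t + 1) ∈ V
      · simp [hupd, hy]
      · simp [hupd, hy]
  have := measure_one_le_autom hμ s₀ upd (Φ := Φ) (κ := 1) ?_ t
  · rw [one_pow, one_mul] at this
    refine (measure_mono fun ω hω => ?_).trans (this.trans_eq (tsum_congr fun x => ?_))
    · obtain ⟨h0, h1, h3⟩ := hω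
      simp only [Set.mem_ofPred_eq]
      rw [hst ω h0 t [] (by rw [List.append_nil, h3])]
      simp [hΦ, h1, visH]
    · simp only [hs₀, hΦ]
      by_cases hx : x ∈ V <;> simp [hx]
  · rintro (_ | rem) x
    · simp [hupd, hΦ]
    · rw [one_mul]
      have h3 : ∀ y, Φ (upd (some rem) x y) y = ENNReal.ofReal (visH V rem y) := by
        intro y
        by_cases hy : y ∈ V
        · cases rem with
          | nil => simp [hupd, hΦ, hy, visH]
          | cons a rem =>
            simp only [hupd, hΦ, hy, visH, if_true, harm_on hy]
            by_cases hya : y = a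
            · subst hya; simp
            · simp [hya]
        · simp [hupd, hΦ, hy]
      simp_rw [h3]
      rw [tsum_srwStep_ofReal h2 hd x fun p => visH_nonneg V rem _]
      exact ENNReal.ofReal_le_ofReal (avg_visH_le hd V rem x)

lemma measure_vis_cons_le (h2 : (2 : R) ≠ 0) (hd : 0 < d) [Countable R] (hμ : IsWalkLaw μ init)
    (hinit : ∑' x, init x ≤ 1) (V : Finset (Fin d → R)) (t : ℕ) {b : Fin d → R} (hb : b ∈ V)
    (l : List (Fin d → R)) :
    μ {ω | ω 0 ∉ V ∧ ω t ∉ V ∧ vis V ω t = b :: l}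
      ≤ ENNReal.ofReal ((if ∃ p, b + dir p ∉ V then 1 else 0) * visW V l b) := by
  refine (measure_vis_eq_le h2 hd hμ V t (b :: l)).trans ?_
  calc _ ≤ ∑' x, init x * ENNReal.ofReal ((if ∃ p, b + dir p ∉ V then 1 else 0) * visW V l b) := by
        refine ENNReal.tsum_le_tsum fun x => mul_le_mul_right ?_ _
        by_cases hx : x ∈ V
        · simp [hx]
        · rw [if_neg hx]
          refine ENNReal.ofReal_le_ofReal (mul_le_mul_of_nonneg_right ?_ (visW_nonneg V l b))
          split_ifs with h
          · exact hit_le_of_super (g := fun _ => 1) (fun _ => zero_le_one)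
              (fun z _ => by split_ifs <;> simp) (fun z _ => (avg_const hd 1 z).le) x
          · push Not at h
            refine (harm_le_of_interior h x).trans_eq (if_neg ?_)
            rintro rfl
            exact hx hb
    _ ≤ _ := by
        rw [ENNReal.tsum_mul_right]
        exact mul_le_of_le_one_left zero_le hinit

end Visits

section TorusVisits

variable {d N r : ℕ} {z : Torus d N} {em ε : ℝ}

lemma visW_emb_le (hd : 3 ≤ d) (hem : 0 < em)
    (hesc : ∀ y ∈ box d r, (∃ p, y + dir p ∉ box d r) → em ≤ esc (box d r) y)
    (hε0 : 0 ≤ ε)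
    (hret : ∀ v ∈ box d r, ∀ y ∈ box d r,
      ret ((box d r).image (emb z)) (emb z v) (emb z y) ≤ (1 + ε) * hatRet (box d r) v y)
    (l : List (box d r)) (b : box d r) :
    ENNReal.ofReal (visW ((box d r).image (emb z)) (l.map fun x => emb z x.1) (emb z b.1))
      ≤ ENNReal.ofReal ((1 + ε) ^ l.length / em) *
        wq (fun x y => qB (box d r) x y + eB (box d r) x * iB (box d r) y) (eB (box d r))
          (b :: l) := by
  induction l generalizing b with
  | nil =>
    simp only [List.map_nil, visW, List.length_nil, pow_zero, wq, eB]
    rw [← ENNReal.ofReal_mul (by positivity)]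
    refine ENNReal.ofReal_le_ofReal ?_
    have h0 := esc_nonneg hd (box d r) b.1
    split_ifs with h
    · obtain ⟨p, hp⟩ := h
      rw [one_div_mul_eq_div, le_div_iff₀ hem, one_mul]
      refine hesc _ b.2 ⟨p, fun h' => hp ?_⟩
      rw [emb_add_dir]
      exact Finset.mem_image_of_mem _ h'
    · positivity
  | cons c l ih =>
    simp only [List.map_cons, visW, List.length_cons, wq]
    rw [ENNReal.ofReal_mul (ret_nonneg _ _ _)]
    have h1 : ENNReal.ofReal (ret ((box d r).image (emb z)) (emb z b.1) (emb z c.1))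
        ≤ ENNReal.ofReal (1 + ε) *
          (qB (box d r) b c + eB (box d r) b * iB (box d r) c) := by
      refine (ENNReal.ofReal_le_ofReal (hret _ b.2 _ c.2)).trans_eq ?_
      rw [ENNReal.ofReal_mul (by positivity)]
      congr 1
      have hb := esc_nonneg hd (box d r) b.1
      have hc := esc_nonneg hd (box d r) c.1
      have hk := capa_nonneg hd (box d r)
      rw [qB, eB, iB, ← ENNReal.ofReal_mul hb, ← ENNReal.ofReal_add (ret_nonneg _ _ _)
        (by positivity), hatRet, mul_div_assoc]
    refine (mul_le_mul' h1 (ih c)).trans_eq ?_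
    rw [pow_succ', mul_div_assoc, ENNReal.ofReal_mul (by positivity)]
    ring

lemma measure_vis_emb_le [NeZero N] (hd : 3 ≤ d) (h2 : (2 : ZMod N) ≠ 0) (hcap : 0 < capa (box d r))
    (hem : 0 < em)
    (hesc : ∀ y ∈ box d r, (∃ p, y + dir p ∉ box d r) → em ≤ esc (box d r) y)
    (hε0 : 0 ≤ ε)
    (hret : ∀ v ∈ box d r, ∀ y ∈ box d r,
      ret ((box d r).image (emb z)) (emb z v) (emb z y) ≤ (1 + ε) * hatRet (box d r) v y)
    {μ : Measure (ℕ → Torus d N)} {init : Torus d N → ℝ≥0∞} (hμ : IsWalkLaw μ init)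
    (hinit : ∑' x, init x ≤ 1) (t : ℕ) {l : List (box d r)} (hl : l ≠ []) :
    μ {ω | ω 0 ∉ (box d r).image (emb z) ∧ ω t ∉ (box d r).image (emb z) ∧
        vis ((box d r).image (emb z)) ω t = l.map fun x => emb z x.1}
      ≤ ENNReal.ofReal (capa (box d r) / em ^ 2 * (1 + ε) ^ l.length) *
        ∑' m, cp (wt (iB (box d r)) (qB (box d r)) (eB (box d r))) m l := by
  refine le_trans ?_ (mul_le_mul_right (wt_hat_le l) _)
  obtain ⟨b, l, rfl⟩ := List.exists_cons_of_ne_nil hl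
  refine (measure_vis_cons_le h2 (by omega) hμ hinit _ t
    (Finset.mem_image_of_mem _ b.2) _).trans ?_
  have h0 := esc_nonneg hd (box d r) b.1
  have h2 := visW_emb_le hd hem hesc hε0 hret l b
  rw [wt]
  generalize wq (fun x y => qB (box d r) x y + eB (box d r) x * iB (box d r) y)
    (eB (box d r)) (b :: l) = W at h2 ⊢
  by_cases h : ∃ p, emb z b.1 + dir p ∉ (box d r).image (emb z)
  swap
  · rw [if_neg h, zero_mul, ENNReal.ofReal_zero]
    exact zero_le
  rw [if_pos h, one_mul]
  have h1 : 1 ≤ ENNReal.ofReal (capa (box d r) / em) * iB (box d r) b := by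
    rw [iB, ← ENNReal.ofReal_mul (by positivity), ← ENNReal.ofReal_one]
    refine ENNReal.ofReal_le_ofReal ?_
    rw [div_mul_div_comm, mul_comm em, mul_div_mul_left _ _ hcap.ne']
    obtain ⟨p, hp⟩ := h
    rw [le_div_iff₀ hem, one_mul]
    refine hesc _ b.2 ⟨p, fun h' => hp ?_⟩
    rw [emb_add_dir]
    exact Finset.mem_image_of_mem _ h'
  generalize iB (box d r) b = J at h1 ⊢
  have h4 : 0 ≤ capa (box d r) / em := by positivity
  refine h2.trans ((le_mul_of_one_le_left zero_le h1).trans ?_)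
  rw [mul_mul_mul_comm, ← ENNReal.ofReal_mul h4]
  refine mul_le_mul' (ENNReal.ofReal_le_ofReal ?_) le_rfl
  have h3 : (1 + ε) ^ l.length ≤ (1 + ε) ^ (b :: l).length :=
    pow_le_pow_right₀ (by linarith) (by simp)
  calc capa (box d r) / em * ((1 + ε) ^ l.length / em)
      = capa (box d r) / em ^ 2 * (1 + ε) ^ l.length := by field_simp
    _ ≤ _ := mul_le_mul_of_nonneg_left h3 (by positivity)

lemma exists_vis_eq_map (ω : ℕ → Torus d N) (t : ℕ) :
    ∃ l : List (box d r), vis ((box d r).image (emb z)) ω t = l.map fun x => emb z x.1 := by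
  have h : ∀ x ∈ vis ((box d r).image (emb z)) ω t, ∃ y : box d r, emb z y.1 = x := by
    intro x hx
    obtain ⟨y, hy, rfl⟩ := Finset.mem_image.1 ((mem_vis _ _ _ _).1 hx).1
    exact ⟨⟨y, hy⟩, rfl⟩
  generalize vis ((box d r).image (emb z)) ω t = L at h
  induction L with
  | nil => exact ⟨[], rfl⟩
  | cons a L ih =>
    obtain ⟨l, hl⟩ := ih fun x hx => h x (List.mem_cons_of_mem _ hx)
    obtain ⟨y, hy⟩ := h a List.mem_cons_self
    exact ⟨y :: l, by simp [hl, hy]⟩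

lemma mem_occ_iff_visited (hN : 2 * r + 1 < N) {ω : ℕ → Torus d N} {t : ℕ} {l : List (box d r)}
    (hl : vis ((box d r).image (emb z)) ω t = l.map fun x => emb z x.1) {x : Lat d}
    (hx : x ∈ box d r) : x ∈ occ l ↔ emb z x ∈ visited t ω := by
  have h1 := mem_vis ((box d r).image (emb z)) ω t (emb z x)
  simp only [Finset.mem_image_of_mem _ hx, true_and] at h1
  rw [← h1, hl, mem_occ, List.mem_map]
  constructor
  · rintro ⟨h, h'⟩
    exact ⟨_, h', rfl⟩
  · rintro ⟨y, hy, h'⟩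
    have : y.1 = x := emb_injOn_box hN z y.2 hx h'
    subst this
    exact ⟨hx, hy⟩

lemma measure_vis_pred_le [NeZero N] (hd : 3 ≤ d) (h2 : (2 : ZMod N) ≠ 0) (hcap : 0 < capa (box d r))
    (hem : 0 < em)
    (hesc : ∀ y ∈ box d r, (∃ p, y + dir p ∉ box d r) → em ≤ esc (box d r) y)
    (hε0 : 0 ≤ ε)
    (hret : ∀ v ∈ box d r, ∀ y ∈ box d r,
      ret ((box d r).image (emb z)) (emb z v) (emb z y) ≤ (1 + ε) * hatRet (box d r) v y)
    {μ : Measure (ℕ → Torus d N)} {init : Torus d N → ℝ≥0∞} (hμ : IsWalkLaw μ init)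
    (hinit : ∑' x, init x ≤ 1) (t : ℕ) {n : ℕ} {pred : List (box d r) → Prop}
    (hpred : ∀ l, pred l → l ≠ [] ∧ l.length < n) :
    μ {ω | ω 0 ∉ (box d r).image (emb z) ∧ ω t ∉ (box d r).image (emb z) ∧
        ∃ l, pred l ∧ vis ((box d r).image (emb z)) ω t = l.map fun x => emb z x.1}
      ≤ ENNReal.ofReal (capa (box d r) / em ^ 2 * (1 + ε) ^ n) *
        ∑ m ∈ Finset.range n, ∑' l, cp (wt (iB (box d r)) (qB (box d r)) (eB (box d r))) m l *
          if pred l then 1 else 0 := by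
  have hk := capa_nonneg hd (box d r)
  calc _ ≤ μ (⋃ l, {ω | pred l ∧ ω 0 ∉ (box d r).image (emb z) ∧
          ω t ∉ (box d r).image (emb z) ∧
          vis ((box d r).image (emb z)) ω t = l.map fun x => emb z x.1}) := by
        refine measure_mono ?_
        rintro ω ⟨h0, h1, l, h3, h4⟩
        exact Set.mem_iUnion.2 ⟨l, h3, h0, h1, h4⟩
    _ ≤ ∑' l, μ {ω | pred l ∧ ω 0 ∉ (box d r).image (emb z) ∧
          ω t ∉ (box d r).image (emb z) ∧
          vis ((box d r).image (emb z)) ω t = l.map fun x => emb z x.1} := measure_iUnion_le _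
    _ ≤ ∑' l, ENNReal.ofReal (capa (box d r) / em ^ 2 * (1 + ε) ^ n) *
          ∑ m ∈ Finset.range n, (cp (wt (iB (box d r)) (qB (box d r)) (eB (box d r))) m l *
          if pred l then 1 else 0) := by
        refine ENNReal.tsum_le_tsum fun l => ?_
        by_cases hl : pred l
        · obtain ⟨h3, h4⟩ := hpred l hl
          simp only [hl, true_and, if_true, mul_one]
          refine (measure_vis_emb_le hd h2 hcap hem hesc hε0 hret hμ hinit t h3).trans ?_
          rw [tsum_eq_sum (s := Finset.range n)]
          · refine mul_le_mul' (ENNReal.ofReal_le_ofReal ?_) le_rfl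
            gcongr
            linarith
          · intro m hm
            exact cp_eq_zero rfl (h4.trans_le (by simpa using hm))
        · simp [hl]
    _ = _ := by
        rw [ENNReal.tsum_mul_left, Summable.tsum_finsetSum fun _ _ => ENNReal.summable]

end TorusVisits

/-! ### Deviations of the number of visits -/

section VisitCount

lemma measure_one_le_vis {d : ℕ} {R : Type*} [CommRing R] [MeasurableSpace R] [Countable R]
    {μ : Measure (ℕ → Fin d → R)} {init : (Fin d → R) → ℝ≥0∞}
    (h2 : (2 : R) ≠ 0) (hd : 0 < d) (hμ : IsWalkLaw μ init)
    (hinit : ∑' x, init x ≤ 1) (V : Finset (Fin d → R)) {h : (Fin d → R) → ℝ} {s κ c C : ℝ}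
    (hh : ∀ x, 0 ≤ h x) (hhC : ∀ x, h x ≤ C) (hs : 0 < s) (hκ : 0 ≤ κ) (hc : 0 ≤ c)
    (H : ∀ x, avg h x ≤ κ * if x ∈ V then h x / s else h x) (t : ℕ) :
    μ {ω | 1 ≤ c * (s ^ (vis V ω t).length * if ω t ∈ V then h (ω t) / s else h (ω t))}
      ≤ ENNReal.ofReal (κ ^ t * (c * C)) := by
  set s₀ : (Fin d → R) → ℕ := fun x => if x ∈ V then 1 else 0 with hs₀
  set upd : ℕ → (Fin d → R) → (Fin d → R) → ℕ := fun n _ y => n + if y ∈ V then 1 else 0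
    with hupd
  have hst : ∀ (ω : ℕ → Fin d → R) t, autom s₀ upd ω t = (vis V ω t).length := by
    intro ω t
    induction t with
    | zero =>
      simp only [autom, hs₀, vis]
      split_ifs <;> rfl
    | succ t ih =>
      rw [autom, ih, vis, List.length_append]
      simp only [hupd]
      split_ifs <;> rfl
  set ψ : (Fin d → R) → ℝ := fun x => if x ∈ V then h x / s else h x with hψ
  have hψs : ∀ x, s ^ (if x ∈ V then 1 else 0 : ℕ) * ψ x = h x := by
    intro x
    simp only [hψ]
    split_ifs
    · field_simp
    · simp
  have := measure_one_le_autom hμ s₀ upd (Φ := fun n x => ENNReal.ofReal (c * (s ^ n * ψ x)))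
    (κ := ENNReal.ofReal κ) ?_ t
  · refine (measure_mono ?_).trans (this.trans ?_)
    · intro ω hω
      simp only [Set.mem_ofPred_eq] at hω ⊢
      rw [hst, ← ENNReal.ofReal_one]
      exact ENNReal.ofReal_le_ofReal hω
    · rw [← ENNReal.ofReal_pow hκ, ENNReal.ofReal_mul (by positivity)]
      refine mul_le_mul_right ?_ _
      calc _ ≤ ∑' x, init x * ENNReal.ofReal (c * C) := by
            refine ENNReal.tsum_le_tsum fun x => mul_le_mul_right (ENNReal.ofReal_le_ofReal ?_) _
            rw [hψs]
            exact mul_le_mul_of_nonneg_left (hhC x) hc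
        _ ≤ _ := by
            rw [ENNReal.tsum_mul_right]
            exact mul_le_of_le_one_left zero_le hinit
  · intro n x
    have e : ∀ y, c * (s ^ upd n x y * ψ y) = c * s ^ n * h y := by
      intro y
      rw [← hψs y, hupd, pow_add]
      ring
    simp only [e]
    rw [tsum_srwStep_ofReal h2 hd x (f := fun y => c * s ^ n * h y)
      (fun p => mul_nonneg (by positivity) (hh _)), ← ENNReal.ofReal_mul hκ]
    refine ENNReal.ofReal_le_ofReal ?_
    rw [avg_const_mul]
    calc _ ≤ c * s ^ n * (κ * ψ x) := mul_le_mul_of_nonneg_left (H x) (by positivity)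
      _ = _ := by ring

variable {d N : ℕ} [NeZero N] {z : Torus d N} {B : Finset (Lat d)}

lemma avg_sum_greenT (hd : 3 ≤ d) (hinj : Set.InjOn (emb z) B) (x : Torus d N) :
    avg (fun x => ∑ y ∈ B, greenT (x - emb z y)) x
      = ∑ y ∈ B, greenT (x - emb z y) - (if x ∈ B.image (emb z) then 1 else 0)
        + B.card / (N : ℝ) ^ d := by
  rw [avg_sum]
  have h : ∀ y, avg (fun x => greenT (x - emb z y)) x
      = greenT (x - emb z y) - (if x = emb z y then 1 else 0) + ((N : ℝ) ^ d)⁻¹ := by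
    intro y
    have := greenT_sub_avg (N := N) (by omega : 0 < d) (x - emb z y)
    rw [avg_shift]
    simp only [sub_eq_zero] at this
    linarith
  rw [Finset.sum_congr rfl fun y _ => h y, Finset.sum_add_distrib, Finset.sum_sub_distrib,
    Finset.sum_const, nsmul_eq_mul, ← div_eq_mul_inv,
    ← Finset.sum_image (f := fun w => if x = w then (1 : ℝ) else 0) hinj, Finset.sum_ite_eq]

variable {μ : Measure (ℕ → Torus d N)} {init : Torus d N → ℝ≥0∞} {a K D : ℝ}

lemma measure_vis_length_ge (hd : 3 ≤ d) (h2 : (2 : ZMod N) ≠ 0)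
    (hμ : IsWalkLaw μ init) (hinit : ∑' x, init x ≤ 1) (hinj : Set.InjOn (emb z) B)
    (hK : ∀ x, ∑ y ∈ B, |greenT (x - emb z y)| ≤ K) (hK1 : 1 ≤ K) (ha : 0 < a)
    (haK : a * K = D) (hD : D ≤ 1 / 2) (t n : ℕ) :
    μ {ω | n ≤ (vis (B.image (emb z)) ω t).length}
      ≤ ENNReal.ofReal (5 * Real.exp (a * (t * (B.card / (N : ℝ) ^ d) / (1 - D) ^ 2
        - n / (1 + D)))) := by
  set β : ℝ := B.card / (N : ℝ) ^ d with hβ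
  have hβ0 : 0 ≤ β := by positivity
  set g : Torus d N → ℝ := fun x => ∑ y ∈ B, greenT (x - emb z y) with hg
  have hgK : ∀ x, |g x| ≤ K := fun x => (Finset.abs_sum_le_sum_abs _ _).trans (hK x)
  have haD : a ≤ D := by rw [← haK]; nlinarith
  have hD0 : 0 < D := by linarith
  have hag : ∀ x, |a * g x| ≤ D := fun x => by
    rw [abs_mul, abs_of_pos ha, ← haK]
    exact mul_le_mul_of_nonneg_left (hgK x) ha.le
  set s : ℝ := (1 + D) / (1 + D - a) with hs
  have hda : 0 < 1 + D - a := by linarith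
  have hs1 : 1 ≤ s := by rw [hs, le_div_iff₀ hda]; linarith
  have hs0 : 0 < s := by linarith
  have hs3 : s ≤ 3 / 2 := by rw [hs, div_le_iff₀ hda]; linarith
  have hsD : s ≤ 1 / (1 - D) := by
    rw [hs, div_le_div_iff₀ hda (by linarith)]; nlinarith
  have hsinv : 1 / s = 1 - a / (1 + D) := by rw [hs]; field_simp
  set κ : ℝ := 1 + s * a * β / (1 - D) with hκ
  have hκ0 : 0 ≤ s * a * β / (1 - D) := by
    have : 0 < 1 - D := by linarith
    positivity
  set h : Torus d N → ℝ := fun x => 1 + a * g x with hh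
  have hlo : ∀ x, 1 - D ≤ h x := fun x => by have := (abs_le.1 (hag x)).1; simp only [hh]; linarith
  have hhi : ∀ x, h x ≤ 1 + D := fun x => by have := (abs_le.1 (hag x)).2; simp only [hh]; linarith
  have havg : ∀ x, avg h x = h x - (if x ∈ B.image (emb z) then a else 0) + a * β := by
    intro x
    rw [hh, avg_add, avg_const (by omega), avg_const_mul, avg_sum_greenT hd hinj]
    simp only [hg]
    split_ifs <;> ring
  have key := measure_one_le_vis h2 (by omega) hμ hinit (B.image (emb z)) (h := h) (s := s)
    (κ := κ) (c := s / (s ^ n * (1 - D))) (C := 1 + D)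
    (fun x => by linarith [hlo x]) hhi hs0 (by linarith)
    (div_nonneg hs0.le (mul_nonneg (by positivity) (by linarith))) ?_ t
  · refine (measure_mono ?_).trans (key.trans (ENNReal.ofReal_le_ofReal ?_))
    · intro ω hω
      simp only [Set.mem_ofPred_eq] at hω ⊢
      have h1 : s ^ n ≤ s ^ (vis (B.image (emb z)) ω t).length := pow_le_pow_right₀ hs1 hω
      have h3 : (1 - D) / s ≤ if ω t ∈ B.image (emb z) then h (ω t) / s else h (ω t) := by
        have := hlo (ω t)
        split_ifs
        · gcongr
        · exact (div_le_self (by linarith) hs1).trans this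
      have h4 : 0 < 1 - D := by linarith
      calc (1 : ℝ) = s / (s ^ n * (1 - D)) * (s ^ n * ((1 - D) / s)) := by field_simp
        _ ≤ _ := by
          gcongr
          refine h3.trans_eq ?_
          congr
    · have h4 : 0 < 1 - D := by linarith
      have e1 : κ ^ t ≤ Real.exp (a * (t * β / (1 - D) ^ 2)) := by
        calc κ ^ t ≤ Real.exp (s * a * β / (1 - D)) ^ t :=
              pow_le_pow_left₀ (by linarith) (by rw [hκ, add_comm]; exact Real.add_one_le_exp _) _
          _ = Real.exp (t * (s * a * β / (1 - D))) := by rw [← Real.exp_nat_mul]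
          _ ≤ _ := by
            refine Real.exp_le_exp.2 ?_
            calc t * (s * a * β / (1 - D)) ≤ t * (1 / (1 - D) * a * β / (1 - D)) := by gcongr
              _ = _ := by field_simp
      have e2 : (1 / s) ^ n ≤ Real.exp (-(a * (n / (1 + D)))) := by
        calc (1 / s) ^ n ≤ Real.exp (-(a / (1 + D))) ^ n := by
              refine pow_le_pow_left₀ (by positivity) ?_ _
              rw [hsinv, sub_eq_neg_add]
              exact Real.add_one_le_exp _
          _ = _ := by
              rw [← Real.exp_nat_mul]
              congr 1
              ring
      have e3 : s * ((1 + D) / (1 - D)) ≤ 5 := by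
        have : (1 + D) / (1 - D) ≤ 3 := by rw [div_le_iff₀ h4]; linarith
        have h5 : 0 ≤ (1 + D) / (1 - D) := by positivity
        nlinarith
      calc κ ^ t * (s / (s ^ n * (1 - D)) * (1 + D))
          = s * ((1 + D) / (1 - D)) * (κ ^ t * (1 / s) ^ n) := by
            simp only [one_div, inv_pow]
            field_simp
        _ ≤ 5 * (Real.exp (a * (t * β / (1 - D) ^ 2)) * Real.exp (-(a * (n / (1 + D))))) := by
            gcongr
        _ = _ := by
            rw [← Real.exp_add]
            congr 2
            ring
  · intro x
    rw [havg]
    have h4 : 0 < 1 - D := by linarith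
    have e1 : a * β ≤ s * a * β / (1 - D) * (h x / s) := by
      have : s * a * β / (1 - D) * (h x / s) = a * β * (h x / (1 - D)) := by field_simp
      rw [this]
      refine le_mul_of_one_le_right (by positivity) ?_
      rw [le_div_iff₀ h4]
      linarith [hlo x]
    split_ifs with hx
    · have e2 : h x - a ≤ h x / s := by
        rw [div_eq_mul_one_div, hsinv]
        have : h x * (a / (1 + D)) ≤ a := by
          rw [← mul_div_assoc, div_le_iff₀ (by linarith)]
          nlinarith [hhi x]
        linarith
      rw [hκ]
      linarith
    · have e2 : h x / s ≤ h x := div_le_self (by linarith [hlo x]) hs1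
      have e3 := mul_le_mul_of_nonneg_left e2 hκ0
      rw [hκ]
      linarith

lemma measure_vis_length_le (hd : 3 ≤ d) (h2 : (2 : ZMod N) ≠ 0)
    (hμ : IsWalkLaw μ init) (hinit : ∑' x, init x ≤ 1) (hinj : Set.InjOn (emb z) B)
    (hK : ∀ x, ∑ y ∈ B, |greenT (x - emb z y)| ≤ K) (hK1 : 1 ≤ K) (ha : 0 < a)
    (haK : a * K = D) (hD : D ≤ 1 / 2) (hN : B.card ≤ N ^ d) (t n : ℕ) :
    μ {ω | (vis (B.image (emb z)) ω t).length ≤ n}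
      ≤ ENNReal.ofReal (3 * Real.exp (a * (n / (1 - D)
        - t * (B.card / (N : ℝ) ^ d) * ((1 - D) / (1 + D))))) := by
  set β : ℝ := B.card / (N : ℝ) ^ d with hβ
  have hβ0 : 0 ≤ β := by positivity
  have hβ1 : β ≤ 1 := div_le_one_of_le₀ (by exact_mod_cast hN) (by positivity)
  set g : Torus d N → ℝ := fun x => ∑ y ∈ B, greenT (x - emb z y) with hg
  have hgK : ∀ x, |g x| ≤ K := fun x => (Finset.abs_sum_le_sum_abs _ _).trans (hK x)
  have haD : a ≤ D := by rw [← haK]; nlinarith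
  have hD0 : 0 < D := by linarith
  have h4 : 0 < 1 - D := by linarith
  have hag : ∀ x, |a * g x| ≤ D := fun x => by
    rw [abs_mul, abs_of_pos ha, ← haK]
    exact mul_le_mul_of_nonneg_left (hgK x) ha.le
  set s : ℝ := (1 - D) / (1 - D + a) with hs
  have hs0 : 0 < s := by positivity
  have hs1 : s ≤ 1 := by rw [hs, div_le_iff₀ (by linarith)]; linarith
  have hsD : 1 - D ≤ s := by
    rw [hs, le_div_iff₀ (by linarith)]
    nlinarith
  have hsinv : 1 / s = 1 + a / (1 - D) := by rw [hs]; field_simp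
  set κ : ℝ := 1 - s * a * β / (1 + D) with hκ
  have hκ1 : s * a * β / (1 + D) ≤ 1 := by
    rw [div_le_iff₀ (by linarith)]
    have : s * a * β ≤ 1 * D * 1 := by gcongr
    linarith
  set h : Torus d N → ℝ := fun x => 1 - a * g x with hh
  have hlo : ∀ x, 1 - D ≤ h x := fun x => by have := (abs_le.1 (hag x)).2; simp only [hh]; linarith
  have hhi : ∀ x, h x ≤ 1 + D := fun x => by have := (abs_le.1 (hag x)).1; simp only [hh]; linarith
  have havg : ∀ x, avg h x = h x + (if x ∈ B.image (emb z) then a else 0) - a * β := by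
    intro x
    rw [hh, avg_sub, avg_const (by omega), avg_const_mul, avg_sum_greenT hd hinj]
    simp only [hg]
    split_ifs <;> ring
  have key := measure_one_le_vis h2 (by omega) hμ hinit (B.image (emb z)) (h := h) (s := s)
    (κ := κ) (c := 1 / (s ^ n * (1 - D))) (C := 1 + D)
    (fun x => by linarith [hlo x]) hhi hs0 (by linarith)
    (by positivity) ?_ t
  · refine (measure_mono ?_).trans (key.trans (ENNReal.ofReal_le_ofReal ?_))
    · intro ω hω
      simp only [Set.mem_ofPred_eq] at hω ⊢
      have h1 : s ^ n ≤ s ^ (vis (B.image (emb z)) ω t).length :=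
        pow_le_pow_of_le_one hs0.le hs1 hω
      have h3 : (1 - D) ≤ if ω t ∈ B.image (emb z) then h (ω t) / s else h (ω t) := by
        have := hlo (ω t)
        split_ifs
        · exact this.trans (by rw [le_div_iff₀ hs0]; nlinarith)
        · exact this
      calc (1 : ℝ) = 1 / (s ^ n * (1 - D)) * (s ^ n * (1 - D)) := by field_simp
        _ ≤ _ := by
          gcongr
          refine h3.trans_eq ?_
          congr
    · have e1 : κ ^ t ≤ Real.exp (-(a * (t * β * ((1 - D) / (1 + D))))) := by
        calc κ ^ t ≤ Real.exp (-(s * a * β / (1 + D))) ^ t := by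
              refine pow_le_pow_left₀ (by linarith) ?_ _
              rw [hκ, sub_eq_neg_add]
              exact Real.add_one_le_exp _
          _ = Real.exp (-(t * (s * a * β / (1 + D)))) := by
              rw [← Real.exp_nat_mul]
              congr 1
              ring
          _ ≤ _ := by
            refine Real.exp_le_exp.2 (neg_le_neg ?_)
            calc a * (t * β * ((1 - D) / (1 + D))) = t * ((1 - D) * a * β / (1 + D)) := by ring
              _ ≤ _ := by gcongr
      have e2 : (1 / s) ^ n ≤ Real.exp (a * (n / (1 - D))) := by
        calc (1 / s) ^ n ≤ Real.exp (a / (1 - D)) ^ n := by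
              refine pow_le_pow_left₀ (by positivity) ?_ _
              rw [hsinv, add_comm]
              exact Real.add_one_le_exp _
          _ = _ := by
              rw [← Real.exp_nat_mul]
              congr 1
              ring
      have e3 : (1 + D) / (1 - D) ≤ 3 := by rw [div_le_iff₀ h4]; linarith
      calc κ ^ t * (1 / (s ^ n * (1 - D)) * (1 + D))
          = (1 + D) / (1 - D) * (κ ^ t * (1 / s) ^ n) := by
            simp only [one_div, inv_pow]
            field_simp
        _ ≤ 3 * (Real.exp (-(a * (t * β * ((1 - D) / (1 + D))))) *
              Real.exp (a * (n / (1 - D)))) := by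
            have : 0 ≤ κ := by linarith
            gcongr
        _ = _ := by
            rw [← Real.exp_add]
            congr 2
            ring
  · intro x
    rw [havg]
    have e1 : s * a * β / (1 + D) * (h x / s) ≤ a * β := by
      have : s * a * β / (1 + D) * (h x / s) = a * β * (h x / (1 + D)) := by field_simp
      rw [this]
      refine mul_le_of_le_one_right (by positivity) ?_
      rw [div_le_one₀ (by linarith)]
      linarith [hhi x]
    split_ifs with hx
    · have e2 : h x + a ≤ h x / s := by
        rw [div_eq_mul_one_div, hsinv]
        have : a ≤ h x * (a / (1 - D)) := by
          rw [← mul_div_assoc, le_div_iff₀ (by linarith)]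
          nlinarith [hlo x]
        linarith
      rw [hκ]
      linarith
    · have e2 : h x ≤ h x / s := by
        rw [le_div_iff₀ hs0]
        nlinarith [hlo x]
      have e3 := mul_le_mul_of_nonneg_left e2 (by positivity : 0 ≤ s * a * β / (1 + D))
      rw [hκ]
      linarith

end VisitCount

/-! ### Transfer of rare local events from interlacements to the walk -/

section LocalBound

variable {d r : ℕ} {B : Finset (Lat d)} {K D u : ℝ}

lemma tsum_cp_window_le (hd : 3 ≤ d) (hcap : 0 < capa B)
    (hKg : ∀ x ∈ B, ∑ y ∈ B, green (x - y) ≤ K) (hK1 : 1 ≤ K) (hu : 0 < u)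
    (hD0 : 0 < D) (hD : D ≤ 1 / 32) {Ω : Type*} [MeasurableSpace Ω] {P : Measure Ω}
    {I : ℝ → Ω → Set (Lat d)}
    (hI : ∀ v, 0 ≤ v → IsInterlacement d v P (I v)) {bad : Set (Lat d) → Prop}
    (hbad : ∀ A A' : Set (Lat d), (∀ x ∈ B, (x ∈ A ↔ x ∈ A')) → bad A → bad A')
    {p : ℝ≥0∞}
    (hp : ∀ v, u * (1 - 16 * D) ≤ v → v ≤ u * (1 + 16 * D) → P {ω | bad (I v ω)} ≤ p)
    {pred : List B → Prop}
    (hlo : ∀ l, pred l → (1 - 8 * D) * (u * B.card) ≤ l.length)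
    (hhi : ∀ l, pred l → l.length ≤ (1 + 8 * D) * (u * B.card))
    (hpb : ∀ l, pred l → bad (occ l)) (m : ℕ) :
    ∑' l, cp (wt (iB B) (qB B) (eB B)) m l * (if pred l then 1 else 0)
      ≤ ENNReal.ofReal (Real.exp (-(D ^ 2 * (u * B.card) / K)))
        + ENNReal.ofReal (Real.exp 1 * m) * p := by
  have hmono : ∀ q : List B → Prop, (∀ l, pred l → q l) →
      ∑' l, cp (wt (iB B) (qB B) (eB B)) m l * (if pred l then 1 else 0)
        ≤ ∑' l, cp (wt (iB B) (qB B) (eB B)) m l * (if q l then 1 else 0) := by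
    intro q hq
    refine ENNReal.tsum_le_tsum fun l => mul_le_mul_right ?_ _
    by_cases h : pred l
    · simp [h, hq l h]
    · simp [h]
  have hK0 : 0 < K := by linarith
  set a := D / K with ha
  have ha0 : 0 < a := by positivity
  have haK : a * K = D := by rw [ha]; field_simp
  have haD : a ≤ D := by rw [← haK]; nlinarith
  have hX : 0 ≤ u * (B.card : ℝ) := by positivity
  have hexp : ∀ q : ℝ, q ≤ -(D * (u * B.card)) → Real.exp (a * q)
      ≤ Real.exp (-(D ^ 2 * (u * B.card) / K)) := by
    intro q hq
    refine Real.exp_le_exp.2 ((mul_le_mul_of_nonneg_left hq ha0.le).trans_eq ?_)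
    rw [ha]
    ring
  have hmX : ∀ c : ℝ, (m : ℝ) * (B.card / capa B) ≤ c * (u * B.card) ∨
      u * c ≤ m / capa B := by
    intro c
    by_cases h : (m : ℝ) / capa B ≤ u * c
    · left
      calc (m : ℝ) * (B.card / capa B) = m / capa B * B.card := by ring
        _ ≤ u * c * B.card := by gcongr
        _ = _ := by ring
    · exact Or.inr (le_of_not_ge h)
  have hmX' : ∀ c : ℝ, c * (u * B.card) ≤ (m : ℝ) * (B.card / capa B) ∨
      m / capa B ≤ u * c := by
    intro c
    by_cases h : u * c ≤ (m : ℝ) / capa B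
    · left
      calc c * (u * B.card) = u * c * B.card := by ring
        _ ≤ m / capa B * B.card := by gcongr
        _ = _ := by ring
    · exact Or.inr (le_of_not_ge h)
  rcases hmX (1 - 16 * D) with h1 | h1
  · refine le_trans ?_ (le_self_add)
    refine (hmono _ hlo).trans ((tsum_cp_ge_le hd hcap.ne' ha0.le (by linarith) hKg hK0.le m
      ((1 - 8 * D) * (u * B.card))).trans (ENNReal.ofReal_le_ofReal (hexp _ ?_)))
    rw [haK]
    have h2 : (1 - 9 * D) * (u * B.card) ≤ (1 - 8 * D) * (u * B.card) / (1 + D) := by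
      rw [le_div_iff₀ (by linarith)]
      nlinarith [mul_nonneg hX hD0.le, mul_nonneg hX (sq_nonneg D)]
    nlinarith [mul_nonneg hX hD0.le]
  rcases hmX' (1 + 16 * D) with h3 | h3
  · refine le_trans ?_ (le_self_add)
    refine (hmono _ hhi).trans ((tsum_cp_le_le hd hcap.ne' ha0.le (by linarith) hKg m
      ((1 + 8 * D) * (u * B.card))).trans (ENNReal.ofReal_le_ofReal (hexp _ ?_)))
    rw [haK]
    have h2 : (1 + 8 * D) * (u * B.card) / (1 - D) ≤ (1 + 11 * D) * (u * B.card) := by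
      rw [div_le_iff₀ (by linarith)]
      have : 0 ≤ D * (2 - 11 * D) := mul_nonneg hD0.le (by linarith)
      nlinarith [mul_nonneg hX this]
    nlinarith [mul_nonneg hX hD0.le]
  · refine le_trans ?_ (le_add_self)
    have hm : 1 ≤ m := by
      rcases Nat.eq_zero_or_pos m with h | h
      · exfalso
        subst h
        rw [Nat.cast_zero, zero_div] at h1
        nlinarith
      · exact h
    exact (hmono _ hpb).trans ((tsum_cp_bad_le hd hcap hm (hI _ (by positivity)) hbad).trans
      (mul_le_mul_right (hp _ h1 h3) _))

set_option maxHeartbeats 1600000 in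
lemma measure_bad_le {N : ℕ} [NeZero N] {z : Torus d N} {em ε : ℝ}
    (hd : 3 ≤ d) (h2 : (2 : ZMod N) ≠ 0) (hcap : 0 < capa (box d r))
    (hem : 0 < em)
    (hesc : ∀ y ∈ box d r, (∃ p, y + dir p ∉ box d r) → em ≤ esc (box d r) y)
    (hε0 : 0 ≤ ε)
    (hret : ∀ v ∈ box d r, ∀ y ∈ box d r,
      ret ((box d r).image (emb z)) (emb z v) (emb z y) ≤ (1 + ε) * hatRet (box d r) v y)
    (hrN : 2 * r + 1 < N)
    (hK : ∀ x, ∑ y ∈ box d r, |greenT (x - emb z y)| ≤ K)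
    (hKg : ∀ x ∈ box d r, ∑ y ∈ box d r, green (x - y) ≤ K) (hK1 : 1 ≤ K) (hu : 0 < u)
    (hD0 : 0 < D) (hD : D ≤ 1 / 32) (hεn : ε * (2 * (u * (box d r).card) + 1) ≤ 1)
    {Ω : Type*} [MeasurableSpace Ω] {P : Measure Ω}
    {I : ℝ → Ω → Set (Lat d)}
    (hI : ∀ v, 0 ≤ v → IsInterlacement d v P (I v)) {bad : Set (Lat d) → Prop}
    (hbad : ∀ A A' : Set (Lat d), (∀ x ∈ box d r, (x ∈ A ↔ x ∈ A')) → bad A → bad A')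
    {p : ℝ≥0∞}
    (hp : ∀ v, u * (1 - 16 * D) ≤ v → v ≤ u * (1 + 16 * D) → P {ω | bad (I v ω)} ≤ p)
    {μ : Measure (ℕ → Torus d N)} {init : Torus d N → ℝ≥0∞} (hμ : IsWalkLaw μ init)
    (hinit : ∑' x, init x ≤ 1) :
    μ {ω | ω 0 ∉ (box d r).image (emb z) ∧ ω ⌊u * (N : ℝ) ^ d⌋₊ ∉ (box d r).image (emb z) ∧
        bad (emb z ⁻¹' visited ⌊u * (N : ℝ) ^ d⌋₊ ω)}
      ≤ ENNReal.ofReal (14 * Real.exp (-(D ^ 2 * (u * (box d r).card) / K)))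
        + ENNReal.ofReal (3 * (capa (box d r) / em ^ 2)) * (ENNReal.ofReal (2 * (u * (box d r).card) + 1) *
          (ENNReal.ofReal (Real.exp (-(D ^ 2 * (u * (box d r).card) / K)))
            + ENNReal.ofReal (Real.exp 1 * (2 * (u * (box d r).card) + 1)) * p)) := by
  set t := ⌊u * (N : ℝ) ^ d⌋₊ with ht
  set X : ℝ := u * (box d r).card with hX
  have hX0 : 0 ≤ X := by positivity
  set n₁ := ⌊(1 - 8 * D) * X⌋₊ with hn₁
  set n₂ := ⌈(1 + 8 * D) * X⌉₊ with hn₂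
  set V := (box d r).image (emb z) with hV
  set pred : List (box d r) → Prop := fun l => (n₁ < l.length ∧ l.length < n₂) ∧ bad (occ l)
    with hpred
  have hK0 : 0 < K := by linarith
  set a := D / K with ha
  have ha0 : 0 < a := by positivity
  have haK : a * K = D := by rw [ha]; field_simp
  have haD : a ≤ D := by rw [← haK]; nlinarith
  have hinj := emb_injOn_box hrN z
  have hNpos : 0 < (N : ℝ) := by exact_mod_cast NeZero.pos N
  have hNd : 0 < (N : ℝ) ^ d := by positivity
  have hcard : (box d r).card ≤ N ^ d := by
    rw [card_box]
    exact Nat.pow_le_pow_left hrN.le d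
  set β : ℝ := (box d r).card / (N : ℝ) ^ d with hβ
  have hβ0 : 0 ≤ β := by positivity
  have hβ1 : β ≤ 1 := div_le_one_of_le₀ (by exact_mod_cast hcard) (by positivity)
  have hXβ : X = u * (N : ℝ) ^ d * β := by rw [hX, hβ]; field_simp
  have htβ : t * β ≤ X := by
    rw [hXβ]
    exact mul_le_mul_of_nonneg_right (Nat.floor_le (by positivity)) hβ0
  have htβ' : X - 1 ≤ t * β := by
    have : u * (N : ℝ) ^ d - 1 ≤ t := (Nat.sub_one_lt_floor _).le
    have := mul_le_mul_of_nonneg_right this hβ0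
    rw [sub_mul, ← hXβ] at this
    linarith
  set E := Real.exp (-(D ^ 2 * X / K)) with hE
  have hexp : ∀ q : ℝ, q ≤ -(D * X) → Real.exp (a * q) ≤ E := by
    intro q hq
    refine Real.exp_le_exp.2 ((mul_le_mul_of_nonneg_left hq ha0.le).trans_eq ?_)
    rw [ha]
    ring
  have hge : μ {ω | n₂ ≤ (vis V ω t).length} ≤ ENNReal.ofReal (5 * E) := by
    refine (measure_vis_length_ge hd h2 hμ hinit hinj hK hK1 ha0 haK (by linarith) t n₂).trans
      (ENNReal.ofReal_le_ofReal (mul_le_mul_of_nonneg_left (hexp _ ?_) (by norm_num)))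
    have e1 : t * β / (1 - D) ^ 2 ≤ (1 + 3 * D) * X := by
      rw [div_le_iff₀ (by nlinarith)]
      refine htβ.trans ?_
      have : 1 ≤ (1 + 3 * D) * (1 - D) ^ 2 := by nlinarith [mul_pos hD0 hD0]
      nlinarith
    have e2 : (1 + 6 * D) * X ≤ n₂ / (1 + D) := by
      rw [le_div_iff₀ (by linarith)]
      have h3 : (1 + 8 * D) * X ≤ n₂ := Nat.le_ceil _
      have : 0 ≤ D * (1 - 6 * D) := mul_nonneg hD0.le (by linarith)
      nlinarith
    nlinarith [mul_nonneg hX0 hD0.le]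
  have hle : μ {ω | (vis V ω t).length ≤ n₁} ≤ ENNReal.ofReal (9 * E) := by
    refine (measure_vis_length_le hd h2 hμ hinit hinj hK hK1 ha0 haK (by linarith) hcard t
      n₁).trans (ENNReal.ofReal_le_ofReal ?_)
    have e1 : (n₁ : ℝ) / (1 - D) ≤ (1 - 7 * D) * X := by
      rw [div_le_iff₀ (by linarith)]
      have h3 : (n₁ : ℝ) ≤ (1 - 8 * D) * X :=
        Nat.floor_le (mul_nonneg (by linarith) hX0)
      nlinarith [mul_nonneg hX0 (sq_nonneg D)]
    have e2 : (1 - 2 * D) * X - 1 ≤ t * β * ((1 - D) / (1 + D)) := by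
      have h3 : (1 - 2 * D) ≤ (1 - D) / (1 + D) := by
        rw [le_div_iff₀ (by linarith)]
        nlinarith
      have h4 : (1 - D) / (1 + D) ≤ 1 := by
        rw [div_le_one₀ (by linarith)]
        linarith
      have h5 : 0 ≤ (1 - D) / (1 + D) := div_nonneg (by linarith) (by linarith)
      calc (1 - 2 * D) * X - 1 ≤ (1 - D) / (1 + D) * X - 1 := by gcongr
        _ ≤ (X - 1) * ((1 - D) / (1 + D)) := by nlinarith
        _ ≤ _ := by gcongr
    have e3 : Real.exp (a * (n₁ / (1 - D) - t * β * ((1 - D) / (1 + D))))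
        ≤ Real.exp (a * -(D * X)) * Real.exp a := by
      rw [← Real.exp_add]
      refine Real.exp_le_exp.2 ?_
      have : (n₁ : ℝ) / (1 - D) - t * β * ((1 - D) / (1 + D)) ≤ -(D * X) + 1 := by
        nlinarith [mul_nonneg hX0 hD0.le]
      nlinarith
    have e4 : Real.exp a ≤ 3 := by
      have := Real.exp_le_exp.2 (by linarith : a ≤ 1)
      linarith [Real.exp_one_lt_d9]
    have e5 := hexp (-(D * X)) le_rfl
    have e6 : Real.exp (a * -(D * X)) * Real.exp a ≤ E * 3 := by gcongr
    linarith
  have hmid : μ {ω | ω 0 ∉ V ∧ ω t ∉ V ∧ ∃ l, pred l ∧ vis V ω t = l.map fun x => emb z x.1}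
      ≤ ENNReal.ofReal (3 * (capa (box d r) / em ^ 2)) * (ENNReal.ofReal (2 * X + 1) *
          (ENNReal.ofReal E + ENNReal.ofReal (Real.exp 1 * (2 * X + 1)) * p)) := by
    have hn₂' : (n₂ : ℝ) ≤ 2 * X + 1 := by
      have : (n₂ : ℝ) < (1 + 8 * D) * X + 1 := Nat.ceil_lt_add_one (by positivity)
      nlinarith
    refine (measure_vis_pred_le hd h2 hcap hem hesc hε0 hret hμ hinit t (n := n₂)
      (pred := pred) ?_).trans ?_
    · rintro l ⟨⟨h3, h4⟩, -⟩
      refine ⟨?_, h4⟩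
      rintro rfl
      simp at h3
    · refine mul_le_mul' (ENNReal.ofReal_le_ofReal ?_) ?_
      · have h3 : (1 + ε) ^ n₂ ≤ 3 := by
          calc (1 + ε) ^ n₂ ≤ Real.exp ε ^ n₂ :=
                pow_le_pow_left₀ (by linarith) (by rw [add_comm]; exact Real.add_one_le_exp _) _
            _ = Real.exp (n₂ * ε) := by rw [← Real.exp_nat_mul]
            _ ≤ Real.exp 1 := Real.exp_le_exp.2 (by nlinarith)
            _ ≤ 3 := by linarith [Real.exp_one_lt_d9]
        have h4 := capa_nonneg hd (box d r)
        rw [mul_comm]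
        gcongr
      · calc _ ≤ ∑ m ∈ Finset.range n₂,
              (ENNReal.ofReal E + ENNReal.ofReal (Real.exp 1 * (2 * X + 1)) * p) := by
              refine Finset.sum_le_sum fun m hm => ?_
              refine (tsum_cp_window_le hd hcap hKg hK1 hu hD0 hD hI hbad hp (pred := pred)
                ?_ ?_ (fun l hl => hl.2) m).trans ?_
              · rintro l ⟨⟨h3, -⟩, -⟩
                exact (Nat.lt_of_floor_lt h3).le
              · rintro l ⟨⟨-, h3⟩, -⟩
                exact (Nat.lt_ceil.1 h3).le
              · gcongr
                exact (Nat.cast_le.2 (Finset.mem_range.1 hm).le).trans hn₂'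
          _ ≤ _ := by
              rw [Finset.sum_const, Finset.card_range, nsmul_eq_mul]
              refine mul_le_mul' ?_ le_rfl
              rw [← ENNReal.ofReal_natCast]
              exact ENNReal.ofReal_le_ofReal hn₂'
  have hsub : {ω | ω 0 ∉ V ∧ ω t ∉ V ∧ bad (emb z ⁻¹' visited t ω)}
      ⊆ ({ω | n₂ ≤ (vis V ω t).length} ∪ {ω | (vis V ω t).length ≤ n₁}) ∪
        {ω | ω 0 ∉ V ∧ ω t ∉ V ∧ ∃ l, pred l ∧ vis V ω t = l.map fun x => emb z x.1} := by
    rintro ω ⟨h0, h1, h3⟩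
    obtain ⟨l, hl⟩ := exists_vis_eq_map (r := r) (z := z) ω t
    have hlen : (vis V ω t).length = l.length := by rw [hV, hl, List.length_map]
    by_cases h4 : n₂ ≤ (vis V ω t).length
    · exact Or.inl (Or.inl h4)
    by_cases h5 : (vis V ω t).length ≤ n₁
    · exact Or.inl (Or.inr h5)
    rw [hlen] at h4 h5
    refine Or.inr ⟨h0, h1, l, ⟨⟨by omega, by omega⟩, hbad _ _ ?_ h3⟩, hl⟩
    intro x hx
    exact (mem_occ_iff_visited hrN hl hx).symm
  refine (measure_mono hsub).trans ((measure_union_le _ _).trans (add_le_add ?_ hmid))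
  refine (measure_union_le _ _).trans ((add_le_add hge hle).trans_eq ?_)
  rw [← ENNReal.ofReal_add (by positivity) (by positivity)]
  congr 1
  ring

end LocalBound

/-! ### Connectivity and diameters -/

section Connectivity

lemma connectedIn_refl {α : Type*} {rel : α → α → Prop} {S : Set α} {x : α} (hx : x ∈ S) :
    connectedIn rel S x x :=
  ⟨0, fun _ => x, rfl, rfl, fun _ _ => hx, fun k hk => absurd hk (Nat.not_lt_zero k)⟩

lemma connectedIn.mono {α : Type*} {rel : α → α → Prop} {S T : Set α} {x y : α}
    (h : connectedIn rel S x y) (hST : S ⊆ T) : connectedIn rel T x y := by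
  obtain ⟨n, p, h0, h1, h2, h3⟩ := h
  exact ⟨n, p, h0, h1, fun k hk => hST (h2 k hk), h3⟩

lemma connectedIn.left_mem {α : Type*} {rel : α → α → Prop} {S : Set α} {x y : α}
    (h : connectedIn rel S x y) : x ∈ S := by
  obtain ⟨n, p, rfl, h1, h2, h3⟩ := h
  exact h2 0 (Nat.zero_le n)

lemma connectedIn.right_mem {α : Type*} {rel : α → α → Prop} {S : Set α} {x y : α}
    (h : connectedIn rel S x y) : y ∈ S := by
  obtain ⟨n, p, h0, rfl, h2, h3⟩ := h
  exact h2 n le_rfl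

lemma connectedIn.step {α : Type*} {rel : α → α → Prop} {S : Set α} {x y z : α}
    (h : connectedIn rel S x y) (hz : z ∈ S) (hyz : rel y z) : connectedIn rel S x z := by
  obtain ⟨n, p, h0, h1, h2, h3⟩ := h
  refine ⟨n + 1, fun k => if k ≤ n then p k else z, by simp [h0], by simp, ?_, ?_⟩
  · intro k hk
    dsimp only
    split_ifs with h
    · exact h2 k h
    · exact hz
  · intro k hk
    rcases Nat.lt_succ_iff_lt_or_eq.1 hk with h | rfl
    · simp only [h.le, Nat.succ_le_of_lt h, if_true]
      exact h3 k h
    · simpa [h1] using hyz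

lemma connectedIn.induct {α : Type*} {rel : α → α → Prop} {S : Set α} {x y : α}
    (h : connectedIn rel S x y) {motive : α → Prop} (h0 : motive x)
    (hs : ∀ a b, a ∈ S → b ∈ S → rel a b → motive a → motive b) : motive y := by
  obtain ⟨n, p, rfl, rfl, h2, h3⟩ := h
  have : ∀ k ≤ n, motive (p k) := by
    intro k
    induction k with
    | zero => exact fun _ => h0
    | succ k ih =>
      exact fun hk => hs _ _ (h2 k (by omega)) (h2 _ hk) (h3 k (by omega)) (ih (by omega))
  exact this n le_rfl

lemma connectedIn.trans {α : Type*} {rel : α → α → Prop} {S : Set α} {x y z : α}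
    (h : connectedIn rel S x y) (h' : connectedIn rel S y z) : connectedIn rel S x z :=
  h'.induct h fun _ _ _ hb hab h => h.step hb hab

lemma connectedIn.symm {α : Type*} {rel : α → α → Prop} (hrel : ∀ a b, rel a b → rel b a)
    {S : Set α} {x y : α} (h : connectedIn rel S x y) : connectedIn rel S y x :=
  h.induct (motive := fun b => connectedIn rel S b x) (connectedIn_refl h.left_mem) fun a b ha hb hab h' =>
    ((connectedIn_refl hb).step ha (hrel a b hab)).trans h'

lemma connectedIn.image {α β : Type*} {rel : α → α → Prop} {rel' : β → β → Prop} {f : α → β}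
    (hf : ∀ a b, rel a b → rel' (f a) (f b)) {S : Set α} {T : Set β} (hST : ∀ a ∈ S, f a ∈ T)
    {x y : α} (h : connectedIn rel S x y) : connectedIn rel' T (f x) (f y) := by
  obtain ⟨n, p, rfl, rfl, h2, h3⟩ := h
  exact ⟨n, fun k => f (p k), rfl, rfl, fun k hk => hST _ (h2 k hk), fun k hk => hf _ _ (h3 k hk)⟩

lemma adj_symm {d : ℕ} {R : Type*} [AddGroupWithOne R] (x y : Fin d → R) (h : adj x y) :
    adj y x := by
  obtain ⟨h1, i, h2, h3⟩ := h
  exact ⟨h1.symm, i, h2.symm, fun j hj => (h3 j hj).symm⟩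

/-- The sites of a path form a connected set. -/
lemma isConnSet_path {α : Type*} {rel : α → α → Prop} (hrel : ∀ a b, rel a b → rel b a)
    {n : ℕ} {p : ℕ → α} (h : ∀ k < n, rel (p k) (p (k + 1))) :
    IsConnSet rel {x | ∃ k ≤ n, p k = x} := by
  have h0 : ∀ k ≤ n, connectedIn rel {x | ∃ k ≤ n, p k = x} (p 0) (p k) := by
    intro k hk
    exact ⟨k, p, rfl, rfl, fun i hi => ⟨i, hi.trans hk, rfl⟩, fun i hi => h i (by omega)⟩
  rintro x ⟨k, hk, rfl⟩ y ⟨l, hl, rfl⟩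
  exact ((h0 k hk).symm hrel).trans (h0 l hl)

variable {d : ℕ}

lemma latDist_le_iff {x y : Lat d} {n : ℕ} : latDist x y ≤ n ↔ ∀ i, |x i - y i| ≤ n := by
  simp only [latDist, Finset.sup_le_iff, Finset.mem_univ, true_implies]
  exact forall_congr' fun i => by
    rw [← Nat.cast_le (α := ℤ), Int.natCast_natAbs]

lemma mem_latBall_natCast {x : Lat d} {n : ℕ} : x ∈ latBall (0 : Lat d) (n : ℝ) ↔ x ∈ box d n := by
  simp only [latBall, Set.mem_ofPred_eq, Nat.cast_le, latDist_le_iff, mem_box, Pi.zero_apply,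
    zero_sub, abs_neg]

lemma le_diamOf {S : Set (Lat d)} {n : ℕ} (hS : S ⊆ box d n) {x y : Lat d} (hx : x ∈ S)
    (hy : y ∈ S) : latDist x y ≤ diamOf latDist S := by
  refine le_csSup ⟨2 * n, ?_⟩ ⟨x, hx, y, hy, rfl⟩
  rintro _ ⟨x, hx, y, hy, rfl⟩
  rw [latDist_le_iff]
  intro i
  have h1 := abs_le.1 (mem_box.1 (hS hx) i)
  have h2 := abs_le.1 (mem_box.1 (hS hy) i)
  rw [abs_le]
  push_cast
  constructor <;> linarith

lemma adj_abs_sub_le {x y : Lat d} (h : adj x y) (i : Fin d) : |x i - y i| ≤ 1 := by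
  obtain ⟨-, j, h1, h2⟩ := h
  by_cases hij : i = j
  · subst hij
    rcases h1 with h1 | h1 <;> rw [h1] <;> simp
  · rw [h2 i hij]
    simp

end Connectivity

/-! ### Good boxes -/

section GoodBox

variable {d : ℕ}

/-- Local existence and uniqueness of macroscopic vacant clusters at scale `L`, when `A` is the
set of occupied sites. -/
def Good (L : ℕ) (A : Set (Lat d)) : Prop :=
  (∃ S : Set (Lat d), S ⊆ Aᶜ ∩ latBall 0 ((L : ℝ) / 2) ∧ IsConnSet adj S ∧
    (L : ℝ) / 8 ≤ (diamOf latDist S : ℝ)) ∧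
  ∀ S₁ S₂ : Set (Lat d), S₁ ⊆ Aᶜ ∩ latBall 0 (L : ℝ) → S₂ ⊆ Aᶜ ∩ latBall 0 (L : ℝ) →
    IsConnSet adj S₁ → IsConnSet adj S₂ →
    (L : ℝ) / 8 ≤ (diamOf latDist S₁ : ℝ) → (L : ℝ) / 8 ≤ (diamOf latDist S₂ : ℝ) →
    ∃ x ∈ S₁, ∃ y ∈ S₂, connectedIn adj (Aᶜ ∩ latBall 0 (2 * (L : ℝ))) x y

lemma latBall_subset {r r' : ℝ} (h : r ≤ r') (x : Lat d) : latBall x r ⊆ latBall x r' :=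
  fun _ hy => le_trans hy h

lemma good_congr {L : ℕ} {A A' : Set (Lat d)} (h : ∀ x ∈ box d (2 * L), (x ∈ A ↔ x ∈ A')) :
    Good L A ↔ Good L A' := by
  have h1 : ∀ r : ℝ, r ≤ 2 * L → Aᶜ ∩ latBall 0 r = A'ᶜ ∩ latBall 0 r := by
    intro r hr
    ext x
    simp only [Set.mem_inter_iff, Set.mem_compl_iff]
    refine and_congr_left fun hx => not_congr (h x ?_)
    rw [← mem_latBall_natCast]
    push_cast
    exact latBall_subset hr 0 hx
  have hL : (0 : ℝ) ≤ L := by positivity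
  unfold Good
  rw [h1 _ (by linarith), h1 L (by linarith), h1 (2 * L) le_rfl]

lemma measurableSet_of_local {Ω : Type*} [MeasurableSpace Ω] {P : Measure Ω}
    {I : Ω → Set (Lat d)} {v : ℝ} (hI : IsInterlacement d v P I) {B : Finset (Lat d)}
    {E : Set (Lat d) → Prop}
    (hE : ∀ A A' : Set (Lat d), (∀ x ∈ B, (x ∈ A ↔ x ∈ A')) → E A → E A') :
    MeasurableSet {ω | E (I ω)} := by
  have : {ω | E (I ω)} = ⋃ S ∈ B.powerset.filter (fun S : Finset (Lat d) => E S),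
      {ω | ∀ x ∈ B, (x ∈ I ω ↔ x ∈ S)} := by
    ext ω
    simp only [Set.mem_iUnion, Finset.mem_filter, Finset.mem_powerset, Set.mem_ofPred_eq,
      exists_prop]
    constructor
    · intro h
      refine ⟨B.filter fun x => x ∈ I ω, ⟨Finset.filter_subset _ _, hE _ _ ?_ h⟩, ?_⟩
      · intro x hx
        simp [hx]
      · intro x hx
        simp [hx]
    · rintro ⟨S, ⟨-, hS⟩, h⟩
      exact hE _ _ (fun x hx => (h x hx).symm) hS
  rw [this]
  exact Finset.measurableSet_biUnion _ fun S _ => measurableSet_trace hI B S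

/-- A long path contains a long connected piece around its starting point. -/
lemma exists_connSet_of_connectedIn {W : Set (Lat d)} {n : ℕ} {x y : Lat d}
    (hx : x ∈ latBall (0 : Lat d) (n : ℝ)) (hy : connectedIn adj W x y)
    (hyb : y ∉ box d (2 * n)) :
    ∃ S : Set (Lat d), S ⊆ W ∩ latBall 0 ((2 * n : ℕ) : ℝ) ∧ IsConnSet adj S ∧ x ∈ S ∧
      n ≤ diamOf latDist S := by
  obtain ⟨m, p, h0, h1, h2, h3⟩ := hy
  have hxb : x ∈ box d (2 * n) := by
    rw [← mem_latBall_natCast]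
    exact latBall_subset (by push_cast; linarith [(Nat.cast_nonneg n : (0 : ℝ) ≤ n)]) 0 hx
  have hex : ∃ k, p k ∉ box d (2 * n) := ⟨m, by rwa [h1]⟩
  set k := Nat.find hex with hk
  have hk1 : p k ∉ box d (2 * n) := Nat.find_spec hex
  have hk2 : ∀ i < k, p i ∈ box d (2 * n) := fun i hi => by
    by_contra h
    exact Nat.find_min hex hi h
  have hkm : k ≤ m := Nat.find_min' hex (by rwa [h1])
  have hk0 : k ≠ 0 := by
    intro h
    rw [h, h0] at hk1
    exact hk1 hxb
  obtain ⟨l, hl⟩ := Nat.exists_eq_succ_of_ne_zero hk0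
  have hsub : {x | ∃ i ≤ l, p i = x} ⊆ (box d (2 * n) : Set (Lat d)) := by
    rintro _ ⟨i, hi, rfl⟩
    exact hk2 i (by omega)
  refine ⟨{x | ∃ i ≤ l, p i = x}, ?_, ?_, ⟨0, Nat.zero_le l, h0⟩, ?_⟩
  · rintro _ ⟨i, hi, rfl⟩
    exact ⟨h2 i (by omega), mem_latBall_natCast.2 (hk2 i (by omega))⟩
  · exact isConnSet_path adj_symm fun i hi => h3 i (by omega)
  · refine le_trans ?_ (le_diamOf hsub ⟨0, Nat.zero_le l, rfl⟩ ⟨l, le_rfl, rfl⟩)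
    rw [h0]
    by_contra hlt
    push Not at hlt
    obtain ⟨n', rfl⟩ : ∃ n', n = n' + 1 := ⟨n - 1, by omega⟩
    have h4 := (latDist_le_iff (x := x) (y := p l) (n := n')).1 (by omega)
    have h5 := adj_abs_sub_le (h3 l (by omega))
    refine hk1 (mem_box.2 fun i => ?_)
    have h6 := mem_box.1 (mem_latBall_natCast.1 hx) i
    have h7 := h4 i
    have h8 := h5 i
    have e : p k i = x i - (x i - p l i) - (p l i - p k i) := by ring
    rw [hl] at e ⊢
    rw [e]
    have h9 := abs_sub (x i - (x i - p l i)) (p l i - p (l + 1) i)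
    have h10 := abs_sub (x i) (x i - p l i)
    push_cast at *
    simp only [Nat.succ_eq_add_one] at *
    linarith

lemma exists_connSet_of_infinite {W : Set (Lat d)} {n : ℕ} {x : Lat d}
    (hx : x ∈ latBall (0 : Lat d) (n : ℝ)) (hinf : (compOf adj W x).Infinite) :
    ∃ S : Set (Lat d), S ⊆ W ∩ latBall 0 ((2 * n : ℕ) : ℝ) ∧ IsConnSet adj S ∧
      n ≤ diamOf latDist S := by
  obtain ⟨y, hy, hyb⟩ := hinf.exists_notMem_finset (box d (2 * n))
  obtain ⟨S, h1, h2, -, h3⟩ := exists_connSet_of_connectedIn hx hy hyb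
  exact ⟨S, h1, h2, h3⟩

lemma measure_compl_le_of_subset {Ω : Type*} [MeasurableSpace Ω] {P : Measure Ω}
    [IsProbabilityMeasure P] {s t : Set Ω} (ht : MeasurableSet t) (hst : s ⊆ t) {q : ℝ}
    (hs : 1 - q ≤ (P s).toReal) : P tᶜ ≤ ENNReal.ofReal q := by
  have h1 : (P s).toReal ≤ (P t).toReal :=
    ENNReal.toReal_mono (measure_ne_top P t) (measure_mono hst)
  have h2 : (P tᶜ).toReal = 1 - (P t).toReal := by
    have := probReal_compl_eq_one_sub (μ := P) ht
    simpa [Measure.real] using this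
  rw [← ENNReal.ofReal_toReal (measure_ne_top P tᶜ)]
  exact ENNReal.ofReal_le_ofReal (by linarith)

lemma measure_not_good_le {u w q₁ q₂ v : ℝ} {Ω : Type*} [MeasurableSpace Ω] {P : Measure Ω}
    {I : ℝ → Ω → Set (Lat d)} (hI : IsInterlacement d v P (I v))
    (hmono : ∀ v v' : ℝ, v ≤ v' → ∀ ω, I v ω ⊆ I v' ω) {n : ℕ}
    (hv1 : u * (1 - w) ≤ v) (hv2 : v ≤ u * (1 + w))
    (h1 : 1 - q₁ ≤ (P {ω | ∃ x ∈ latBall (0 : Lat d) (n : ℝ),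
          (compOf adj ((I (u * (1 + w)) ω)ᶜ) x).Infinite}).toReal)
    (h2 : 1 - q₂ ≤ (P {ω | ∀ S₁ S₂ : Set (Lat d),
            S₁ ⊆ (I (u * (1 - w)) ω)ᶜ ∩ latBall 0 ((4 * n : ℕ) : ℝ) →
            S₂ ⊆ (I (u * (1 - w)) ω)ᶜ ∩ latBall 0 ((4 * n : ℕ) : ℝ) →
            IsConnSet adj S₁ → IsConnSet adj S₂ →
            ((4 * n : ℕ) : ℝ) / 8 ≤ (diamOf latDist S₁ : ℝ) →
            ((4 * n : ℕ) : ℝ) / 8 ≤ (diamOf latDist S₂ : ℝ) →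
            ∃ x ∈ S₁, ∃ y ∈ S₂,
              connectedIn adj ((I (u * (1 + w)) ω)ᶜ ∩ latBall 0 (2 * ((4 * n : ℕ) : ℝ))) x y}).toReal)
    (hq₁ : 0 ≤ q₁) (hq₂ : 0 ≤ q₂) :
    P {ω | ¬ Good (4 * n) (I v ω)} ≤ ENNReal.ofReal (q₁ + q₂) := by
  have := hI.1
  have hL : (0 : ℝ) ≤ (4 * n : ℕ) := by positivity
  have hloc : ∀ A A' : Set (Lat d), (∀ x ∈ box d (2 * (4 * n)), (x ∈ A ↔ x ∈ A')) →
      ∀ r : ℝ, r ≤ 2 * ((4 * n : ℕ) : ℝ) → Aᶜ ∩ latBall 0 r = A'ᶜ ∩ latBall 0 r := by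
    intro A A' h r hr
    ext x
    simp only [Set.mem_inter_iff, Set.mem_compl_iff]
    refine and_congr_left fun hx => not_congr (h x ?_)
    rw [← mem_latBall_natCast]
    refine latBall_subset (hr.trans_eq ?_) 0 hx
    push_cast
    ring
  have m1 : MeasurableSet {ω | ∃ S : Set (Lat d),
      S ⊆ (I v ω)ᶜ ∩ latBall 0 (((4 * n : ℕ) : ℝ) / 2) ∧ IsConnSet adj S ∧
      ((4 * n : ℕ) : ℝ) / 8 ≤ (diamOf latDist S : ℝ)} :=
    measurableSet_of_local (B := box d (2 * (4 * n))) hI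
      (E := fun A => ∃ S : Set (Lat d),
        S ⊆ Aᶜ ∩ latBall 0 (((4 * n : ℕ) : ℝ) / 2) ∧ IsConnSet adj S ∧
        ((4 * n : ℕ) : ℝ) / 8 ≤ (diamOf latDist S : ℝ))
      fun A A' h => by rw [hloc A A' h _ (by linarith)]; exact id
  have m2 := measurableSet_of_local (B := box d (2 * (4 * n))) hI
    (E := fun A => ∀ S₁ S₂ : Set (Lat d), S₁ ⊆ Aᶜ ∩ latBall 0 ((4 * n : ℕ) : ℝ) →
      S₂ ⊆ Aᶜ ∩ latBall 0 ((4 * n : ℕ) : ℝ) → IsConnSet adj S₁ → IsConnSet adj S₂ →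
      ((4 * n : ℕ) : ℝ) / 8 ≤ (diamOf latDist S₁ : ℝ) →
      ((4 * n : ℕ) : ℝ) / 8 ≤ (diamOf latDist S₂ : ℝ) →
      ∃ x ∈ S₁, ∃ y ∈ S₂, connectedIn adj (Aᶜ ∩ latBall 0 (2 * ((4 * n : ℕ) : ℝ))) x y)
    fun A A' h => by
      rw [hloc A A' h _ (by linarith), hloc A A' h (2 * ((4 * n : ℕ) : ℝ)) le_rfl]; exact id
  have b1 := measure_compl_le_of_subset m1 (fun ω hω => ?_) h1
  have b2 := measure_compl_le_of_subset m2 (fun ω hω => ?_) h2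
  · rw [ENNReal.ofReal_add hq₁ hq₂]
    refine (measure_mono ?_).trans ((measure_union_le _ _).trans (add_le_add b1 b2))
    intro ω hω
    by_contra hcon
    simp only [Set.mem_union, Set.mem_compl_iff, not_or, not_not] at hcon
    exact hω ⟨hcon.1, hcon.2⟩
  · intro S₁ S₂ hS₁ hS₂ c₁ c₂ d₁ d₂
    have hs : (I v ω)ᶜ ⊆ (I (u * (1 - w)) ω)ᶜ := Set.compl_subset_compl.2 (hmono _ _ hv1 ω)
    obtain ⟨x, hx, y, hy, hxy⟩ := hω S₁ S₂ (hS₁.trans (Set.inter_subset_inter_left _ hs))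
      (hS₂.trans (Set.inter_subset_inter_left _ hs)) c₁ c₂ d₁ d₂
    exact ⟨x, hx, y, hy, connectedIn.mono hxy
      (Set.inter_subset_inter_left _ (Set.compl_subset_compl.2 (hmono _ _ hv2 ω)))⟩
  · obtain ⟨x, hx, hinf⟩ := hω
    obtain ⟨S, hS, hc, hdm⟩ := exists_connSet_of_infinite hx hinf
    refine ⟨S, hS.trans ?_, hc, ?_⟩
    · refine Set.inter_subset_inter (Set.compl_subset_compl.2 (hmono _ _ hv2 ω))
        (latBall_subset ?_ 0)
      push_cast
      linarith
    · have : (n : ℝ) ≤ (diamOf latDist S : ℝ) := by exact_mod_cast hdm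
      push_cast
      linarith [(Nat.cast_nonneg n : (0 : ℝ) ≤ n)]

end GoodBox

/-! ### Probability that a box of the torus is bad -/

section BadBox

variable {d : ℕ}

lemma pow_le_card_box_mul (hd : 0 < d) {j : ℕ} (hj : 1 ≤ j) :
    ((2 * j + 1 : ℕ) : ℝ) ^ d ≤ (box d (16 * j ^ 2)).card * (j : ℝ) ^ (-(1 / 8) : ℝ) := by
  have hj1 : (1 : ℝ) ≤ j := by exact_mod_cast hj
  have h : (2 * j + 1) ^ d * j ≤ (2 * (16 * j ^ 2) + 1) ^ d := by
    calc (2 * j + 1) ^ d * j ≤ (2 * j + 1) ^ d * j ^ d :=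
          Nat.mul_le_mul le_rfl (Nat.le_self_pow hd.ne' j)
      _ = ((2 * j + 1) * j) ^ d := (mul_pow _ _ _).symm
      _ ≤ _ := Nat.pow_le_pow_left (by nlinarith) d
  rw [card_box]
  calc ((2 * j + 1 : ℕ) : ℝ) ^ d = (((2 * j + 1) ^ d * j : ℕ) : ℝ) * (j : ℝ)⁻¹ := by
        push_cast
        field_simp
    _ ≤ (((2 * (16 * j ^ 2) + 1) ^ d : ℕ) : ℝ) * (j : ℝ)⁻¹ := by
        gcongr
    _ ≤ _ := by
        gcongr
        exact inv_le_rpow_eighth hj1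

lemma mul_rpow_neg_eighth_le_one {F t : ℝ} (hF : 0 < F) (h : F ^ 8 ≤ t) :
    F * t ^ (-(1 / 8) : ℝ) ≤ 1 := by
  have h5 : t ^ (-(1 / 8) : ℝ) ≤ F⁻¹ := by
    calc t ^ (-(1 / 8) : ℝ) ≤ (F ^ 8) ^ (-(1 / 8) : ℝ) :=
          Real.rpow_le_rpow_of_nonpos (by positivity) h (by norm_num)
      _ = _ := by
          rw [← Real.rpow_natCast, ← Real.rpow_mul hF.le, ← Real.rpow_neg_one]
          norm_num
  calc F * t ^ (-(1 / 8) : ℝ) ≤ F * F⁻¹ := by gcongr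
    _ = 1 := mul_inv_cancel₀ hF.ne'

lemma card_box_mul_escape_le {r G M : ℕ} (hd : 0 < d) (hG : 2 * gC d ≤ G)
    (hM : (G * (box d r).card) ^ 8 ≤ M) :
    ((box d r).card : ℝ) * (gC d * (M : ℝ) ^ (-(1 / 8) : ℝ)) ≤ 1 / 2 := by
  have hg := gC_pos hd
  have hb : (0 : ℝ) < (box d r).card := by
    rw [card_box]
    positivity
  have hGp : (0 : ℝ) < G := by linarith
  have hx : (0 : ℝ) < G * (box d r).card := by positivity
  have h1 : (G : ℝ) * (box d r).card * (M : ℝ) ^ (-(1 / 8) : ℝ) ≤ 1 :=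
    mul_rpow_neg_eighth_le_one hx (by exact_mod_cast hM)
  have h2 : (0 : ℝ) ≤ (box d r).card * (M : ℝ) ^ (-(1 / 8) : ℝ) := by positivity
  nlinarith [mul_le_mul_of_nonneg_right hG h2]

lemma measure_not_good_scale_le (hd : 3 ≤ d) {u w : ℝ} (hu : 0 < u) (hw : 0 < w)
    {Ω : Type*} [MeasurableSpace Ω] {P : Measure Ω} {I : ℝ → Ω → Set (Lat d)}
    (hI : ∀ v, 0 ≤ v → IsInterlacement d v P (I v)) {j r L G M N : ℕ} [NeZero N] (hj : 1 ≤ j)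
    (hr : r = 16 * j ^ 2) (hL : r = 2 * L)
    (hbad : ∀ v, u * (1 - w) ≤ v → v ≤ u * (1 + w) → 0 ≤ v →
      P {ω | ¬ Good L (I v ω)} ≤ ENNReal.ofReal (2 * Real.exp (-(j : ℝ) ^ w)))
    (hG : 2 * gC d ≤ G)
    (hM2 : 2 ≤ M) (hM : (G * (box d r).card) ^ 8 ≤ M)
    (hN1 : 8 * (r + 1) ≤ N)
    (hN2 : (4 * (1 + 4 * gC d) * ((box d r).card * (4 * d * M) ^ 2) *
      (2 * (u * (box d r).card) + 1)) ^ 8 ≤ N) (z : Torus d N)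
    {μ : Measure (ℕ → Torus d N)} {init : Torus d N → ℝ≥0∞} (hμ : IsWalkLaw μ init)
    (hinit : ∑' x, init x ≤ 1) :
    μ {ω | ω 0 ∉ (box d r).image (emb z) ∧
        ω ⌊u * (N : ℝ) ^ d⌋₊ ∉ (box d r).image (emb z) ∧
        ¬ Good L (emb z ⁻¹' visited ⌊u * (N : ℝ) ^ d⌋₊ ω)}
      ≤ ENNReal.ofReal (14 * Real.exp (-((min w (1 / 2) / 16) ^ 2 * u / (2 * (1 + gC d)) *
            (j : ℝ) ^ (1 / 8 : ℝ))))
        + ENNReal.ofReal (3 * ((box d r).card * (4 * d * M) ^ 2)) *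
          (ENNReal.ofReal (2 * (u * (box d r).card) + 1) *
          (ENNReal.ofReal (Real.exp (-((min w (1 / 2) / 16) ^ 2 * u / (2 * (1 + gC d)) *
            (j : ℝ) ^ (1 / 8 : ℝ))))
            + ENNReal.ofReal (Real.exp 1 * (2 * (u * (box d r).card) + 1)) *
              ENNReal.ofReal (2 * Real.exp (-(j : ℝ) ^ w)))) := by
  have hd0 : 0 < d := by omega
  have hg := gC_pos hd0
  set b : ℝ := ((box d r).card : ℝ) with hb
  have hb1 : 1 ≤ b := by
    rw [hb, card_box]
    exact_mod_cast Nat.one_le_pow _ _ (by omega)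
  have hb0 : 0 < b := by linarith
  have hj1 : (1 : ℝ) ≤ j := by exact_mod_cast hj
  have hj0 : (0 : ℝ) < j := by linarith
  have hN0 : (0 : ℝ) < N := by exact_mod_cast (by omega : 0 < N)
  have hM0 : (0 : ℝ) < M := by exact_mod_cast (by omega : 0 < M)
  have hdR : (1 : ℝ) ≤ d := by exact_mod_cast hd0
  have hM2R : (2 : ℝ) ≤ M := by exact_mod_cast hM2
  have hdM : (0 : ℝ) < 4 * d * M := by positivity
  have hrN : 2 * r + 1 < N := by omega
  have h2 : (2 : ZMod N) ≠ 0 := by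
    intro h
    have : ((2 : ℕ) : ZMod N) = 0 := by exact_mod_cast h
    rw [ZMod.natCast_eq_zero_iff] at this
    have := Nat.le_of_dvd two_pos this
    omega
  have hpow := pow_le_card_box_mul hd0 hj
  rw [← hr, ← hb] at hpow
  set K : ℝ := 2 * (1 + gC d) * (b * (j : ℝ) ^ (-(1 / 8) : ℝ)) with hKdef
  have hKb : ((2 * j + 1 : ℕ) : ℝ) ^ d * (1 + gC d) + b * ((1 + gC d) * (j : ℝ) ^ (-(1 / 8) : ℝ)) ≤ K := by
    have := mul_le_mul_of_nonneg_right hpow (by linarith : (0 : ℝ) ≤ 1 + gC d)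
    rw [hKdef]
    linarith
  have hK1 : 1 ≤ K := by
    have h3 : (1 : ℝ) ≤ ((2 * j + 1 : ℕ) : ℝ) ^ d := one_le_pow₀ (by push_cast; linarith)
    have h4 : 1 ≤ b * (j : ℝ) ^ (-(1 / 8) : ℝ) := h3.trans hpow
    rw [hKdef]
    have := one_le_mul_of_one_le_of_one_le (by linarith : 1 ≤ 2 * (1 + gC d)) h4
    linarith
  have hKg : ∀ x, ∑ y ∈ box d r, green (x - y) ≤ K := fun x =>
    (sum_green_le hd (box d r) hj x).trans hKb
  have hcap : 0 < capa (box d r) := by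
    have := card_le_mul_capa hd (box d r) fun x _ => hKg x
    rw [← hb] at this
    by_contra hc
    push Not at hc
    have := mul_nonpos_of_nonneg_of_nonpos (by linarith : 0 ≤ K) hc
    linarith
  have hesc : ∀ y ∈ box d r, (∃ p, y + dir p ∉ box d r) → (4 * (d : ℝ) * M)⁻¹ ≤ esc (box d r) y := by
    rintro y hy ⟨p, hp⟩
    exact esc_box_ge hd hM2 (card_box_mul_escape_le hd0 hG hM) hy hp
  have hem1 : (4 * (d : ℝ) * M)⁻¹ ≤ (2 * (d : ℝ))⁻¹ := by
    apply inv_anti₀ (by positivity)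
    have := mul_le_mul_of_nonneg_left hM2R (by positivity : 0 ≤ 4 * (d : ℝ))
    linarith
  set ε : ℝ := 4 * ((1 + 4 * gC d) * (N : ℝ) ^ (-(1 / 8) : ℝ)) * (b * (4 * d * M) ^ 2) with hε
  have hε0 : 0 ≤ ε := by positivity
  have hret : ∀ v ∈ box d r, ∀ y ∈ box d r,
      ret ((box d r).image (emb z)) (emb z v) (emb z y) ≤ (1 + ε) * hatRet (box d r) v y := by
    intro v hv y hy
    refine ret_emb_le hd hN1 z hcap (inv_pos.2 hdM) hem1 hesc hε0 (le_of_eq ?_) hv hy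
    rw [hε, ← hb]
    field_simp
  have hεn : ε * (2 * (u * b) + 1) ≤ 1 := by
    set F : ℝ := 4 * (1 + 4 * gC d) * (b * (4 * d * M) ^ 2) * (2 * (u * b) + 1) with hF
    have hF0 : 0 < F := by positivity
    have e : ε * (2 * (u * b) + 1) = F * (N : ℝ) ^ (-(1 / 8) : ℝ) := by
      rw [hε, hF]
      ring
    rw [e]
    exact mul_rpow_neg_eighth_le_one hF0 hN2
  have hmin : 0 < min w (1 / 2) := lt_min hw (by norm_num)
  have hmw : min w (1 / 2) ≤ w := min_le_left _ _
  have hmh : min w (1 / 2) ≤ 1 / 2 := min_le_right _ _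
  set D : ℝ := min w (1 / 2) / 16 with hD
  have hlo : u * (1 - w) ≤ u * (1 - 16 * D) :=
    mul_le_mul_of_nonneg_left (by rw [hD]; linarith) hu.le
  have hhi : u * (1 + 16 * D) ≤ u * (1 + w) :=
    mul_le_mul_of_nonneg_left (by rw [hD]; linarith) hu.le
  have h0lo : 0 ≤ u * (1 - 16 * D) := mul_nonneg hu.le (by rw [hD]; linarith)
  have hD32 : D ≤ 1 / 32 := by rw [hD]; linarith
  have hD0 : 0 < D := by rw [hD]; linarith
  have key := measure_bad_le (d := d) (r := r) (N := N) (z := z) (K := K) (D := D) (u := u)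
    (em := (4 * (d : ℝ) * M)⁻¹) (ε := ε) hd h2 hcap (inv_pos.2 hdM) hesc hε0 hret hrN
    (fun x => (sum_abs_greenT_le hd z (emb_injOn_box hrN z) hj x).trans hKb)
    (fun x _ => hKg x) hK1 hu hD0 hD32 hεn
    hI (bad := fun A => ¬ Good (L) A)
    (fun A A' h => by
      rw [good_congr (A := A) (A' := A')]
      · exact id
      · intro x hx
        refine h x ?_
        rwa [hL])
    (p := ENNReal.ofReal (2 * Real.exp (-(j : ℝ) ^ w)))
    (fun v hv1 hv2 => hbad v (hlo.trans hv1) (hv2.trans hhi) (h0lo.trans hv1))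
    hμ hinit
  refine key.trans ?_
  have hX : D ^ 2 * (u * b) / K = D ^ 2 * u / (2 * (1 + gC d)) * (j : ℝ) ^ (1 / 8 : ℝ) := by
    rw [hKdef, Real.rpow_neg hj0.le]
    field_simp
  rw [hX]
  gcongr
  · rw [inv_pow, div_inv_eq_mul]
    gcongr
    exact capa_le_card _

end BadBox

/-! ### Polynomially bounded sequences -/

section PolyBdd

/-- The sequence `f` is polynomially bounded. -/
def PolyBdd (f : ℕ → ℝ) : Prop := ∃ (C : ℝ) (q : ℕ), 0 ≤ C ∧ ∀ j : ℕ, 1 ≤ j → |f j| ≤ C * (j : ℝ) ^ q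

variable {f g : ℕ → ℝ}

lemma polyBdd_const (a : ℝ) : PolyBdd fun _ => a :=
  ⟨|a|, 0, abs_nonneg a, fun j _ => by simp⟩

lemma polyBdd_natCast : PolyBdd fun j => (j : ℝ) :=
  ⟨1, 1, zero_le_one, fun j _ => by simp⟩

lemma PolyBdd.mul (hf : PolyBdd f) (hg : PolyBdd g) : PolyBdd fun j => f j * g j := by
  obtain ⟨C, q, hC, h⟩ := hf
  obtain ⟨C', q', hC', h'⟩ := hg
  refine ⟨C * C', q + q', by positivity, fun j hj => ?_⟩
  rw [abs_mul, pow_add, mul_mul_mul_comm]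
  exact mul_le_mul (h j hj) (h' j hj) (abs_nonneg _) (by positivity)

lemma PolyBdd.add (hf : PolyBdd f) (hg : PolyBdd g) : PolyBdd fun j => f j + g j := by
  obtain ⟨C, q, hC, h⟩ := hf
  obtain ⟨C', q', hC', h'⟩ := hg
  refine ⟨C + C', q + q', by positivity, fun j hj => ?_⟩
  have hj1 : (1 : ℝ) ≤ j := by exact_mod_cast hj
  refine (abs_add_le _ _).trans ?_
  have h1 : C * (j : ℝ) ^ q ≤ C * (j : ℝ) ^ (q + q') := by
    gcongr
    omega
  have h2 : C' * (j : ℝ) ^ q' ≤ C' * (j : ℝ) ^ (q + q') := by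
    gcongr
    omega
  linarith [h j hj, h' j hj]

lemma PolyBdd.pow (hf : PolyBdd f) (n : ℕ) : PolyBdd fun j => f j ^ n := by
  induction n with
  | zero => simpa using polyBdd_const 1
  | succ n ih => simpa only [pow_succ] using ih.mul hf

end PolyBdd

section BadBoxBound

variable {d : ℕ}

/-- Polynomial prefactor and stretched exponential decay of the probability of a bad box. -/
lemma exists_measure_not_good_le (hd : 3 ≤ d) {u : ℝ} (hu : 0 < u)
    (hsup : StronglySupercritical d u) :
    ∃ (γ c A : ℝ) (q J : ℕ), 0 < γ ∧ 0 < c ∧ 0 ≤ A ∧ ∀ j : ℕ, J ≤ j → ∀ N : ℕ, ∀ _ : NeZero N,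
      A * (j : ℝ) ^ q ≤ N → ∀ z : Torus d N, ∀ (μ : Measure (ℕ → Torus d N))
      (init : Torus d N → ℝ≥0∞), IsWalkLaw μ init → ∑' x, init x ≤ 1 →
      μ {ω | ω 0 ∉ (box d (16 * j ^ 2)).image (emb z) ∧
        ω ⌊u * (N : ℝ) ^ d⌋₊ ∉ (box d (16 * j ^ 2)).image (emb z) ∧
        ¬ Good (8 * j ^ 2) (emb z ⁻¹' visited ⌊u * (N : ℝ) ^ d⌋₊ ω)} ≤
      ENNReal.ofReal (A * (j : ℝ) ^ q * Real.exp (-(c * (j : ℝ) ^ γ))) := by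
  obtain ⟨w, hw, Ω, mΩ, P, I, hI, hmono, N₀, hN₀⟩ := hsup
  have hg := gC_pos (d := d) (by omega)
  obtain ⟨G, hG⟩ := exists_nat_ge (2 * gC d)
  set c₁ : ℝ := (min w (1 / 2) / 16) ^ 2 * u / (2 * (1 + gC d)) with hc₁
  have hc₁0 : 0 < c₁ := by
    have : 0 < min w (1 / 2) := lt_min hw (by norm_num)
    positivity
  let b : ℕ → ℝ := fun j => ((box d (16 * j ^ 2)).card : ℝ)
  let M : ℕ → ℕ := fun j => (G * (box d (16 * j ^ 2)).card) ^ 8 + 2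
  let m : ℕ → ℝ := fun j => b j * (4 * d * (M j : ℝ)) ^ 2
  let s : ℕ → ℝ := fun j => 2 * (u * b j) + 1
  let F : ℕ → ℝ := fun j => 4 * (1 + 4 * gC d) * m j * s j
  let H : ℕ → ℝ := fun j => 14 + 3 * m j * (s j * (1 + Real.exp 1 * s j * 2))
  have pb : PolyBdd b := by
    have : b = fun j : ℕ => (2 * (16 * (j : ℝ) ^ 2) + 1) ^ d := by
      funext j
      simp only [b, card_box]
      push_cast
      rfl
    rw [this]
    exact (((polyBdd_const 2).mul ((polyBdd_const 16).mul (polyBdd_natCast.pow 2))).add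
      (polyBdd_const 1)).pow d
  have pM : PolyBdd fun j => (M j : ℝ) := by
    have : (fun j => (M j : ℝ)) = fun j => ((G : ℝ) * b j) ^ 8 + 2 := by
      funext j
      simp only [M, b]
      push_cast
      rfl
    rw [this]
    exact (((polyBdd_const G).mul pb).pow 8).add (polyBdd_const 2)
  have pm : PolyBdd m := pb.mul (((polyBdd_const (4 * (d : ℝ))).mul pM).pow 2)
  have ps : PolyBdd s := ((polyBdd_const 2).mul ((polyBdd_const u).mul pb)).add (polyBdd_const 1)
  have pF : PolyBdd F := ((polyBdd_const (4 * (1 + 4 * gC d))).mul pm).mul ps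
  have pH : PolyBdd H := (polyBdd_const 14).add (((polyBdd_const 3).mul pm).mul
    (ps.mul ((polyBdd_const 1).add (((polyBdd_const (Real.exp 1)).mul ps).mul (polyBdd_const 2)))))
  have hb0 : ∀ j, 0 ≤ b j := fun j => Nat.cast_nonneg _
  have hm0 : ∀ j, 0 ≤ m j := fun j => mul_nonneg (hb0 j) (sq_nonneg _)
  have hs0 : ∀ j, 0 ≤ s j := fun j => by
    have := mul_nonneg hu.le (hb0 j)
    simp only [s]
    linarith
  have hH0 : ∀ j, 0 ≤ H j := fun j => by
    have := hm0 j
    have := hs0 j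
    simp only [H]
    positivity
  obtain ⟨A, q, hA, hAq⟩ := (((polyBdd_const 8).mul (((polyBdd_const 16).mul
    (polyBdd_natCast.pow 2)).add (polyBdd_const 1))).add (pF.pow 8)).add pH
  refine ⟨min (1 / 8) w, min c₁ 1, A, q, N₀ + 1, lt_min (by norm_num) hw, lt_min hc₁0 one_pos, hA,
    ?_⟩
  intro j hj N _ hN z μ init hμ hinit
  have hj1 : 1 ≤ j := by omega
  have hj1R : (1 : ℝ) ≤ j := by exact_mod_cast hj1
  have hF8 : 0 ≤ F j ^ 8 := by
    have : Even 8 := by decide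
    exact this.pow_nonneg _
  have hsq : 0 ≤ 8 * (16 * (j : ℝ) ^ 2 + 1) := by positivity
  have hAj := (le_abs_self _).trans (hAq j hj1)
  simp only at hAj
  have hHj := hH0 j
  have hN1 : 8 * (16 * j ^ 2 + 1) ≤ N := by
    have : 8 * (16 * (j : ℝ) ^ 2 + 1) ≤ N := by linarith
    exact_mod_cast this
  have hbad : ∀ v, u * (1 - w) ≤ v → v ≤ u * (1 + w) → 0 ≤ v →
      P {ω | ¬ Good (8 * j ^ 2) (I v ω)} ≤ ENNReal.ofReal (2 * Real.exp (-(j : ℝ) ^ w)) := by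
    intro v hv1 hv2 hv0
    have hj2 : j ≤ j ^ 2 := Nat.le_self_pow two_ne_zero j
    have e1 := (hN₀ (2 * j ^ 2) (by omega)).1
    have e2 := (hN₀ (4 * (2 * j ^ 2)) (by omega)).2
    have := measure_not_good_le (hI v hv0) hmono hv1 hv2 e1 e2 (Real.exp_pos _).le
      (Real.exp_pos _).le
    rw [show 4 * (2 * j ^ 2) = 8 * j ^ 2 by ring] at this
    refine this.trans (ENNReal.ofReal_le_ofReal ?_)
    have hexp : ∀ n : ℕ, j ≤ n → Real.exp (-(n : ℝ) ^ w) ≤ Real.exp (-(j : ℝ) ^ w) := by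
      intro n hn
      gcongr
    linarith [hexp (2 * j ^ 2) (by omega), hexp (8 * j ^ 2) (by omega)]
  have key := measure_not_good_scale_le (M := M j) hd hu hw hI hj1 rfl
    (by ring : 16 * j ^ 2 = 2 * (8 * j ^ 2)) hbad hG (by simp only [M]; omega)
    (by simp only [M]; omega) hN1 (show F j ^ 8 ≤ N by linarith) z hμ hinit
  refine key.trans ?_
  rw [← hc₁]
  set X := Real.exp (-(c₁ * (j : ℝ) ^ (1 / 8 : ℝ))) with hX
  set Y := Real.exp (-(j : ℝ) ^ w) with hY
  set Z := Real.exp (-(min c₁ 1 * (j : ℝ) ^ (min (1 / 8) w))) with hZ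
  have hX0 : 0 ≤ X := (Real.exp_pos _).le
  have hY0 : 0 ≤ Y := (Real.exp_pos _).le
  have hXZ : X ≤ Z := by
    rw [hX, hZ]
    gcongr
    · exact min_le_left _ _
    · exact min_le_left _ _
  have hYZ : Y ≤ Z := by
    rw [hY, hZ]
    gcongr
    calc min c₁ 1 * (j : ℝ) ^ (min (1 / 8) w) ≤ 1 * (j : ℝ) ^ w := by
          gcongr
          · exact min_le_right _ _
          · exact min_le_right _ _
      _ = _ := one_mul _
  have hmj := hm0 j
  have hsj := hs0 j
  have he := (Real.exp_pos 1).le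
  change ENNReal.ofReal (14 * X) + ENNReal.ofReal (3 * m j) * (ENNReal.ofReal (s j) *
    (ENNReal.ofReal X + ENNReal.ofReal (Real.exp 1 * s j) * ENNReal.ofReal (2 * Y))) ≤ _
  rw [← ENNReal.ofReal_mul (by positivity), ← ENNReal.ofReal_add hX0 (by positivity),
    ← ENNReal.ofReal_mul hsj, ← ENNReal.ofReal_mul (by positivity),
    ← ENNReal.ofReal_add (by positivity) (by positivity)]
  refine ENNReal.ofReal_le_ofReal ?_
  calc 14 * X + 3 * m j * (s j * (X + Real.exp 1 * s j * (2 * Y)))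
      ≤ 14 * Z + 3 * m j * (s j * (Z + Real.exp 1 * s j * (2 * Z))) := by gcongr
    _ = H j * Z := by
        simp only [H]
        ring
    _ ≤ A * (j : ℝ) ^ q * Z := by
        have : H j ≤ A * (j : ℝ) ^ q := by linarith
        gcongr

end BadBoxBound

/-! ### Gluing good boxes -/

section Gluing

variable {d N : ℕ}

lemma adj_emb (h1 : (1 : ZMod N) ≠ 0) (z : Torus d N) {x y : Lat d} (h : adj x y) :
    adj (emb z x) (emb z y) := by
  obtain ⟨p, rfl⟩ := (adj_iff_dir one_ne_zero x y).1 h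
  exact (adj_iff_dir h1 _ _).2 ⟨p, (emb_add_dir z x p).symm⟩

lemma adj_add_right {R : Type*} [AddCommGroupWithOne R] (v : Fin d → R) {x y : Fin d → R} (h : adj x y) :
    adj (x + v) (y + v) := by
  obtain ⟨hne, i, hi, hj⟩ := h
  refine ⟨fun e => hne (add_right_cancel e), i, ?_, fun j hji => by simp [hj j hji]⟩
  rcases hi with hi | hi
  · left
    simp only [Pi.add_apply, hi]
    abel
  · right
    simp only [Pi.add_apply, hi]
    abel

/-- Paths in the torus lift to the lattice. -/
lemma exists_lift (h1 : (1 : ZMod N) ≠ 0) {A : Set (Torus d N)} {z y : Torus d N}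
    (h : connectedIn adj Aᶜ z y) :
    ∃ Y : Lat d, emb z Y = y ∧ connectedIn adj (emb z ⁻¹' A)ᶜ 0 Y := by
  have e0 : emb z (0 : Lat d) = z := by
    ext i
    simp [emb, proj]
  refine h.induct (motive := fun y => ∃ Y : Lat d, emb z Y = y ∧
    connectedIn adj (emb z ⁻¹' A)ᶜ 0 Y) ⟨0, e0, connectedIn_refl ?_⟩ ?_
  · simp only [Set.mem_compl_iff, Set.mem_preimage, e0]
    exact h.left_mem
  · rintro a b - hb hab ⟨Y, rfl, hY⟩
    obtain ⟨p, rfl⟩ := (adj_iff_dir h1 _ _).1 hab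
    refine ⟨Y + dir p, (emb_add_dir z Y p).symm, hY.step ?_ ((adj_iff_dir one_ne_zero _ _).2 ⟨p, rfl⟩)⟩
    simpa only [Set.mem_compl_iff, Set.mem_preimage, ← emb_add_dir] using hb

lemma connectedIn_line [NeZero N] (h1 : (1 : ZMod N) ≠ 0)
    {Q : Set (Torus d N)} {z : Torus d N} (i : Fin d)
    (hQ : ∀ s, Function.update z i s ∈ Q) (s : ZMod N) :
    connectedIn adj Q z (Function.update z i s) := by
  have key : ∀ k : ℕ, connectedIn adj Q z (Function.update z i (z i + k)) := by
    intro k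
    induction k with
    | zero =>
      have := hQ (z i)
      rw [Function.update_eq_self] at this
      simpa using connectedIn_refl this
    | succ k ih =>
      refine ih.step (hQ _) ?_
      rw [adj_iff_dir h1]
      refine ⟨(i, true), ?_⟩
      ext j
      by_cases hj : j = i
      · subst hj
        simp [dir, add_assoc]
      · simp [dir, hj]
  have := key (s - z i).val
  rwa [ZMod.natCast_zmod_val, add_sub_cancel] at this

/-- Any two points, each having a coordinate avoiding `J i` and one avoiding `J' i`, are joined
through such points. -/
lemma connectedIn_of_coordinates (hd : 3 ≤ d) [NeZero N] (h1 : (1 : ZMod N) ≠ 0)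
    {J J' : Fin d → Set (ZMod N)} {g : Torus d N} (hg : ∀ i, g i ∉ J i ∧ g i ∉ J' i)
    {z : Torus d N} (hz : (∃ i, z i ∉ J i) ∧ ∃ i, z i ∉ J' i) :
    connectedIn adj {z : Torus d N | (∃ i, z i ∉ J i) ∧ ∃ i, z i ∉ J' i} z g := by
  obtain ⟨⟨i, hi⟩, i', hi'⟩ := hz
  obtain ⟨k, hk, hk'⟩ : ∃ k : Fin d, k ≠ i ∧ k ≠ i' := by
    have : ∃ k : Fin d, k ∉ ({i, i'} : Finset (Fin d)) := by
      by_contra hcon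
      push Not at hcon
      have h2 : (Finset.univ : Finset (Fin d)).card ≤ ({i, i'} : Finset (Fin d)).card :=
        Finset.card_le_card fun x _ => hcon x
      have := Finset.card_le_two (a := i) (b := i')
      simp only [Finset.card_univ, Fintype.card_fin] at h2
      omega
    obtain ⟨k, hk⟩ := this
    simp only [Finset.mem_insert, Finset.mem_singleton, not_or] at hk
    exact ⟨k, hk⟩
  have s1 := connectedIn_line (Q := {z : Torus d N | (∃ i, z i ∉ J i) ∧ ∃ i, z i ∉ J' i})
    h1 k (z := z) (fun s => ⟨⟨i, by rwa [Function.update_of_ne hk.symm]⟩,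
      i', by rwa [Function.update_of_ne hk'.symm]⟩) (g k)
  set y := Function.update z k (g k) with hy
  have hyk : y k = g k := Function.update_self _ _ _
  refine s1.trans ?_
  have key : ∀ T : Finset (Fin d), connectedIn adj
      {z : Torus d N | (∃ i, z i ∉ J i) ∧ ∃ i, z i ∉ J' i} y (fun l => if l ∈ T then g l else y l) := by
    intro T
    induction T using Finset.induction_on with
    | empty => exact connectedIn_refl s1.right_mem
    | insert l T hl ih =>
      by_cases hlk : l = k
      · have e : (fun m => if m ∈ insert l T then g m else y m) = fun m => if m ∈ T then g m else y m := by
          funext m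
          by_cases hm : m = l
          · subst hm
            simp [hlk, hyk]
          · simp [hm]
        rw [e]
        exact ih
      · have e : (fun m => if m ∈ insert l T then g m else y m) =
            Function.update (fun m => if m ∈ T then g m else y m) l (g l) := by
          funext m
          by_cases hm : m = l
          · subst hm
            simp
          · simp [hm]
        rw [e]
        refine ih.trans (connectedIn_line h1 l (fun s => ?_) (g l))
        have hval : Function.update (fun m => if m ∈ T then g m else y m) l s k = g k := by
          rw [Function.update_of_ne (Ne.symm hlk)]
          simp [hyk]
        exact ⟨⟨k, by rw [hval]; exact (hg k).1⟩, k, by rw [hval]; exact (hg k).2⟩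
  simpa using key Finset.univ

lemma mem_image_emb_iff {r : ℕ} {a z : Torus d N} :
    a ∈ (box d r).image (emb z) ↔ ∀ i, ∃ k : ℤ, |k| ≤ r ∧ a i = z i + k := by
  rw [Finset.mem_image]
  constructor
  · rintro ⟨x, hx, rfl⟩ i
    exact ⟨x i, mem_box.1 hx i, rfl⟩
  · intro h
    choose x hx hxa using h
    exact ⟨x, mem_box.2 hx, funext fun i => (hxa i).symm⟩

lemma diamOf_image_add (S : Set (Lat d)) (v : Lat d) :
    diamOf latDist ((fun x => x + v) '' S) = diamOf latDist S := by
  unfold diamOf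
  congr 1
  ext n
  constructor
  · rintro ⟨_, ⟨x, hx, rfl⟩, _, ⟨y, hy, rfl⟩, h⟩
    exact ⟨x, hx, y, hy, by simpa [latDist] using h⟩
  · rintro ⟨x, hx, y, hy, h⟩
    exact ⟨_, ⟨x, hx, rfl⟩, _, ⟨y, hy, rfl⟩, by simpa [latDist] using h⟩

lemma IsConnSet.image_add {S : Set (Lat d)} (h : IsConnSet adj S) (v : Lat d) :
    IsConnSet adj ((fun x => x + v) '' S) := by
  rintro _ ⟨x, hx, rfl⟩ _ ⟨y, hy, rfl⟩
  exact (h x hx y hy).image (f := fun x => x + v) (fun a b hab => adj_add_right v hab)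
    fun a ha => Set.mem_image_of_mem _ ha

lemma Good.connectedIn (h1 : (1 : ZMod N) ≠ 0) {A : Set (Torus d N)} {z : Torus d N} {L : ℕ}
    (hg : Good L (emb z ⁻¹' A)) {S₁ S₂ : Set (Lat d)}
    (hS₁ : S₁ ⊆ (emb z ⁻¹' A)ᶜ ∩ latBall 0 (L : ℝ)) (hS₂ : S₂ ⊆ (emb z ⁻¹' A)ᶜ ∩ latBall 0 (L : ℝ))
    (hc₁ : IsConnSet adj S₁) (hc₂ : IsConnSet adj S₂)
    (hd₁ : (L : ℝ) / 8 ≤ (diamOf latDist S₁ : ℝ)) (hd₂ : (L : ℝ) / 8 ≤ (diamOf latDist S₂ : ℝ))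
    {x y : Lat d} (hx : x ∈ S₁) (hy : y ∈ S₂) : Frag.connectedIn adj Aᶜ (emb z x) (emb z y) := by
  obtain ⟨x', hx', y', hy', h⟩ := hg.2 S₁ S₂ hS₁ hS₂ hc₁ hc₂ hd₁ hd₂
  have hf : ∀ a b : Lat d, adj a b → adj (emb z a) (emb z b) := fun a b hab => adj_emb h1 z hab
  exact (((hc₁ x hx x' hx').image hf fun a ha => (hS₁ ha).1).trans
    (h.image hf fun a ha => ha.1)).trans ((hc₂ y' hy' y hy).image hf fun a ha => (hS₂ ha).1)

lemma nonempty_of_diamOf_pos {S : Set (Lat d)} (h : 0 < diamOf latDist S) : S.Nonempty := by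
  by_contra hS
  rw [Set.not_nonempty_iff_eq_empty] at hS
  subst hS
  simp [diamOf] at h

lemma exists_notMem_intervals {r : ℕ} [NeZero N] (hN : 2 * (2 * r + 1) < N) (s t : ZMod N) :
    ∃ g : ZMod N, (¬ ∃ k : ℤ, |k| ≤ r ∧ s = g + k) ∧ ¬ ∃ k : ℤ, |k| ≤ r ∧ t = g + k := by
  set U : Finset (ZMod N) := (Finset.Icc (-(r : ℤ)) r).image (fun k : ℤ => s - k) ∪
    (Finset.Icc (-(r : ℤ)) r).image (fun k : ℤ => t - k) with hU
  have hcard : U.card < (Finset.univ : Finset (ZMod N)).card := by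
    refine (Finset.card_union_le _ _).trans_lt ?_
    have h1 := Finset.card_image_le (s := Finset.Icc (-(r : ℤ)) r) (f := fun k : ℤ => s - (k : ZMod N))
    have h2 := Finset.card_image_le (s := Finset.Icc (-(r : ℤ)) r) (f := fun k : ℤ => t - (k : ZMod N))
    rw [Int.card_Icc] at h1 h2
    rw [Finset.card_univ, ZMod.card]
    omega
  obtain ⟨g, -, hg⟩ := Finset.exists_mem_notMem_of_card_lt_card hcard
  rw [hU, Finset.mem_union, not_or] at hg
  refine ⟨g, ?_, ?_⟩
  · rintro ⟨k, hk, rfl⟩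
    exact hg.1 (Finset.mem_image.2 ⟨k, Finset.mem_Icc.2 (abs_le.1 hk), by ring⟩)
  · rintro ⟨k, hk, rfl⟩
    exact hg.2 (Finset.mem_image.2 ⟨k, Finset.mem_Icc.2 (abs_le.1 hk), by ring⟩)

lemma mem_image_emb_comm {r : ℕ} {a z : Torus d N} :
    a ∈ (box d r).image (emb z) ↔ z ∈ (box d r).image (emb a) := by
  rw [mem_image_emb_iff, mem_image_emb_iff]
  refine forall_congr' fun i => ⟨?_, ?_⟩ <;>
  · rintro ⟨k, hk, h⟩
    exact ⟨-k, by rwa [abs_neg], by rw [h]; push_cast; ring⟩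

/-- If all boxes away from `a` and `b` are good, there is only one large vacant cluster. -/
lemma connectedIn_of_good (hd : 3 ≤ d) [NeZero N] {n L : ℕ} (hL : L = 8 * n) (hn : 1 ≤ n)
    (hN : 2 * (4 * L + 1) < N) {A : Set (Torus d N)} {a b : Torus d N}
    (hgood : ∀ z, a ∉ (box d (2 * L)).image (emb z) → b ∉ (box d (2 * L)).image (emb z) →
      Good L (emb z ⁻¹' A)) {x y : Torus d N}
    (hxc : 2 * (4 * L + 1) ^ d < (compOf adj Aᶜ x).ncard)
    (hyc : 2 * (4 * L + 1) ^ d < (compOf adj Aᶜ y).ncard) : connectedIn adj Aᶜ x y := by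
  have h1 : (1 : ZMod N) ≠ 0 := by
    intro h
    have : ((1 : ℕ) : ZMod N) = 0 := by exact_mod_cast h
    rw [ZMod.natCast_eq_zero_iff] at this
    have := Nat.le_of_dvd one_pos this
    omega
  have hLR : (L : ℝ) = 8 * n := by
    rw [hL]
    push_cast
    rfl
  have hnR : (1 : ℝ) ≤ n := by exact_mod_cast hn
  let J : Torus d N → Fin d → Set (ZMod N) := fun a i => {s | ∃ k : ℤ, |k| ≤ (2 * L : ℕ) ∧ a i = s + k}
  let Q : Set (Torus d N) := {z | (∃ i, z i ∉ J a i) ∧ ∃ i, z i ∉ J b i}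
  have hQ : ∀ z, z ∈ Q ↔ a ∉ (box d (2 * L)).image (emb z) ∧ b ∉ (box d (2 * L)).image (emb z) := by
    intro z
    rw [mem_image_emb_iff, mem_image_emb_iff, not_forall, not_forall]
    rfl
  have hgQ : ∀ z ∈ Q, Good L (emb z ⁻¹' A) := fun z hz => hgood z ((hQ z).1 hz).1 ((hQ z).1 hz).2
  have hseed : ∀ z ∈ Q, ∃ S : Set (Lat d), (S ⊆ (emb z ⁻¹' A)ᶜ ∩ latBall 0 ((L : ℝ) / 2) ∧
      IsConnSet adj S ∧ (L : ℝ) / 8 ≤ (diamOf latDist S : ℝ)) ∧ S.Nonempty := by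
    intro z hz
    obtain ⟨S, hS⟩ := (hgQ z hz).1
    refine ⟨S, hS, nonempty_of_diamOf_pos ?_⟩
    have := hS.2.2
    have h0 : (0 : ℝ) < (diamOf latDist S : ℝ) := by linarith
    exact_mod_cast h0
  choose! S hS hne using hseed
  choose! v hv using hne
  have hSL : ∀ z ∈ Q, S z ⊆ (emb z ⁻¹' A)ᶜ ∩ latBall 0 (L : ℝ) := fun z hz =>
    (hS z hz).1.trans (Set.inter_subset_inter_right _ (latBall_subset (by linarith) 0))
  -- seeds of neighbouring points are joined
  have hstep : ∀ z z', z ∈ Q → z' ∈ Q → adj z z' →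
      connectedIn adj Aᶜ (emb z (v z)) (emb z' (v z')) := by
    intro z z' hz hz' hzz
    obtain ⟨p, rfl⟩ := (adj_iff_dir h1 _ _).1 hzz
    have hemb : ∀ x : Lat d, emb (z + dir p) x = emb z (x + dir p) := by
      intro x
      rw [← emb_add_dir]
      simp only [emb]
      abel
    have := (hgQ z hz).connectedIn h1 (hSL z hz) (S₂ := (fun x => x + dir p) '' S (z + dir p)) ?_
      (hS z hz).2.1 ((hS _ hz').2.1.image_add _) (hS z hz).2.2
      (by rw [diamOf_image_add]; exact (hS _ hz').2.2) (hv z hz) ⟨_, hv _ hz', rfl⟩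
    · rwa [← hemb] at this
    · rintro _ ⟨x, hx, rfl⟩
      have hx' := (hS _ hz').1 hx
      refine ⟨?_, ?_⟩
      · have := hx'.1
        simp only [Set.mem_compl_iff, Set.mem_preimage, hemb] at this ⊢
        exact this
      · have h4 : x ∈ latBall (0 : Lat d) ((4 * n : ℕ) : ℝ) := by
          refine latBall_subset ?_ 0 hx'.2
          push_cast
          linarith
        show x + dir p ∈ latBall (0 : Lat d) (L : ℝ)
        rw [mem_latBall_natCast, mem_box] at h4 ⊢
        intro i
        have h5 := h4 i
        have h6 := dir_int_abs_le p i
        have h7 := abs_add_le (x i) ((dir p : Lat d) i)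
        simp only [Pi.add_apply]
        push_cast at h5
        omega
  have hjoin : ∀ z z', z ∈ Q → connectedIn adj Q z z' →
      connectedIn adj Aᶜ (emb z (v z)) (emb z' (v z')) := by
    intro z z' hz h
    refine h.induct (motive := fun z' => connectedIn adj Aᶜ (emb z (v z)) (emb z' (v z'))) ?_ ?_
    · exact connectedIn_refl ((hS z hz).1 (hv z hz)).1
    · intro p q hp hq hpq h
      exact h.trans (hstep p q hp hq hpq)
  choose g hga hgb using fun i => exists_notMem_intervals (r := 2 * L) (by omega) (a i) (b i)
  have hgJ : ∀ i, g i ∉ J a i ∧ g i ∉ J b i := fun i => ⟨hga i, hgb i⟩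
  -- a large cluster is joined to the seed of `g`
  have hlarge : ∀ x, 2 * (4 * L + 1) ^ d < (compOf adj Aᶜ x).ncard →
      connectedIn adj Aᶜ x (emb g (v g)) := by
    intro x hx
    have hzex : ∃ z ∈ compOf adj Aᶜ x, z ∈ Q := by
      by_contra hcon
      push Not at hcon
      have hsub : compOf adj Aᶜ x ⊆
          (((box d (2 * L)).image (emb a) ∪ (box d (2 * L)).image (emb b) : Finset (Torus d N)) : Set _) := by
        intro z hz
        have := hcon z hz
        rw [hQ, not_and_or, not_not, not_not, mem_image_emb_comm, mem_image_emb_comm (a := b)] at this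
        exact Finset.mem_coe.2 (Finset.mem_union.2 this)
      have h2 := Set.ncard_le_ncard hsub (Finset.finite_toSet _)
      rw [Set.ncard_coe_finset] at h2
      have h3 := Finset.card_union_le ((box d (2 * L)).image (emb a)) ((box d (2 * L)).image (emb b))
      have h4 := Finset.card_image_le (s := box d (2 * L)) (f := emb a)
      have h5 := Finset.card_image_le (s := box d (2 * L)) (f := emb b)
      rw [card_box, show 2 * (2 * L) + 1 = 4 * L + 1 by ring] at h4 h5
      omega
    obtain ⟨z, hzx, hzQ⟩ := hzex
    have hyex : ∃ y ∈ compOf adj Aᶜ x, y ∉ (box d (2 * n)).image (emb z) := by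
      by_contra hcon
      push Not at hcon
      have hsub : compOf adj Aᶜ x ⊆ (((box d (2 * n)).image (emb z) : Finset (Torus d N)) : Set _) :=
        fun y hy => Finset.mem_coe.2 (hcon y hy)
      have h2 := Set.ncard_le_ncard hsub (Finset.finite_toSet _)
      rw [Set.ncard_coe_finset] at h2
      have h4 := Finset.card_image_le (s := box d (2 * n)) (f := emb z)
      rw [card_box] at h4
      have h5 : (2 * (2 * n) + 1) ^ d ≤ (4 * L + 1) ^ d := Nat.pow_le_pow_left (by omega) d
      omega
    obtain ⟨y, hyx, hyn⟩ := hyex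
    have hzy : connectedIn adj Aᶜ z y := (connectedIn.symm adj_symm hzx).trans hyx
    obtain ⟨Y, hY, hconn⟩ := exists_lift h1 hzy
    obtain ⟨S', hS'1, hS'2, hS'3, hS'4⟩ := exists_connSet_of_connectedIn (n := n)
      (mem_latBall_natCast.2 (mem_box.2 fun i => by simp)) hconn
      (fun h => hyn (Finset.mem_image.2 ⟨Y, h, hY⟩))
    have hlink := (hgQ z hzQ).connectedIn h1 (S₁ := S') (S₂ := S z)
      (hS'1.trans (Set.inter_subset_inter_right _ (latBall_subset (by push_cast; linarith) 0)))
      (hSL z hzQ) hS'2 (hS z hzQ).2.1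
      (by have : (n : ℝ) ≤ (diamOf latDist S' : ℝ) := by exact_mod_cast hS'4
          linarith) (hS z hzQ).2.2 hS'3 (hv z hzQ)
    have e0 : emb z (0 : Lat d) = z := by
      ext i
      simp [emb, proj]
    rw [e0] at hlink
    exact (hzx.trans hlink).trans (hjoin z g hzQ (connectedIn_of_coordinates hd h1 hgJ hzQ))
  exact (hlarge x hxc).trans (connectedIn.symm adj_symm (hlarge y hyc))

end Gluing

/-! ### Polylogarithmic scales -/

section Conclusion

lemma eventually_log_pow_le (C : ℝ) (m : ℕ) :
    ∀ᶠ N : ℕ in atTop, C * Real.log N ^ m ≤ N := by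
  have h := (Real.isLittleO_pow_log_id_atTop (n := m)).comp_tendsto tendsto_natCast_atTop_atTop
  have h2 := h.bound (c := (|C| + 1)⁻¹) (by positivity)
  filter_upwards [h2] with N hN
  simp only [Function.comp_apply, Real.norm_eq_abs, id, Nat.abs_cast] at hN
  have hC : 0 < |C| + 1 := by positivity
  rw [inv_mul_eq_div, le_div_iff₀ hC] at hN
  have h3 := abs_nonneg (Real.log N ^ m)
  calc C * Real.log N ^ m ≤ |C * Real.log N ^ m| := le_abs_self _
    _ = |C| * |Real.log N ^ m| := abs_mul _ _
    _ ≤ N := by nlinarith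

lemma tendsto_log_natCast : Tendsto (fun N : ℕ => Real.log N) atTop atTop :=
  Real.tendsto_log_atTop.comp tendsto_natCast_atTop_atTop

lemma natCast_ceil_pow_le {l : ℝ} (hl : 1 ≤ l) (k q : ℕ) :
    ((⌈l ^ k⌉₊ : ℕ) : ℝ) ^ q ≤ 2 ^ q * l ^ (k * q) := by
  have h1 : (1 : ℝ) ≤ l ^ k := one_le_pow₀ hl
  have h2 := (Nat.ceil_lt_add_one (by positivity : 0 ≤ l ^ k)).le
  calc ((⌈l ^ k⌉₊ : ℕ) : ℝ) ^ q ≤ (2 * l ^ k) ^ q := by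
        gcongr
        linarith
    _ = _ := by rw [mul_pow, pow_mul]

lemma tsum_unifInit_le (d N : ℕ) [NeZero N] : ∑' x, unifInit d N x ≤ 1 := by
  rw [tsum_fintype]
  simp only [unifInit, Finset.sum_const, Finset.card_univ, Fintype.card_pi, ZMod.card,
    Finset.prod_const, Fintype.card_fin, nsmul_eq_mul]
  push_cast
  exact ENNReal.mul_inv_le_one _

lemma measure_exists_le_card_mul {d N : ℕ} [NeZero N] {Ω : Type*} [MeasurableSpace Ω] {μ : Measure Ω}
    {E : Torus d N → Set Ω} {p : ℝ} (hE : ∀ z, μ (E z) ≤ ENNReal.ofReal p) (hp : 0 ≤ p) :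
    (μ (⋃ z, E z)).toReal ≤ (N : ℝ) ^ d * p := by
  refine ENNReal.toReal_le_of_le_ofReal (by positivity) ?_
  refine (measure_iUnion_fintype_le μ E).trans ((Finset.sum_le_sum fun z _ => hE z).trans ?_)
  rw [Finset.sum_const, nsmul_eq_mul, Finset.card_univ, ENNReal.ofReal_mul (by positivity)]
  refine le_of_eq ?_
  congr 1
  rw [← Nat.cast_pow, ENNReal.ofReal_natCast]
  simp [ZMod.card]

/-- Scale choice: with `j` a large power of `log N`, all the requirements hold. -/
lemma eventually_scale (d : ℕ) {γ c A : ℝ} (q J : ℕ) (hγ : 0 < γ) (hc : 0 < c) :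
    ∃ lam : ℕ, 0 < lam ∧ ∀ ρ : ℝ, ∀ᶠ N : ℕ in atTop, ∃ j : ℕ, J ≤ j ∧ 1 ≤ j ∧
      A * (j : ℝ) ^ q ≤ N ∧ 2 * (4 * (8 * j ^ 2) + 1) < N ∧
      2 * (4 * (8 * (j : ℝ) ^ 2) + 1) ^ d ≤ Real.log N ^ lam ∧
      (N : ℝ) ^ d * (A * (j : ℝ) ^ q * Real.exp (-(c * (j : ℝ) ^ γ))) ≤ (N : ℝ) ^ (-ρ) := by
  obtain ⟨k, hk⟩ := exists_nat_ge (2 / γ)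
  have hkγ : 2 ≤ k * γ := by rwa [div_le_iff₀ hγ] at hk
  have hk0 : k ≠ 0 := by
    rintro rfl
    simp at hkγ
    linarith
  refine ⟨k * 2 * d + 1, by omega, fun ρ => ?_⟩
  filter_upwards [eventually_log_pow_le (|A| * 2 ^ q) (k * q), eventually_log_pow_le 265 (k * 2),
    tendsto_log_natCast.eventually_ge_atTop (max 1 (J : ℝ)),
    tendsto_log_natCast.eventually_ge_atTop (2 * 132 ^ d),
    tendsto_log_natCast.eventually_ge_atTop ((d + 1 + ρ) / c), eventually_ge_atTop 1]
    with N h1 h2 h3 h4 h5 h6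
  set l := Real.log N with hl
  have hl1 : 1 ≤ l := (le_max_left _ _).trans h3
  have hlJ : (J : ℝ) ≤ l := (le_max_right _ _).trans h3
  have hl0 : 0 < l := by linarith
  have hN0 : (0 : ℝ) < N := by exact_mod_cast h6
  set j := ⌈l ^ k⌉₊ with hj
  have hjl : l ^ k ≤ j := Nat.le_ceil _
  have hlk : l ≤ l ^ k := le_self_pow₀ hl1 hk0
  have hj1 : (1 : ℝ) ≤ j := by linarith
  have hjq := natCast_ceil_pow_le hl1 k q
  have hj2 := natCast_ceil_pow_le hl1 k 2
  rw [← hj] at hjq hj2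
  have hlk2 : 1 ≤ l ^ (k * 2) := one_le_pow₀ hl1
  have hAj : |A| * (j : ℝ) ^ q ≤ N := by
    refine le_trans ?_ h1
    rw [mul_assoc]
    gcongr
  have hAj' : A * (j : ℝ) ^ q ≤ N := by
    refine le_trans ?_ hAj
    gcongr
    exact le_abs_self _
  refine ⟨j, by exact_mod_cast hlJ.trans (hlk.trans hjl), by exact_mod_cast hj1, hAj', ?_, ?_, ?_⟩
  · have : 2 * (4 * (8 * (j : ℝ) ^ 2) + 1) < N := by nlinarith
    exact_mod_cast this
  · calc 2 * (4 * (8 * (j : ℝ) ^ 2) + 1) ^ d ≤ 2 * (132 * l ^ (k * 2)) ^ d := by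
          gcongr
          nlinarith
      _ = 2 * 132 ^ d * l ^ (k * 2 * d) := by rw [mul_pow, ← pow_mul]; ring
      _ ≤ l * l ^ (k * 2 * d) := by gcongr
      _ = _ := by rw [pow_succ]; ring
  · have hjγ : l ^ 2 ≤ (j : ℝ) ^ γ := by
      calc l ^ 2 = l ^ (2 : ℝ) := by norm_cast
        _ ≤ l ^ (k * γ) := Real.rpow_le_rpow_of_exponent_le hl1 hkγ
        _ = (l ^ k) ^ γ := by rw [Real.rpow_mul hl0.le, Real.rpow_natCast]
        _ ≤ (j : ℝ) ^ γ := by gcongr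
    have h7 : d + 1 + ρ ≤ c * l := by
      rw [div_le_iff₀ hc] at h5
      linarith
    have hNl : (N : ℝ) = Real.exp l := by rw [hl, Real.exp_log hN0]
    calc (N : ℝ) ^ d * (A * (j : ℝ) ^ q * Real.exp (-(c * (j : ℝ) ^ γ)))
        ≤ (N : ℝ) ^ d * (N * Real.exp (-(c * l ^ 2))) := by gcongr
      _ = Real.exp ((d + 1) * l - c * l ^ 2) := by
          rw [hNl, ← Real.exp_nat_mul, ← Real.exp_add, ← Real.exp_add]
          congr 1
          ring
      _ ≤ Real.exp (l * -ρ) := by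
          apply Real.exp_le_exp.2
          nlinarith
      _ = (N : ℝ) ^ (-ρ) := by rw [Real.rpow_def_of_pos hN0]

lemma exists_not_good_of_large {d : ℕ} (hd : 3 ≤ d) {N j t lam : ℕ} [NeZero N] (hj : 1 ≤ j)
    (hN : 2 * (4 * (8 * j ^ 2) + 1) < N)
    (hlam : 2 * (4 * (8 * (j : ℝ) ^ 2) + 1) ^ d ≤ Real.log N ^ lam) {ω : ℕ → Torus d N}
    {x y : Torus d N} (hxy : ¬ connectedIn adj ((visited t ω)ᶜ) x y)
    (hx : Real.log N ^ lam < ((compOf adj ((visited t ω)ᶜ) x).ncard : ℝ))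
    (hy : Real.log N ^ lam < ((compOf adj ((visited t ω)ᶜ) y).ncard : ℝ)) :
    ∃ z : Torus d N, ω 0 ∉ (box d (16 * j ^ 2)).image (emb z) ∧
      ω t ∉ (box d (16 * j ^ 2)).image (emb z) ∧ ¬ Good (8 * j ^ 2) (emb z ⁻¹' visited t ω) := by
  by_contra hcon
  push Not at hcon
  have hc : ∀ x : Torus d N, Real.log N ^ lam < ((compOf adj ((visited t ω)ᶜ) x).ncard : ℝ) →
      2 * (4 * (8 * j ^ 2) + 1) ^ d < (compOf adj ((visited t ω)ᶜ) x).ncard := fun x hx => by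
    have := hlam.trans_lt hx
    exact_mod_cast this
  refine hxy (connectedIn_of_good hd (n := j ^ 2) rfl (Nat.one_le_pow _ _ hj) hN
    (a := ω 0) (b := ω t) (fun z hza hzb => hcon z ?_ ?_) (hc x hx) (hc y hy))
  · rwa [show 16 * j ^ 2 = 2 * (8 * j ^ 2) by ring]
  · rwa [show 16 * j ^ 2 = 2 * (8 * j ^ 2) by ring]

end Conclusion

end Frag

namespace Frag

/-- **Theorem (second largest component is polylogarithmic).**
For `d ≥ 3` and a strongly supercritical `u > 0`, there exists `λ = λ(u) > 0`
such that for every `ρ > 0` there is `c = c(d,u,ρ) > 0` with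
`P[|C^u_sec| > (log N)^λ] ≤ c N^{−ρ}` for all `N ≥ 2`.  The event
`|C^u_sec| > m` is expressed as the existence of two distinct vacant components
each of volume `> m`. -/
theorem second_component_small
    (d : ℕ) (hd : 3 ≤ d) (u : ℝ) (hu : 0 < u)
    (hsup : StronglySupercritical d u) :
    ∃ lam : ℝ, 0 < lam ∧ ∀ ρ : ℝ, 0 < ρ →
      ∃ c : ℝ, 0 < c ∧ ∀ N : ℕ, 2 ≤ N →
        ∀ μ : Measure (ℕ → Torus d N), IsWalkLaw μ (unifInit d N) →
          (μ {ω | ∃ x y : Torus d N,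
              x ∈ (visited (⌊u * (N : ℝ) ^ d⌋₊) ω)ᶜ ∧
              y ∈ (visited (⌊u * (N : ℝ) ^ d⌋₊) ω)ᶜ ∧
              ¬ connectedIn adj ((visited (⌊u * (N : ℝ) ^ d⌋₊) ω)ᶜ) x y ∧
              (Real.log N) ^ lam <
                ((compOf adj ((visited (⌊u * (N : ℝ) ^ d⌋₊) ω)ᶜ) x).ncard : ℝ) ∧
              (Real.log N) ^ lam <
                ((compOf adj ((visited (⌊u * (N : ℝ) ^ d⌋₊) ω)ᶜ) y).ncard : ℝ)}).toReal
            ≤ c * (N : ℝ) ^ (-ρ) := by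
  obtain ⟨γ, c, A, q, J, hγ, hc, hA, hbound⟩ := exists_measure_not_good_le hd hu hsup
  obtain ⟨lam, hlam, hscale⟩ := eventually_scale d (A := A) q J hγ hc
  refine ⟨lam, by exact_mod_cast hlam, fun ρ hρ => ?_⟩
  obtain ⟨N₁, hN₁⟩ := eventually_atTop.1 (hscale ρ)
  refine ⟨((N₁ : ℝ) + 1) ^ ρ, by positivity, fun N hN μ hμ => ?_⟩
  have hNz : NeZero N := ⟨by omega⟩
  have hN0 : (0 : ℝ) < N := by exact_mod_cast (by omega : 0 < N)
  have hprob := hμ.1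
  by_cases hlarge : N₁ ≤ N
  · obtain ⟨j, hJ, hj, hAj, hjN, hjlam, hfin⟩ := hN₁ N hlarge
    have hone : (1 : ℝ) ≤ ((N₁ : ℝ) + 1) ^ ρ := Real.one_le_rpow (by simp) hρ.le
    refine le_trans ?_ (le_mul_of_one_le_left (by positivity) hone)
    refine le_trans ?_ hfin
    refine le_trans (ENNReal.toReal_mono (measure_ne_top _ _) (measure_mono ?_))
      (measure_exists_le_card_mul
        (fun z => hbound j hJ N hNz hAj z μ _ hμ (tsum_unifInit_le d N)) (by positivity))
    rintro ω ⟨x, y, -, -, hxy, hx, hy⟩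
    rw [Real.rpow_natCast] at hx hy
    exact Set.mem_iUnion.2 (exists_not_good_of_large hd hj hjN hjlam hxy hx hy)
  · have h1 : (μ {ω | ∃ x y : Torus d N,
              x ∈ (visited (⌊u * (N : ℝ) ^ d⌋₊) ω)ᶜ ∧
              y ∈ (visited (⌊u * (N : ℝ) ^ d⌋₊) ω)ᶜ ∧
              ¬ connectedIn adj ((visited (⌊u * (N : ℝ) ^ d⌋₊) ω)ᶜ) x y ∧
              (Real.log N) ^ (lam : ℝ) <
                ((compOf adj ((visited (⌊u * (N : ℝ) ^ d⌋₊) ω)ᶜ) x).ncard : ℝ) ∧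
              (Real.log N) ^ (lam : ℝ) <
                ((compOf adj ((visited (⌊u * (N : ℝ) ^ d⌋₊) ω)ᶜ) y).ncard : ℝ)}).toReal ≤ 1 :=
      measureReal_le_one
    refine h1.trans ?_
    rw [Real.rpow_neg hN0.le, ← div_eq_mul_inv, one_le_div (by positivity)]
    have : (N : ℝ) ≤ N₁ + 1 := by
      have : N ≤ N₁ + 1 := by omega
      exact_mod_cast this
    gcongr

end Frag
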